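/- arXiv:2403.02492 — 3 statements merged into one kernel-verified Lean document; each statement's English description precedes it below -/
import Mathlib

section
/- Every Σ⁰₃ equivalence relation on ℕ computably reduces to the isomorphism problem for recursively presented groups: there is a fixed computable generating set X and, for every Σ⁰₃ equivalence relation E on ℕ, a total computable function taking each index n to an index of a c.e. presentation over X, such that n E m iff the presented groups are isomorphic. -/
/-- The `e`-th computably enumerable subset of `ℕ`: the domain of the `e`-th partial
computable function. -/
def W (e : ℕ) : Set ℕ := {n | ((Denumerable.ofNat Nat.Partrec.Code e).eval n).Dom}

/-- A set `S ⊆ ℕ` is Σ⁰₃ if there is a computable predicate `R ⊆ ℕ⁴` with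
`n ∈ S ↔ ∃x ∀y ∃z, R n x y z`. -/
def IsSigma03 (S : Set ℕ) : Prop :=
  ∃ R : ℕ → ℕ → ℕ → ℕ → Bool,
    (Computable fun p : ℕ × ℕ × ℕ × ℕ => R p.1 p.2.1 p.2.2.1 p.2.2.2) ∧
    ∀ n, n ∈ S ↔ ∃ x, ∀ y, ∃ z, R n x y z = true

/-- A binary relation on `ℕ` is Σ⁰₃ if the corresponding set of codes of pairs
(under the standard computable pairing) is Σ⁰₃. -/
def Sigma03Rel (E : ℕ → ℕ → Prop) : Prop :=
  IsSigma03 {p : ℕ | E p.unpair.1 p.unpair.2}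

/-- `E` computably reduces to `F`: there is a total computable `Φ` with
`m E n ↔ Φ(m) F Φ(n)`. -/
def ComputableReduction (E F : ℕ → ℕ → Prop) : Prop :=
  ∃ Φ : ℕ → ℕ, Computable Φ ∧ ∀ m n, E m n ↔ F (Φ m) (Φ n)

/-- Code of an element of the free group on a set `X ⊆ ℕ` of generators, via its reduced
word (with each generator coded by its value in `ℕ`). -/
def encodeFGX {X : Set ℕ} (g : FreeGroup X) : ℕ :=
  Encodable.encode (g.toWord.map fun p => ((p.1 : ℕ), p.2))

/-- The relator set over generators `X ⊆ ℕ` given by the `e`-th c.e. set: elements of the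
free group on `X` whose codes lie in `W e`. -/
def relSetX (X : Set ℕ) (e : ℕ) : Set (FreeGroup X) := {g | encodeFGX g ∈ W e}

/-- Decode a natural number as an element of the free group on generators `X ⊆ ℕ`. -/
noncomputable def decodeWordX (X : Set ℕ) (m : ℕ) : FreeGroup X :=
  FreeGroup.mk
    (((Encodable.decode (α := List (ℕ × Bool)) m).getD []).filterMap fun p =>
      @dite _ (p.1 ∈ X) (Classical.dec _) (fun h => some ((⟨p.1, h⟩ : X), p.2)) fun _ => none)

/-- The word problem of the recursively presented group `⟨X ∣ relSetX X e⟩`: the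
equivalence relation on `ℕ` identifying codes of words whose images in the group coincide. -/
def wordProblemX (X : Set ℕ) (e : ℕ) : ℕ → ℕ → Prop := fun m n =>
  PresentedGroup.mk (relSetX X e) (decodeWordX X m) =
    PresentedGroup.mk (relSetX X e) (decodeWordX X n)

/-- A Σ⁰₃ set has a normal form with primitive recursive matrix in which the value `0` of the
outer quantifier is never a witness. -/
theorem IsSigma03.exists_primrec {S : Set ℕ} (hS : IsSigma03 S) :
    ∃ T : ℕ → ℕ → ℕ → ℕ → Prop,
      PrimrecPred (fun a : ℕ × ℕ × ℕ × ℕ => T a.1 a.2.1 a.2.2.1 a.2.2.2) ∧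
      (∀ n y z, ¬ T n 0 y z) ∧ ∀ n, n ∈ S ↔ ∃ x, ∀ y, ∃ z, T n x y z := by
  obtain ⟨R, hR, hS⟩ := hS
  obtain ⟨c, hc⟩ := Nat.Partrec.Code.exists_code.1 hR
  have key : ∀ n x y z, R n x y z = true ↔
      ∃ s, Nat.Partrec.Code.evaln s c (Encodable.encode (n, x, y, z)) =
        some (Encodable.encode true) := by
    intro n x y z
    have h := @Nat.Partrec.Code.evaln_complete c (Encodable.encode (n, x, y, z))
      (Encodable.encode true)
    simp only [Option.mem_def] at h
    have hval : c.eval (Encodable.encode (n, x, y, z)) =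
        Part.some (Encodable.encode (R n x y z)) := by
      rw [hc]
      simp
    rw [← h, hval]
    cases R n x y z <;> simp
  refine ⟨fun n x y z => 0 < x ∧ Nat.Partrec.Code.evaln z.unpair.2 c
    (Encodable.encode (n, x - 1, y, z.unpair.1)) = some (Encodable.encode true), ?_, ?_, ?_⟩
  · have hz : Primrec fun a : ℕ × ℕ × ℕ × ℕ => a.2.2.2.unpair :=
      Primrec.unpair.comp (Primrec.snd.comp (Primrec.snd.comp Primrec.snd))
    have hx : Primrec fun a : ℕ × ℕ × ℕ × ℕ => a.2.1 := Primrec.fst.comp Primrec.snd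
    have hy : Primrec fun a : ℕ × ℕ × ℕ × ℕ => a.2.2.1 :=
      Primrec.fst.comp (Primrec.snd.comp Primrec.snd)
    refine PrimrecPred.and (Primrec.nat_lt.comp (Primrec.const 0) hx) (Primrec.eq.comp
      (Nat.Partrec.Code.primrec_evaln.comp (((Primrec.snd.comp hz).pair (Primrec.const c)).pair
        (Primrec.encode.comp (Primrec.fst.pair ((Primrec.nat_sub.comp hx (Primrec.const 1)).pair
          (hy.pair (Primrec.fst.comp hz))))))) (Primrec.const _))
  · intro n y z h
    exact absurd h.1 (lt_irrefl 0)
  · intro n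
    rw [hS]
    constructor
    · rintro ⟨x, hx⟩
      refine ⟨x + 1, fun y => ?_⟩
      obtain ⟨z, hz⟩ := hx y
      obtain ⟨s, hs⟩ := (key _ _ _ _).1 hz
      exact ⟨Nat.pair z s, Nat.succ_pos x, by simpa using hs⟩
    · rintro ⟨x, hx⟩
      refine ⟨x - 1, fun y => ?_⟩
      obtain ⟨z, -, hz⟩ := hx y
      exact ⟨z.unpair.1, (key _ _ _ _).2 ⟨_, hz⟩⟩

/-- The s-m-n theorem for decidable predicates: a primitive recursive binary predicate is uniformly
computably enumerable. -/
theorem PrimrecPred.exists_computable_index {P : ℕ → ℕ → Prop}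
    (hP : PrimrecPred fun a : ℕ × ℕ => P a.1 a.2) :
    ∃ Φ : ℕ → ℕ, Computable Φ ∧ ∀ n m, m ∈ W (Φ n) ↔ P n m := by
  obtain ⟨D, hD⟩ := hP
  have hf : Nat.Partrec fun a : ℕ =>
      if P a.unpair.1 a.unpair.2 then Part.some 0 else Part.none := by
    have := Partrec.cond (α := ℕ) (σ := ℕ) (c := fun a => decide (P a.unpair.1 a.unpair.2))
      (hD.to_comp.comp Primrec.unpair.to_comp) (Computable.const 0).partrec Partrec.none
    refine Partrec.nat_iff.1 (this.of_eq fun a => ?_)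
    by_cases h : P a.unpair.1 a.unpair.2 <;> simp [h]
  obtain ⟨c, hc⟩ := Nat.Partrec.Code.exists_code.1 hf
  refine ⟨fun n => Encodable.encode (Nat.Partrec.Code.curry c n), ?_, ?_⟩
  · exact (Primrec.encode.comp
      (Nat.Partrec.Code.primrec₂_curry.comp (Primrec.const c) Primrec.id)).to_comp
  · intro n m
    simp only [W, Denumerable.ofNat_encode, Set.mem_ofPred_eq, Nat.Partrec.Code.eval_curry, hc,
      Nat.unpair_pair]
    by_cases h : P n m <;> simp [h]

/-- If two functions have fibres that are simultaneously infinite or simultaneously empty, then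
they agree up to a permutation of `ℕ`. -/
theorem exists_perm_comp_eq {α : Type*} (f g : ℕ → α)
    (h : ∀ o, (Infinite {b // f b = o} ∧ Infinite {b // g b = o}) ∨
      (IsEmpty {b // f b = o} ∧ IsEmpty {b // g b = o})) :
    ∃ σ : ℕ ≃ ℕ, ∀ b, g (σ b) = f b := by
  have hfib : ∀ o, Nonempty ({b // f b = o} ≃ {b // g b = o}) := by
    intro o
    rcases h o with ⟨_, _⟩ | ⟨_, _⟩
    · exact nonempty_equiv_of_countable
    · exact ⟨Equiv.equivOfIsEmpty _ _⟩
  let F := fun o => (hfib o).some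
  refine ⟨(Equiv.sigmaFiberEquiv f).symm.trans
    ((Equiv.sigmaCongrRight F).trans (Equiv.sigmaFiberEquiv g)), fun b => ?_⟩
  exact (F (f b) ⟨b, rfl⟩).2

/-- Direct sums are isomorphic when their summands are, up to a permutation of the indices. -/
theorem nonempty_dfinsupp_addEquiv {ι : Type*} {A B : ι → AddSubgroup ℚ} (σ : ι ≃ ι)
    (h : ∀ b, Nonempty (A b ≃+ B (σ b))) :
    Nonempty ((Π₀ b, A b) ≃+ (Π₀ b, B b)) := by
  let F := fun b => (h b).some
  exact ⟨(DFinsupp.mapRange.addEquiv F).trans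
    (DirectSum.equivCongrLeft (β := fun b => B b) σ.symm).symm⟩

/-- The subgroup of `ℚ` generated by `q⁻ʸ` for `y` in `Y`. -/
def invPowSubgroup (q : ℕ) (Y : Set ℕ) : AddSubgroup ℚ :=
  AddSubgroup.closure ((fun y : ℕ => ((q : ℚ) ^ y)⁻¹) '' Y)

theorem inv_pow_mem_invPowSubgroup {q : ℕ} {Y : Set ℕ} {y : ℕ} (hy : y ∈ Y) :
    ((q : ℚ) ^ y)⁻¹ ∈ invPowSubgroup q Y :=
  AddSubgroup.subset_closure ⟨y, hy, rfl⟩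

theorem invPowSubgroup_le_zmultiples {q : ℕ} (hq : q ≠ 0) {Y : Set ℕ} {N : ℕ}
    (hN : ∀ y ∈ Y, y ≤ N) :
    invPowSubgroup q Y ≤ AddSubgroup.zmultiples ((q : ℚ) ^ N)⁻¹ := by
  have hq' : (q : ℚ) ≠ 0 := by exact_mod_cast hq
  refine (AddSubgroup.closure_le _).2 ?_
  rintro _ ⟨y, hy, rfl⟩
  refine AddSubgroup.mem_zmultiples_iff.2 ⟨(q : ℤ) ^ (N - y), ?_⟩
  obtain ⟨d, rfl⟩ := Nat.exists_eq_add_of_le (hN y hy)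
  simp only [zsmul_eq_mul, Int.cast_pow, Int.cast_natCast, Nat.add_sub_cancel_left]
  field_simp
  ring

theorem exists_mem_zmultiples_of_mem_invPowSubgroup {q : ℕ} (hq : q ≠ 0) {Y : Set ℕ} {r : ℚ}
    (hr : r ∈ invPowSubgroup q Y) : ∃ (N : ℕ) (a : ℤ), r * (q : ℚ) ^ N = a := by
  have hq' : (q : ℚ) ≠ 0 := by exact_mod_cast hq
  induction hr using AddSubgroup.closure_induction with
  | mem x hx =>
    obtain ⟨y, -, rfl⟩ := hx
    exact ⟨y, 1, by simp [hq']⟩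
  | zero => exact ⟨0, 0, by simp⟩
  | add x y _ _ hx hy =>
    obtain ⟨N, a, ha⟩ := hx
    obtain ⟨M, b, hb⟩ := hy
    refine ⟨N + M, a * q ^ M + b * q ^ N, ?_⟩
    push_cast
    rw [← ha, ← hb]
    ring
  | neg x _ hx =>
    obtain ⟨N, a, ha⟩ := hx
    exact ⟨N, -a, by push_cast; rw [← ha]; ring⟩

/-- For a nonempty bounded set of exponents the generated subgroup of `ℚ` is infinite cyclic. -/
theorem nonempty_addEquiv_int_invPowSubgroup {q : ℕ} (hq : q ≠ 0) {Y : Set ℕ} {N : ℕ}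
    (hN : ∀ y ∈ Y, y ≤ N) (hne : Y.Nonempty) : Nonempty (invPowSubgroup q Y ≃+ ℤ) := by
  have hq' : (q : ℚ) ≠ 0 := by exact_mod_cast hq
  have : IsAddCyclic (invPowSubgroup q Y) :=
    isAddCyclic_of_injective (AddSubgroup.inclusion (invPowSubgroup_le_zmultiples hq hN))
      (AddSubgroup.inclusion_injective _)
  obtain ⟨y, hy⟩ := hne
  have : Infinite (invPowSubgroup q Y) := by
    refine Infinite.of_injective (fun n : ℕ => n • (⟨_, inv_pow_mem_invPowSubgroup hy⟩ :
      invPowSubgroup q Y)) fun m n h => ?_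
    simpa [hq'] using congrArg Subtype.val h
  exact ⟨addEquivOfAddCyclicCardEq (by simp)⟩

theorem Int.eq_zero_of_forall_pow_dvd {p : ℕ} (hp : 1 < p) {a : ℤ} (h : ∀ r : ℕ, (p : ℤ) ^ r ∣ a) :
    a = 0 := by
  by_contra ha
  have := Int.le_of_dvd (abs_pos.2 ha) ((dvd_abs _ _).2 (h a.natAbs))
  have h2 : (a.natAbs : ℤ) < (p : ℤ) ^ a.natAbs := by exact_mod_cast Nat.lt_pow_self hp
  rw [Int.abs_eq_natAbs] at this
  omega

/-- A nonzero element of a subgroup of `ℤ[1/q]` is not infinitely `p`-divisible for `p` prime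
to `q`. -/
theorem eq_zero_of_forall_dvd_of_coprime {p q : ℕ} (hp : 1 < p) (hq : q ≠ 0) (hpq : p.Coprime q)
    {Y : Set ℕ} {r : ℚ} (h : ∀ s : ℕ, ∃ t ∈ invPowSubgroup q Y, (p : ℚ) ^ s * t = r) : r = 0 := by
  have hq' : (q : ℚ) ≠ 0 := by exact_mod_cast hq
  obtain ⟨t, ht, htr⟩ := h 0
  obtain rfl : t = r := by simpa using htr
  obtain ⟨N, a, ha⟩ := exists_mem_zmultiples_of_mem_invPowSubgroup hq ht
  have : a = 0 := by
    refine Int.eq_zero_of_forall_pow_dvd hp fun s => ?_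
    obtain ⟨u, hu, hut⟩ := h s
    obtain ⟨M, b, hb⟩ := exists_mem_zmultiples_of_mem_invPowSubgroup hq hu
    have hab : (a * q ^ M : ℤ) = p ^ s * (b * q ^ N) := by
      have : (a * q ^ M : ℚ) = p ^ s * (b * q ^ N) := by
        rw [← ha, ← hb, ← hut]; ring
      exact_mod_cast this
    refine IsCoprime.dvd_of_dvd_mul_right (z := (q : ℤ) ^ M) ?_ ⟨_, hab⟩
    exact (Nat.isCoprime_iff_coprime.2 hpq).pow
  rw [this] at ha
  simpa [hq'] using ha

/-- A nonzero element of a cyclic subgroup of `ℚ` is not infinitely `p`-divisible. -/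
theorem eq_zero_of_forall_dvd_of_bounded {p q : ℕ} (hp : 1 < p) (hq : q ≠ 0)
    {Y : Set ℕ} {N : ℕ} (hN : ∀ y ∈ Y, y ≤ N) {r : ℚ}
    (h : ∀ s : ℕ, ∃ t ∈ invPowSubgroup q Y, (p : ℚ) ^ s * t = r) : r = 0 := by
  have hq' : (q : ℚ) ≠ 0 := by exact_mod_cast hq
  obtain ⟨t, ht, htr⟩ := h 0
  obtain rfl : t = r := by simpa using htr
  obtain ⟨a, ha⟩ := AddSubgroup.mem_zmultiples_iff.1 (invPowSubgroup_le_zmultiples hq hN ht)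
  have : a = 0 := by
    refine Int.eq_zero_of_forall_pow_dvd hp fun s => ?_
    obtain ⟨u, hu, hut⟩ := h s
    obtain ⟨b, hb⟩ := AddSubgroup.mem_zmultiples_iff.1 (invPowSubgroup_le_zmultiples hq hN hu)
    refine ⟨b, ?_⟩
    have : (a : ℚ) = p ^ s * b := by
      rw [← ha, ← hb] at hut
      simp only [zsmul_eq_mul] at hut
      field_simp at hut
      exact hut.symm
    exact_mod_cast this
  rw [← ha, this, zero_smul]

/-- The exponents attached by `e` to the generators of the block `b`; the block of a generator `i`
is `i.unpair.1`. -/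
def blockExponents (e : ℕ → ℕ) (b : ℕ) : Set ℕ := {y | ∃ i : ℕ, i.unpair.1 = b ∧ e i = y}

/-- The group presented by the construction: the direct sum over all blocks `b` of the subgroup of
`ℚ` generated by the `(q b)⁻ʸ` with `y` an exponent of `b`. -/
abbrev BlockSum (q e : ℕ → ℕ) : Type :=
  Π₀ b : ℕ, invPowSubgroup (q b) (blockExponents e b)

/-- The element of `BlockSum q e` represented by the generator `i`. -/
noncomputable def blockGen (q e : ℕ → ℕ) (i : ℕ) : BlockSum q e :=
  DFinsupp.single i.unpair.1 ⟨((q i.unpair.1 : ℚ) ^ e i)⁻¹, inv_pow_mem_invPowSubgroup ⟨i, rfl, rfl⟩⟩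

/-- The evaluation of words in `BlockSum q e`. -/
noncomputable def blockEval (q e : ℕ → ℕ) :
    FreeGroup (Set.univ : Set ℕ) →* Multiplicative (BlockSum q e) :=
  FreeGroup.lift fun i => Multiplicative.ofAdd (blockGen q e i)

theorem blockEval_surjective (q e : ℕ → ℕ) : Function.Surjective (blockEval q e) := by
  have hgen : ∀ i, blockGen q e i ∈ (MonoidHom.toAdditiveLeft (blockEval q e)).range := fun i =>
    ⟨Additive.ofMul (FreeGroup.of ⟨i, trivial⟩), by simp [blockEval]⟩
  have hsingle : ∀ (b : ℕ) (r : ℚ) (hr : r ∈ invPowSubgroup (q b) (blockExponents e b)),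
      (DFinsupp.single b ⟨r, hr⟩ : BlockSum q e) ∈ (MonoidHom.toAdditiveLeft (blockEval q e)).range := by
    intro b r hr
    induction hr using AddSubgroup.closure_induction with
    | mem x hx =>
      obtain ⟨y, ⟨i, rfl, rfl⟩, rfl⟩ := hx
      exact hgen i
    | zero =>
      convert zero_mem (MonoidHom.toAdditiveLeft (blockEval q e)).range
      exact DFinsupp.single_zero _
    | add x y hx hy ihx ihy =>
      convert add_mem ihx ihy
      exact DFinsupp.single_add (β := fun b => invPowSubgroup (q b) (blockExponents e b)) b
        ⟨x, hx⟩ ⟨y, hy⟩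
    | neg x hx ih =>
      convert neg_mem ih
      exact DFinsupp.single_neg (β := fun b => invPowSubgroup (q b) (blockExponents e b)) b
        ⟨x, hx⟩
  intro f
  have : Multiplicative.toAdd f ∈ (MonoidHom.toAdditiveLeft (blockEval q e)).range := by
    induction Multiplicative.toAdd f using DFinsupp.induction with
    | h0 => exact zero_mem _
    | ha b r f _ _ ih => exact add_mem (hsingle b r r.2) ih
  exact ⟨this.choose.toMul, this.choose_spec⟩

/-- The coordinate of an element of `BlockSum q e` at the block `b`. -/
noncomputable def blockCoord (q e : ℕ → ℕ) (b : ℕ) :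
    Multiplicative (BlockSum q e) →* Multiplicative ℚ :=
  AddMonoidHom.toMultiplicative ((invPowSubgroup (q b) (blockExponents e b)).subtype.comp
    (DFinsupp.evalAddMonoidHom b))

theorem blockCoord_ofAdd_blockGen (q e : ℕ → ℕ) (b i : ℕ) :
    blockCoord q e b (Multiplicative.ofAdd (blockGen q e i)) =
      Multiplicative.ofAdd (if i.unpair.1 = b then ((q b : ℚ) ^ e i)⁻¹ else 0) := by
  change Multiplicative.ofAdd ((blockGen q e i b : ℚ)) = _
  by_cases h : i.unpair.1 = b
  · subst h
    simp [blockGen]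
  · simp [blockGen, h, DFinsupp.single_eq_of_ne (Ne.symm h)]

theorem eq_one_iff_blockCoord {q e : ℕ → ℕ} {f : Multiplicative (BlockSum q e)} :
    f = 1 ↔ ∀ b, blockCoord q e b f = 1 := by
  constructor
  · rintro rfl b
    exact map_one _
  · intro h
    refine Multiplicative.toAdd.injective (DFinsupp.ext fun b => Subtype.ext ?_)
    exact h b

/-- The contribution to the coordinate `b`, scaled by `q b ^ M`, of the letters of sign `s`. -/
def letterSum (q e : ℕ → ℕ) (b M : ℕ) (s : Bool) (L : List (ℕ × Bool)) : ℕ :=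
  L.foldr (fun p acc => (if p.1.unpair.1 = b ∧ p.2 = s then q b ^ (M - e p.1) else 0) + acc) 0

/-- A strict upper bound for the generators occurring in a word. -/
def letterBound (L : List (ℕ × Bool)) : ℕ := L.foldr (fun p acc => p.1 + 1 + acc) 0

theorem lt_letterBound {L : List (ℕ × Bool)} : ∀ p ∈ L, p.1 < letterBound L := by
  induction L with
  | nil => simp
  | cons a L ih =>
    intro p hp
    simp only [letterBound, List.foldr_cons] at ih ⊢
    rcases List.mem_cons.1 hp with rfl | hp
    · omega
    · have := ih p hp
      omega

/-- The arithmetical condition for a word to be trivial in `BlockSum q e`. -/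
def IsTrivialWord (q e : ℕ → ℕ) (L : List (ℕ × Bool)) : Prop :=
  ∀ b < letterBound L,
    letterSum q e b (letterBound L) true L = letterSum q e b (letterBound L) false L

theorem blockCoord_blockEval_mk {q e : ℕ → ℕ} (hq : ∀ b, q b ≠ 0) (he : ∀ i, e i ≤ i) (b M : ℕ)
    (L : List (↥(Set.univ : Set ℕ) × Bool)) (hM : ∀ p ∈ L, (p.1 : ℕ) < M) :
    Multiplicative.toAdd (blockCoord q e b (blockEval q e (FreeGroup.mk L))) * (q b : ℚ) ^ M =
      (letterSum q e b M true (L.map fun p => ((p.1 : ℕ), p.2)) : ℚ) -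
        letterSum q e b M false (L.map fun p => ((p.1 : ℕ), p.2)) := by
  have hqb : (q b : ℚ) ≠ 0 := by exact_mod_cast hq b
  induction L with
  | nil => simp [letterSum, ← FreeGroup.one_eq_mk]
  | cons a L ih =>
    obtain ⟨⟨i, hi⟩, s⟩ := a
    have hiM : i < M := hM _ List.mem_cons_self
    have ih := ih fun p hp => hM p (List.mem_cons_of_mem _ hp)
    have hpow : ((q b : ℚ) ^ e i)⁻¹ * (q b : ℚ) ^ M = (q b : ℚ) ^ (M - e i) := by
      obtain ⟨d, rfl⟩ := Nat.exists_eq_add_of_le ((he i).trans hiM.le)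
      rw [Nat.add_sub_cancel_left, pow_add]
      field_simp
    have hcons : FreeGroup.mk ((⟨i, hi⟩, s) :: L) =
        FreeGroup.mk [(⟨i, hi⟩, s)] * FreeGroup.mk L := by
      rw [FreeGroup.mul_mk, List.singleton_append]
    rw [hcons, map_mul, map_mul, toAdd_mul, add_mul, ih]
    simp only [letterSum, List.map_cons, List.foldr_cons]
    cases s <;> by_cases h : i.unpair.1 = b <;>
      simp [blockEval, FreeGroup.lift_mk, blockCoord_ofAdd_blockGen, h, hpow] <;> ring

theorem letterSum_eq_zero {q e : ℕ → ℕ} {b M : ℕ} {s : Bool} {L : List (ℕ × Bool)}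
    (h : ∀ p ∈ L, p.1 < b) : letterSum q e b M s L = 0 := by
  induction L with
  | nil => rfl
  | cons a L ih =>
    have ha : a.1.unpair.1 ≠ b :=
      ((Nat.unpair_left_le a.1).trans_lt (h a List.mem_cons_self)).ne
    simpa [letterSum, ha] using ih fun p hp => h p (List.mem_cons_of_mem _ hp)

theorem blockEval_eq_one_iff {q e : ℕ → ℕ} (hq : ∀ b, q b ≠ 0) (he : ∀ i, e i ≤ i)
    (g : FreeGroup (Set.univ : Set ℕ)) :
    blockEval q e g = 1 ↔ IsTrivialWord q e (g.toWord.map fun p => ((p.1 : ℕ), p.2)) := by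
  set L := g.toWord.map fun p => ((p.1 : ℕ), p.2) with hL
  have hlt : ∀ p ∈ g.toWord, (p.1 : ℕ) < letterBound L := fun p hp =>
    lt_letterBound (p.1.1, p.2) (List.mem_map.2 ⟨p, hp, rfl⟩)
  have key : ∀ b, blockCoord q e b (blockEval q e g) = 1 ↔
      letterSum q e b (letterBound L) true L = letterSum q e b (letterBound L) false L := by
    intro b
    have h := blockCoord_blockEval_mk hq he b (letterBound L) g.toWord hlt
    rw [FreeGroup.mk_toWord] at h
    have hqb : (q b : ℚ) ^ letterBound L ≠ 0 := pow_ne_zero _ (by exact_mod_cast hq b)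
    rw [← toAdd_eq_zero, ← mul_left_inj' hqb, h, zero_mul, sub_eq_zero, Nat.cast_inj]
  rw [eq_one_iff_blockCoord]
  refine ⟨fun h b _ => (key b).1 (h b), fun h b => (key b).2 ?_⟩
  by_cases hb : b < letterBound L
  · exact h b hb
  · have : ∀ p ∈ L, p.1 < b := fun p hp => (lt_letterBound p hp).trans_le (not_lt.1 hb)
    rw [letterSum_eq_zero this, letterSum_eq_zero this]

/-- The presentation whose relators are the trivial words presents `BlockSum q e`. -/
theorem nonempty_presentedGroup_mulEquiv_blockSum {q e : ℕ → ℕ} (hq : ∀ b, q b ≠ 0)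
    (he : ∀ i, e i ≤ i) {c : ℕ}
    (hc : ∀ L : List (ℕ × Bool), Encodable.encode L ∈ W c ↔ IsTrivialWord q e L) :
    Nonempty (PresentedGroup (relSetX Set.univ c) ≃* Multiplicative (BlockSum q e)) := by
  have hrel : relSetX Set.univ c = ((blockEval q e).ker : Set (FreeGroup (Set.univ : Set ℕ))) := by
    ext g
    rw [SetLike.mem_coe, MonoidHom.mem_ker, blockEval_eq_one_iff hq he, ← hc]
    rfl
  have hker : Subgroup.normalClosure (relSetX Set.univ c) = (blockEval q e).ker := by
    rw [hrel]
    exact Subgroup.normalClosure_eq_self _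
  exact ⟨(QuotientGroup.quotientMulEquivOfEq hker).trans
    (QuotientGroup.quotientKerEquivOfSurjective _ (blockEval_surjective q e))⟩

theorem PrimrecPred.isTrivialWord {q : ℕ → ℕ} (hq : Primrec q) {e : ℕ → ℕ → ℕ}
    (he : Primrec fun a : ℕ × ℕ => e a.1 a.2) :
    PrimrecPred fun a : ℕ × List (ℕ × Bool) => IsTrivialWord q (e a.1) a.2 := by
  have hbound : Primrec letterBound :=
    Primrec.list_foldr (h := fun (_ : List (ℕ × Bool)) (p : (ℕ × Bool) × ℕ) => p.1.1 + 1 + p.2)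
      Primrec.id (Primrec.const 0) (Primrec.nat_add.comp (Primrec.succ.comp
        (Primrec.fst.comp (Primrec.fst.comp Primrec.snd))) (Primrec.snd.comp Primrec.snd))
  have hpow : Primrec₂ fun m n : ℕ => m ^ n := Primrec₂.unpaired'.1 Nat.Primrec.pow
  have hsum : ∀ s, Primrec fun a : ℕ × ℕ × List (ℕ × Bool) =>
      letterSum q (e a.2.1) a.1 (letterBound a.2.2) s a.2.2 := by
    intro s
    have hL : Primrec fun a : ℕ × ℕ × List (ℕ × Bool) => a.2.2 := Primrec.snd.comp Primrec.snd
    have hi : Primrec fun x : (ℕ × ℕ × List (ℕ × Bool)) × (ℕ × Bool) × ℕ => x.2.1.1 :=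
      Primrec.fst.comp (Primrec.fst.comp Primrec.snd)
    have hs : Primrec fun x : (ℕ × ℕ × List (ℕ × Bool)) × (ℕ × Bool) × ℕ => x.2.1.2 :=
      Primrec.snd.comp (Primrec.fst.comp Primrec.snd)
    have hb : Primrec fun x : (ℕ × ℕ × List (ℕ × Bool)) × (ℕ × Bool) × ℕ => x.1.1 :=
      Primrec.fst.comp Primrec.fst
    refine Primrec.list_foldr (h := fun (a : ℕ × ℕ × List (ℕ × Bool)) (p : (ℕ × Bool) × ℕ) =>
      (if p.1.1.unpair.1 = a.1 ∧ p.1.2 = s then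
        q a.1 ^ (letterBound a.2.2 - e a.2.1 p.1.1) else 0) + p.2) hL (Primrec.const 0) ?_
    refine Primrec.nat_add.comp (Primrec.ite ?_ ?_ (Primrec.const 0)) (Primrec.snd.comp Primrec.snd)
    · exact PrimrecPred.and (Primrec.eq.comp (Primrec.fst.comp (Primrec.unpair.comp hi)) hb)
        (Primrec.eq.comp hs (Primrec.const s))
    · exact hpow.comp (hq.comp hb) (Primrec.nat_sub.comp (hbound.comp (hL.comp Primrec.fst))
        (he.comp ((Primrec.fst.comp (Primrec.snd.comp Primrec.fst)).pair hi)))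
  have hrel : PrimrecRel fun (b : ℕ) (a : ℕ × List (ℕ × Bool)) =>
      letterSum q (e a.1) b (letterBound a.2) true a.2 =
        letterSum q (e a.1) b (letterBound a.2) false a.2 :=
    Primrec.eq.comp (hsum true) (hsum false)
  exact (hrel.forall_mem_list.comp (Primrec.list_range.comp (hbound.comp Primrec.snd))
    Primrec.id).of_eq fun a => by simp [IsTrivialWord]

/-- The generator `i` of the `n`-th group codes a block `(k, x, c)`, an exponent `y` and a stage
`t`; it certifies its exponent if the conditions below `y` for `x` to witness the membership of
`(n, k)` have been seen to hold before stage `t`. -/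
def Certifies (T : ℕ → ℕ → ℕ → ℕ → Prop) (n i : ℕ) : Prop :=
  ∀ y < i.unpair.2.unpair.1, ∃ z < i.unpair.2.unpair.2,
    T (Nat.pair n i.unpair.1.unpair.1) i.unpair.1.unpair.2.unpair.1 y z

open Classical in
/-- The exponent of the generator `i` of the `n`-th group. -/
noncomputable def genExponent (T : ℕ → ℕ → ℕ → ℕ → Prop) (n i : ℕ) : ℕ :=
  if Certifies T n i then i.unpair.2.unpair.1 else 0

theorem genExponent_le (T : ℕ → ℕ → ℕ → ℕ → Prop) (n i : ℕ) : genExponent T n i ≤ i := by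
  unfold genExponent
  split_ifs
  · exact (Nat.unpair_left_le _).trans (Nat.unpair_right_le _)
  · exact Nat.zero_le _

open Classical in
theorem Primrec.genExponent {T : ℕ → ℕ → ℕ → ℕ → Prop}
    (hT : PrimrecPred fun a : ℕ × ℕ × ℕ × ℕ => T a.1 a.2.1 a.2.2.1 a.2.2.2) :
    Primrec fun a : ℕ × ℕ => genExponent T a.1 a.2 := by
  have hu : ∀ {α : Type} [Primcodable α] {f : α → ℕ}, Primrec f →
      Primrec (fun a => (f a).unpair.1) ∧ Primrec (fun a => (f a).unpair.2) := fun hf =>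
    ⟨Primrec.fst.comp (Primrec.unpair.comp hf), Primrec.snd.comp (Primrec.unpair.comp hf)⟩
  have h₂ : Primrec fun a : ℕ × ℕ => a.2.unpair.2 := (hu Primrec.snd).2
  have hin : PrimrecRel fun (z : ℕ) (x : ℕ × ℕ × ℕ) =>
      T (Nat.pair x.2.1 x.2.2.unpair.1.unpair.1) x.2.2.unpair.1.unpair.2.unpair.1 x.1 z := by
    have hi : Primrec fun w : ℕ × ℕ × ℕ × ℕ => w.2.2.2.unpair.1 :=
      (hu (Primrec.snd.comp (Primrec.snd.comp Primrec.snd))).1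
    exact hT.comp ((Primrec₂.natPair.comp (Primrec.fst.comp (Primrec.snd.comp Primrec.snd))
      (hu hi).1).pair ((hu (hu hi).2).1.pair ((Primrec.fst.comp Primrec.snd).pair Primrec.fst)))
  have hmid : PrimrecRel fun (y : ℕ) (a : ℕ × ℕ) => ∃ z < a.2.unpair.2.unpair.2,
      T (Nat.pair a.1 a.2.unpair.1.unpair.1) a.2.unpair.1.unpair.2.unpair.1 y z :=
    (hin.exists_mem_list.comp (Primrec.list_range.comp (hu (h₂.comp Primrec.snd)).2)
      Primrec.id).of_eq fun a => by simp
  have hcert : PrimrecPred fun a : ℕ × ℕ => Certifies T a.1 a.2 :=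
    (hmid.forall_mem_list.comp (Primrec.list_range.comp (hu h₂).1) Primrec.id).of_eq
      fun a => by simp [Certifies]
  exact (Primrec.ite hcert (hu h₂).1 (Primrec.const 0)).of_eq fun a => by
    simp only [_root_.genExponent]

/-- The base attached to a block; blocks with distinct first components have coprime bases. -/
def blockBase (b : ℕ) : ℕ := b.unpair.1.fermatNumber

theorem Primrec.blockBase : Primrec blockBase := by
  have hpow : Primrec₂ fun m n : ℕ => m ^ n := Primrec₂.unpaired'.1 Nat.Primrec.pow
  exact Primrec.succ.comp (hpow.comp (Primrec.const 2) (hpow.comp (Primrec.const 2)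
    (Primrec.fst.comp Primrec.unpair)))

theorem one_lt_blockBase (b : ℕ) : 1 < blockBase b :=
  lt_of_lt_of_le (by norm_num) (Nat.three_le_fermatNumber _)

theorem blockBase_ne_zero (b : ℕ) : blockBase b ≠ 0 := (one_lt_blockBase b).ne_bot

/-- The block `b = (k, x, c)` of the `n`-th group is full if `x` witnesses the membership of
`(n, k)`. -/
def IsFullBlock (T : ℕ → ℕ → ℕ → ℕ → Prop) (n b : ℕ) : Prop :=
  ∀ y, ∃ z, T (Nat.pair n b.unpair.1) b.unpair.2.unpair.1 y z

theorem zero_mem_blockExponents (T : ℕ → ℕ → ℕ → ℕ → Prop) (n b : ℕ) :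
    0 ∈ blockExponents (genExponent T n) b :=
  ⟨Nat.pair b (Nat.pair 0 0), by simp, by simp [genExponent]⟩

theorem IsFullBlock.blockExponents_eq_univ {T : ℕ → ℕ → ℕ → ℕ → Prop} {n b : ℕ}
    (h : IsFullBlock T n b) : blockExponents (genExponent T n) b = Set.univ := by
  refine Set.eq_univ_of_forall fun y => ?_
  choose f hf using h
  refine ⟨Nat.pair b (Nat.pair y ((Finset.range y).sup f + 1)), by simp, ?_⟩
  rw [genExponent, if_pos]
  · simp
  · intro y' hy'
    simp only [Nat.unpair_pair] at hy' ⊢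
    exact ⟨f y', Nat.lt_succ_of_le (Finset.le_sup (Finset.mem_range.2 hy')), hf y'⟩

theorem exists_blockExponents_le_of_not_isFullBlock {T : ℕ → ℕ → ℕ → ℕ → Prop} {n b : ℕ}
    (h : ¬ IsFullBlock T n b) :
    ∃ N, ∀ y ∈ blockExponents (genExponent T n) b, y ≤ N := by
  simp only [IsFullBlock, not_forall] at h
  obtain ⟨N, hN⟩ := h
  refine ⟨N, ?_⟩
  rintro _ ⟨i, rfl, rfl⟩
  unfold genExponent
  split_ifs with hi
  · by_contra! hlt
    obtain ⟨z, -, hz⟩ := hi N hlt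
    exact hN ⟨z, hz⟩
  · exact Nat.zero_le _

open Classical in
/-- The isomorphism type of a block: `some k` for a full block with first component `k`, whose
summand is `ℤ[1/q]`, and `none` for a block whose summand is infinite cyclic. -/
noncomputable def blockType (T : ℕ → ℕ → ℕ → ℕ → Prop) (n b : ℕ) : Option ℕ :=
  if IsFullBlock T n b then some b.unpair.1 else none

theorem nonempty_addEquiv_of_blockType_eq {T : ℕ → ℕ → ℕ → ℕ → Prop} {m n b c : ℕ}
    (h : blockType T n c = blockType T m b) :
    Nonempty (invPowSubgroup (blockBase b) (blockExponents (genExponent T m) b) ≃+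
      invPowSubgroup (blockBase c) (blockExponents (genExponent T n) c)) := by
  unfold blockType at h
  by_cases hc : IsFullBlock T n c <;> by_cases hb : IsFullBlock T m b <;> simp [hc, hb] at h
  · rw [hc.blockExponents_eq_univ, hb.blockExponents_eq_univ, blockBase, blockBase, h]
    exact ⟨AddEquiv.refl _⟩
  · obtain ⟨M, hM⟩ := exists_blockExponents_le_of_not_isFullBlock hb
    obtain ⟨N, hN⟩ := exists_blockExponents_le_of_not_isFullBlock hc
    obtain ⟨F⟩ := nonempty_addEquiv_int_invPowSubgroup (blockBase_ne_zero b) hM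
      ⟨0, zero_mem_blockExponents T m b⟩
    obtain ⟨G⟩ := nonempty_addEquiv_int_invPowSubgroup (blockBase_ne_zero c) hN
      ⟨0, zero_mem_blockExponents T n c⟩
    exact ⟨F.trans G.symm⟩

theorem infinite_blockType_eq_none {T : ℕ → ℕ → ℕ → ℕ → Prop} (hT : ∀ p y z, ¬ T p 0 y z)
    (n : ℕ) : Infinite {b // blockType T n b = none} := by
  refine Infinite.of_injective (fun c : ℕ => ⟨Nat.pair 0 (Nat.pair 0 c), ?_⟩) fun c d h => ?_
  · simp [blockType, IsFullBlock, hT]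
  · simpa using h

theorem infinite_blockType_eq_some {T : ℕ → ℕ → ℕ → ℕ → Prop} {n k : ℕ}
    (h : ∃ x, ∀ y, ∃ z, T (Nat.pair n k) x y z) : Infinite {b // blockType T n b = some k} := by
  obtain ⟨x, hx⟩ := h
  refine Infinite.of_injective (fun c : ℕ => ⟨Nat.pair k (Nat.pair x c), ?_⟩) fun c d h => ?_
  · have : IsFullBlock T n (Nat.pair k (Nat.pair x c)) := by simpa [IsFullBlock] using hx
    simp [blockType, this]
  · simpa using h

theorem isEmpty_blockType_eq_some {T : ℕ → ℕ → ℕ → ℕ → Prop} {n k : ℕ}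
    (h : ¬ ∃ x, ∀ y, ∃ z, T (Nat.pair n k) x y z) : IsEmpty {b // blockType T n b = some k} := by
  refine ⟨fun ⟨b, hb⟩ => h ⟨b.unpair.2.unpair.1, ?_⟩⟩
  unfold blockType at hb
  split_ifs at hb with hfull
  obtain rfl := Option.some.inj hb
  exact hfull

theorem nonempty_blockSum_addEquiv {T : ℕ → ℕ → ℕ → ℕ → Prop} (hT : ∀ p y z, ¬ T p 0 y z)
    {m n : ℕ} (h : ∀ k, (∃ x, ∀ y, ∃ z, T (Nat.pair m k) x y z) ↔
      ∃ x, ∀ y, ∃ z, T (Nat.pair n k) x y z) :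
    Nonempty (BlockSum blockBase (genExponent T m) ≃+ BlockSum blockBase (genExponent T n)) := by
  obtain ⟨σ, hσ⟩ := exists_perm_comp_eq (blockType T m) (blockType T n) fun o => by
    cases o with
    | none => exact Or.inl ⟨infinite_blockType_eq_none hT m, infinite_blockType_eq_none hT n⟩
    | some k =>
      by_cases hk : ∃ x, ∀ y, ∃ z, T (Nat.pair m k) x y z
      · exact Or.inl ⟨infinite_blockType_eq_some hk, infinite_blockType_eq_some ((h k).1 hk)⟩
      · exact Or.inr ⟨isEmpty_blockType_eq_some hk,
          isEmpty_blockType_eq_some fun hk' => hk ((h k).2 hk')⟩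
  exact nonempty_dfinsupp_addEquiv σ fun b => nonempty_addEquiv_of_blockType_eq (hσ b)

/-- The `n`-th group has a nonzero infinitely `q`-divisible element, for `q` the `k`-th Fermat
number, exactly when `(n, k)` is a member. -/
theorem exists_divisible_blockSum_iff {T : ℕ → ℕ → ℕ → ℕ → Prop} (n k : ℕ) :
    (∃ f : BlockSum blockBase (genExponent T n), f ≠ 0 ∧
      ∀ s : ℕ, ∃ g : BlockSum blockBase (genExponent T n), k.fermatNumber ^ s • g = f) ↔
    ∃ x, ∀ y, ∃ z, T (Nat.pair n k) x y z := by
  constructor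
  · rintro ⟨f, hf, hdiv⟩
    obtain ⟨b, hb⟩ := DFinsupp.ne_iff.1 hf
    have hb : (f b : ℚ) ≠ 0 := fun h => hb (Subtype.ext h)
    have hdivb : ∀ s : ℕ, ∃ t ∈ invPowSubgroup (blockBase b)
        (blockExponents (genExponent T n) b), (k.fermatNumber : ℚ) ^ s * t = f b := by
      intro s
      obtain ⟨g, rfl⟩ := hdiv s
      exact ⟨g b, (g b).2, by simp⟩
    have hk : 1 < k.fermatNumber := lt_of_lt_of_le (by norm_num) (Nat.three_le_fermatNumber k)
    have hfull : IsFullBlock T n b := by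
      by_contra hfull
      obtain ⟨N, hN⟩ := exists_blockExponents_le_of_not_isFullBlock hfull
      exact hb (eq_zero_of_forall_dvd_of_bounded hk (blockBase_ne_zero b) hN hdivb)
    have hkb : k = b.unpair.1 := by
      by_contra hkb
      exact hb (eq_zero_of_forall_dvd_of_coprime hk (blockBase_ne_zero b)
        (Nat.coprime_fermatNumber_fermatNumber hkb) hdivb)
    subst hkb
    exact ⟨b.unpair.2.unpair.1, hfull⟩
  · rintro ⟨x, hx⟩
    have hfull : IsFullBlock T n (Nat.pair k (Nat.pair x 0)) := by
      simpa [IsFullBlock] using hx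
    set b := Nat.pair k (Nat.pair x 0) with hbdef
    have hbase : blockBase b = k.fermatNumber := by simp [blockBase, hbdef]
    have hmem : ∀ s : ℕ, ((blockBase b : ℚ) ^ s)⁻¹ ∈
        invPowSubgroup (blockBase b) (blockExponents (genExponent T n) b) := fun s =>
      inv_pow_mem_invPowSubgroup (by rw [hfull.blockExponents_eq_univ]; trivial)
    have hq : (blockBase b : ℚ) ≠ 0 := by exact_mod_cast blockBase_ne_zero b
    refine ⟨DFinsupp.single b ⟨_, hmem 0⟩, ?_, fun s => ⟨DFinsupp.single b ⟨_, hmem s⟩, ?_⟩⟩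
    · rw [Ne, DFinsupp.single_eq_zero]
      intro h
      simpa using congrArg Subtype.val h
    · rw [← DFinsupp.single_smul, ← hbase]
      congr 1
      ext
      simp [hq]

/-- Every Σ⁰₃ equivalence relation on `ℕ` computably reduces to the isomorphism problem
for recursively presented groups: there is a fixed computable generating set `X` and, for
every Σ⁰₃ equivalence relation `E`, a total computable function taking each index `n` to
an index of a c.e. presentation over `X` such that `n E m` iff the presented groups are
isomorphic. -/
theorem Sigma03Equiv_reducesTo_isomorphismProblem_recursivelyPresented :
    ∃ X : Set ℕ, ComputablePred (· ∈ X) ∧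
      ∀ E : ℕ → ℕ → Prop, Equivalence E → Sigma03Rel E →
        ∃ Φ : ℕ → ℕ, Computable Φ ∧
          ∀ m n, E m n ↔
            Nonempty (PresentedGroup (relSetX X (Φ m)) ≃* PresentedGroup (relSetX X (Φ n))) := by
  refine ⟨Set.univ, ⟨fun _ => isTrue trivial, Computable.const true⟩, fun E hE hS => ?_⟩
  obtain ⟨T, hT, hT0, hTE⟩ := hS.exists_primrec
  have hmem : ∀ n k, E n k ↔ ∃ x, ∀ y, ∃ z, T (Nat.pair n k) x y z := fun n k => by
    simpa using hTE (Nat.pair n k)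
  obtain ⟨Φ, hΦ, hW⟩ := PrimrecPred.exists_computable_index
    (P := fun n w => IsTrivialWord blockBase (genExponent T n) ((Encodable.decode w).getD []))
    ((PrimrecPred.isTrivialWord Primrec.blockBase (Primrec.genExponent hT)).comp
      (Primrec.fst.pair (Primrec.option_getD.comp (Primrec.decode.comp Primrec.snd)
        (Primrec.const []))))
  refine ⟨Φ, hΦ, fun m n => ?_⟩
  have hpres : ∀ n, Nonempty (PresentedGroup (relSetX Set.univ (Φ n)) ≃*
      Multiplicative (BlockSum blockBase (genExponent T n))) := fun n =>
    nonempty_presentedGroup_mulEquiv_blockSum blockBase_ne_zero (genExponent_le T n) fun L => by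
      simp [hW]
  obtain ⟨F⟩ := hpres m
  obtain ⟨G⟩ := hpres n
  constructor
  · intro h
    obtain ⟨H⟩ := nonempty_blockSum_addEquiv hT0 (m := m) (n := n) fun k => by
      rw [← hmem, ← hmem]
      exact ⟨fun hk => hE.trans (hE.symm h) hk, fun hk => hE.trans h hk⟩
    exact ⟨F.trans ((AddEquiv.toMultiplicative H).trans G.symm)⟩
  · rintro ⟨H⟩
    let K : BlockSum blockBase (genExponent T m) ≃+ BlockSum blockBase (genExponent T n) :=
      AddEquiv.toMultiplicative.symm (F.symm.trans (H.trans G))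
    obtain ⟨f, hf, hdiv⟩ := (exists_divisible_blockSum_iff n n).2 ((hmem n n).1 (hE.refl n))
    refine (hmem m n).2 ((exists_divisible_blockSum_iff m n).1
      ⟨K.symm f, by simpa using hf, fun s => ?_⟩)
    obtain ⟨g, rfl⟩ := hdiv s
    exact ⟨K.symm g, by rw [map_nsmul]⟩
end

section
/- Let (E_i) be the fixed uniform enumeration of all ceers. If S ⊆ ℕ is Σ⁰₃ and proper on the infinite ceers, then [S] is Σ⁰₃-complete: [S] is Σ⁰₃ and every Σ⁰₃ subset of ℕ many-one reduces to [S]. -/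
/-- `E` and `F` are computably equivalent: computable reductions exist in both directions. -/
def CeerEquiv (E F : ℕ → ℕ → Prop) : Prop :=
  ComputableReduction E F ∧ ComputableReduction F E

/-- The fixed uniform enumeration of all ceers: `ceer i` is the equivalence relation
generated by the `i`-th c.e. set `W i` of coded pairs. -/
def ceer (i : ℕ) : ℕ → ℕ → Prop :=
  Relation.EqvGen fun m n => Nat.pair m n ∈ W i

/-- `[S]`: the closure of a set of indices of ceers under computable equivalence. -/
def ceerClosure (S : Set ℕ) : Set ℕ := {i | ∃ j ∈ S, CeerEquiv (ceer i) (ceer j)}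

/-- An equivalence relation on `ℕ` has infinitely many classes iff there is an infinite
family of pairwise inequivalent elements. -/
def HasInfinitelyManyClasses (E : ℕ → ℕ → Prop) : Prop :=
  ∃ f : ℕ → ℕ, ∀ m n, m ≠ n → ¬E (f m) (f n)

/-- `S` is proper on the infinite ceers: some ceer with infinitely many classes has its
index in `[S]` and some ceer with infinitely many classes has its index outside `[S]`. -/
def ProperOnInfiniteCeers (S : Set ℕ) : Prop :=
  ∃ i j, HasInfinitelyManyClasses (ceer i) ∧ HasInfinitelyManyClasses (ceer j) ∧
    i ∈ ceerClosure S ∧ j ∉ ceerClosure S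

namespace CeerIndex

open Nat.Partrec (Code)

/-! ### Computability toolkit -/

section Toolkit

variable {α : Type*} [Primcodable α]

theorem computable_beq {f g : α → ℕ} (hf : Computable f) (hg : Computable g) :
    Computable fun a => f a == g a :=
  (Primrec.beq (α := ℕ)).to_comp.comp hf hg

theorem computable_ble {f g : α → ℕ} (hf : Computable f) (hg : Computable g) :
    Computable fun a => Nat.ble (f a) (g a) := by
  have h : Primrec₂ fun m n : ℕ => Nat.ble m n := by
    refine (Primrec.nat_le.decide).of_eq fun m n => ?_
    rw [Bool.eq_iff_iff]; simp
  exact h.to_comp.comp hf hg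

theorem computable_and {f g : α → Bool} (hf : Computable f) (hg : Computable g) :
    Computable fun a => f a && g a :=
  Primrec.and.to_comp.comp hf hg

theorem computable_or {f g : α → Bool} (hf : Computable f) (hg : Computable g) :
    Computable fun a => f a || g a :=
  Primrec.or.to_comp.comp hf hg

theorem computable_not {f : α → Bool} (hf : Computable f) : Computable fun a => !f a :=
  Primrec.not.to_comp.comp hf

theorem computable_add {f g : α → ℕ} (hf : Computable f) (hg : Computable g) :
    Computable fun a => f a + g a :=
  Primrec.nat_add.to_comp.comp hf hg

theorem computable_pair {f g : α → ℕ} (hf : Computable f) (hg : Computable g) :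
    Computable fun a => Nat.pair (f a) (g a) :=
  Primrec₂.natPair.to_comp.comp hf hg

theorem computable_unpair_fst {f : α → ℕ} (hf : Computable f) :
    Computable fun a => (f a).unpair.1 :=
  Computable.fst.comp (Primrec.unpair.to_comp.comp hf)

theorem computable_unpair_snd {f : α → ℕ} (hf : Computable f) :
    Computable fun a => (f a).unpair.2 :=
  Computable.snd.comp (Primrec.unpair.to_comp.comp hf)

/-- Unbounded search for a number that provably exists is computable. -/
theorem computable_find {P : α → ℕ → Bool} (hP : Computable₂ P) (h : ∀ a, ∃ n, P a n = true) :
    Computable fun a => Nat.find (h a) := by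
  refine (Partrec.rfind (p := fun a n => Part.some (P a n)) hP).of_eq fun a => ?_
  refine Part.eq_some_iff.2 (Nat.mem_rfind.2 ⟨?_, fun {m} hm => ?_⟩)
  · simpa using (Nat.find_spec (h a)).symm
  · simpa using (Nat.find_min (h a) hm)

theorem exists_computable_choice {P : α → ℕ → Bool} (hP : Computable₂ P)
    (h : ∀ a, ∃ n, P a n = true) : ∃ f : α → ℕ, Computable f ∧ ∀ a, P a (f a) = true :=
  ⟨_, computable_find hP h, fun a => Nat.find_spec (h a)⟩

/-- Bounded universal quantification preserves computability. -/
theorem computable_ball {P : α → ℕ → Bool} (hP : Computable₂ P) {k : α → ℕ} (hk : Computable k) :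
    Computable fun a => decide (∀ i < k a, P a i = true) := by
  have h : ∀ a, ∃ n, (Nat.ble (k a) n || !P a n) = true := fun a => ⟨k a, by simp⟩
  have hc : Computable₂ fun a n => Nat.ble (k a) n || !P a n :=
    computable_or (computable_ble (hk.comp .fst) .snd) (computable_not hP)
  refine (computable_ble hk (computable_find hc h)).of_eq fun a => ?_
  rw [Bool.eq_iff_iff]
  simp only [Nat.ble_eq, Nat.le_find_iff, decide_eq_true_eq]
  refine forall₂_congr fun i hi => ?_
  simp [hi]

end Toolkit

/-! ### Finite approximations of ceers by labellings -/

/-- Apply a list of label substitutions, each `(a, b)` replacing the label `b` by `a`. -/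
def relabel (l : List (ℕ × ℕ)) (x : ℕ) : ℕ :=
  l.foldl (fun y r => bif y == r.2 then r.1 else y) x

/-- The pair enumerated into `W e` at stage `s`, or the code of `(0, 0)` if there is none. -/
def gen (e s : ℕ) : ℕ :=
  bif (Code.evaln s.unpair.2 (Denumerable.ofNat Code e) s.unpair.1).isSome then s.unpair.1 else 0

/-- The substitutions performed on labels before stage `s`. -/
def merges (e : ℕ) (s : ℕ) : List (ℕ × ℕ) :=
  Nat.rec [] (fun s l =>
    l ++ [(relabel l (gen e s).unpair.1, relabel l (gen e s).unpair.2)]) s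

/-- The label of the class of `x` in the stage `s` approximation of `ceer e`. -/
def lab (e s x : ℕ) : ℕ := relabel (merges e s) x

theorem lab_succ (e s x : ℕ) : lab e (s + 1) x =
    if lab e s x = lab e s (gen e s).unpair.2 then lab e s (gen e s).unpair.1 else lab e s x := by
  have : merges e (s + 1) = merges e s ++ [(relabel (merges e s) (gen e s).unpair.1,
    relabel (merges e s) (gen e s).unpair.2)] := rfl
  simp only [lab, this]
  simp only [relabel, List.foldl_append, List.foldl_cons, List.foldl_nil]
  simp [Bool.cond_eq_ite]

theorem lab_mono_succ {e s x y : ℕ} (h : lab e s x = lab e s y) :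
    lab e (s + 1) x = lab e (s + 1) y := by
  simp [lab_succ, h]

theorem lab_eventually_id (e s : ℕ) : ∃ N, ∀ x, N ≤ x → lab e s x = x := by
  induction s with
  | zero => exact ⟨0, fun x _ => rfl⟩
  | succ s ih =>
    obtain ⟨N, hN⟩ := ih
    refine ⟨max N (lab e s (gen e s).unpair.2 + 1), fun x hx => ?_⟩
    have h := hN x (by omega)
    rw [lab_succ, h, if_neg (by omega)]

theorem mem_W_iff {e n : ℕ} :
    n ∈ W e ↔ ∃ k, (Code.evaln k (Denumerable.ofNat Code e) n).isSome = true := by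
  simp only [W, Set.mem_ofPred_eq, Part.dom_iff_mem, Code.evaln_complete, Option.isSome_iff_exists,
    Option.mem_def]
  exact exists_comm

theorem ceer_gen (e s : ℕ) : ceer e (gen e s).unpair.1 (gen e s).unpair.2 := by
  unfold gen
  cases h : (Code.evaln s.unpair.2 (Denumerable.ofNat Code e) s.unpair.1).isSome
  · exact .refl _
  · refine .rel _ _ (mem_W_iff.2 ⟨s.unpair.2, ?_⟩)
    simpa using h

theorem ceer_of_lab {e s : ℕ} : ∀ {x y : ℕ}, lab e s x = lab e s y → ceer e x y := by
  induction s with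
  | zero => rintro x y h; cases h; exact .refl _
  | succ s ih =>
    intro x y h
    have hg := ceer_gen e s
    rw [lab_succ, lab_succ] at h
    split_ifs at h with h₁ h₂ h₂
    · exact ih (h₁.trans h₂.symm)
    · exact .trans _ _ _ (ih h₁) (.trans _ _ _ (.symm _ _ hg) (ih h))
    · exact .trans _ _ _ (ih h) (.trans _ _ _ hg (.symm _ _ (ih h₂)))
    · exact ih h

theorem lab_mono {e x y s t : ℕ} (hst : s ≤ t) (h : lab e s x = lab e s y) :
    lab e t x = lab e t y := by
  induction hst with
  | refl => exact h
  | step _ ih => exact lab_mono_succ ih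

theorem ceer_iff {e x y : ℕ} : ceer e x y ↔ ∃ s, lab e s x = lab e s y := by
  refine ⟨fun h => ?_, fun ⟨s, h⟩ => ceer_of_lab h⟩
  induction h with
  | rel m n h =>
    obtain ⟨k, hk⟩ := mem_W_iff.1 h
    refine ⟨Nat.pair (Nat.pair m n) k + 1, ?_⟩
    have hg : gen e (Nat.pair (Nat.pair m n) k) = Nat.pair m n := by simp [gen, hk]
    simp [lab_succ, hg]
  | refl x => exact ⟨0, rfl⟩
  | symm _ _ _ ih => exact ih.imp fun _ => Eq.symm
  | trans _ _ _ _ _ ih₁ ih₂ =>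
    obtain ⟨s, hs⟩ := ih₁
    obtain ⟨t, ht⟩ := ih₂
    exact ⟨max s t, (lab_mono (le_max_left _ _) hs).trans (lab_mono (le_max_right _ _) ht)⟩

theorem primrec_relabel : Primrec₂ relabel := by
  refine Primrec.list_foldl (f := fun p : List (ℕ × ℕ) × ℕ => p.1) (g := fun p => p.2)
    (h := fun _ q => bif q.1 == q.2.2 then q.2.1 else q.1) .fst .snd ?_
  refine Primrec.cond ?_ ?_ ?_
  · exact Primrec.beq.comp (Primrec.fst.comp .snd) (Primrec.snd.comp (Primrec.snd.comp .snd))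
  · exact Primrec.fst.comp (Primrec.snd.comp .snd)
  · exact Primrec.fst.comp .snd

theorem primrec_gen : Primrec₂ gen := by
  have hu : Primrec fun p : ℕ × ℕ => p.2.unpair := Primrec.unpair.comp .snd
  refine Primrec.cond ?_ (Primrec.fst.comp hu) (Primrec.const 0)
  refine Primrec.option_isSome.comp (Code.primrec_evaln.comp (Primrec.pair (Primrec.pair
    (Primrec.snd.comp hu) ((Primrec.ofNat Code).comp .fst)) (Primrec.fst.comp hu)))

theorem primrec_merges : Primrec₂ merges := by
  refine Primrec.nat_rec (f := fun _ : ℕ => ([] : List (ℕ × ℕ))) (g := fun e q =>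
    q.2 ++ [(relabel q.2 (gen e q.1).unpair.1, relabel q.2 (gen e q.1).unpair.2)])
    (Primrec.const _) ?_
  have hl : Primrec fun p : ℕ × ℕ × List (ℕ × ℕ) => p.2.2 := Primrec.snd.comp .snd
  have hg : Primrec fun p : ℕ × ℕ × List (ℕ × ℕ) => (gen p.1 p.2.1).unpair :=
    Primrec.unpair.comp (primrec_gen.comp .fst (Primrec.fst.comp .snd))
  exact Primrec.list_concat.comp hl (Primrec.pair
    (primrec_relabel.comp hl (Primrec.fst.comp hg)) (primrec_relabel.comp hl (Primrec.snd.comp hg)))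

theorem computable_lab {α : Type*} [Primcodable α] {e s x : α → ℕ} (he : Computable e)
    (hs : Computable s) (hx : Computable x) : Computable fun a => lab (e a) (s a) (x a) :=
  primrec_relabel.to_comp.comp (primrec_merges.to_comp.comp he hs) hx

/-! ### Uniform indices -/

/-- Uniformly semi-decidable sets have computable indices. -/
theorem exists_index {P : ℕ → ℕ → ℕ → Bool}
    (hP : Computable fun q : ℕ × ℕ × ℕ => P q.1 q.2.1 q.2.2) :
    ∃ t : ℕ → ℕ, Computable t ∧ ∀ a q, q ∈ W (t a) ↔ ∃ s, P a q s = true := by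
  have hQ : Computable₂ fun r s : ℕ => P r.unpair.1 r.unpair.2 s :=
    hP.comp (g := fun q : ℕ × ℕ => (q.1.unpair.1, q.1.unpair.2, q.2))
      ((computable_unpair_fst .fst).pair ((computable_unpair_snd .fst).pair .snd))
  have hf : Partrec fun r : ℕ =>
      Nat.rfind fun s => (Part.some (P r.unpair.1 r.unpair.2 s) : Part Bool) :=
    Partrec.rfind (p := fun (r s : ℕ) => (Part.some (P r.unpair.1 r.unpair.2 s) : Part Bool)) hQ
  obtain ⟨c, hc⟩ := Code.exists_code.1 (Partrec.nat_iff.1 hf)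
  refine ⟨fun a => Encodable.encode (c.curry a), ?_, fun a q => ?_⟩
  · exact Computable.encode.comp (Code.primrec₂_curry.to_comp.comp (.const c) .id)
  · change ((Denumerable.ofNat Code (Encodable.encode (c.curry a))).eval q).Dom ↔ _
    rw [Denumerable.ofNat_encode, Code.eval_curry, hc]
    exact Nat.rfind_dom.trans ⟨fun ⟨s, hs, _⟩ => ⟨s, by simpa using (Part.mem_some_iff.1 hs).symm⟩,
      fun ⟨s, hs⟩ => ⟨s, Part.mem_some_iff.2 (by simpa using hs.symm), fun _ => trivial⟩⟩

/-- A parametrized form of the recursion theorem for indices of c.e. sets. -/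
theorem exists_fixed_index {F : ℕ → ℕ → ℕ} (hF : Computable₂ F) :
    ∃ c : Code, ∀ a, W (Encodable.encode (c.curry a)) = W (F (Encodable.encode c) a) := by
  have hf : Partrec₂ fun (c : Code) (r : ℕ) =>
      (Denumerable.ofNat Code (F (Encodable.encode c) r.unpair.1)).eval r.unpair.2 := by
    refine Code.eval_part.comp ((Computable.ofNat Code).comp
      (hF.comp (Computable.encode.comp .fst) (computable_unpair_fst .snd)))
      (computable_unpair_snd .snd)
  obtain ⟨c, hc⟩ := Code.fixed_point₂ hf
  refine ⟨c, fun a => ?_⟩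
  ext q
  simp [W, Code.eval_curry, hc]


/-! ### Gluing two ceers along a counter -/

/-- The finite function coded by `b`, extended by `0`. -/
def listFun (b m : ℕ) : ℕ := (Denumerable.ofNat (List ℕ) b).getD m 0

/-- At stage `s` the first `k` values of the function coded by `b` represent in `ceer z` the
first `k` elements of `ceer a`. -/
def good (a z s k b : ℕ) : Bool :=
  decide (∀ i < k, decide (∀ j < k, ((lab z s (listFun b i) == lab z s (listFun b j)) ==
    (lab a s i == lab a s j)) = true) = true)

theorem good_iff {a z s k b : ℕ} : good a z s k b = true ↔ ∀ i < k, ∀ j < k,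
    (lab z s (listFun b i) = lab z s (listFun b j) ↔ lab a s i = lab a s j) := by
  simp only [good, decide_eq_true_eq]
  refine forall₂_congr fun i _ => forall₂_congr fun j _ => ?_
  rw [beq_iff_eq, Bool.eq_iff_iff, beq_iff_eq, beq_iff_eq]

theorem exists_listFun (f : ℕ → ℕ) (k : ℕ) : ∃ b, ∀ i < k, listFun b i = f i := by
  refine ⟨Encodable.encode ((List.range k).map f), fun i hi => ?_⟩
  simp [listFun, List.getD_eq_getElem?_getD, hi]

theorem exists_good (a z s k : ℕ) : ∃ b, good a z s k b = true := by
  obtain ⟨N, hN⟩ := lab_eventually_id z s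
  obtain ⟨b, hb⟩ := exists_listFun (fun i => N + lab a s i) k
  refine ⟨b, good_iff.2 fun i hi j hj => ?_⟩
  rw [hb i hi, hb j hj, hN _ (by omega), hN _ (by omega)]
  omega

/-- The least code of representatives at stage `s`. -/
def best (a z s k : ℕ) : ℕ := Nat.find (exists_good a z s k)

theorem exists_hit (z s k b x : ℕ) :
    ∃ m, (Nat.ble k m || lab z s x == lab z s (listFun b m)) = true :=
  ⟨k, by simp⟩

/-- The least `m < k` such that `listFun b m` is identified with `x` at stage `s`, or `k`. -/
def hit (z s k b x : ℕ) : ℕ := Nat.find (exists_hit z s k b x)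

theorem hit_le (z s k b x : ℕ) : hit z s k b x ≤ k := Nat.find_min' _ (by simp)

theorem hit_congr {z s k b x y : ℕ} (h : lab z s x = lab z s y) :
    hit z s k b x = hit z s k b y := by
  simp [hit, h]

theorem hit_spec {z s k b x m : ℕ} (hm : m < k) (h : lab z s x = lab z s (listFun b m)) :
    hit z s k b x < k ∧ lab z s x = lab z s (listFun b (hit z s k b x)) := by
  have hlt : hit z s k b x < k := lt_of_le_of_lt (Nat.find_min' _ (by simp [h])) hm
  have hs := Nat.find_spec (exists_hit z s k b x)
  change (Nat.ble k (hit z s k b x) || _ == lab z s (listFun b (hit z s k b x))) = true at hs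
  simp only [Bool.or_eq_true, Nat.ble_eq, beq_iff_eq] at hs
  exact ⟨hlt, hs.resolve_left (by omega)⟩

/-- The representative of the element `m` of `ceer a` at stage `s`. -/
def rep (a z : ℕ) (k : ℕ → ℕ) (s m : ℕ) : ℕ := listFun (best a z s (k s)) m

theorem rep_iff {a z s i j : ℕ} {k : ℕ → ℕ} (hi : i < k s) (hj : j < k s) :
    lab z s (rep a z k s i) = lab z s (rep a z k s j) ↔ lab a s i = lab a s j :=
  good_iff.1 (Nat.find_spec (exists_good a z s (k s))) i hi j hj

/-- The map from `ceer z` at stage `s` to `ceer z` at stage `s + 1`: the identity, unless the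
counter or the representatives change, when everything is sent to the new representatives. -/
def trans (a z : ℕ) (k : ℕ → ℕ) (s x : ℕ) : ℕ :=
  bif k s == k (s + 1) && best a z s (k s) == best a z (s + 1) (k (s + 1)) then x
  else rep a z k (s + 1) (hit z s (k s) (best a z s (k s)) x)

theorem lab_trans {a z s x y : ℕ} {k : ℕ → ℕ} (h : lab z s x = lab z s y) :
    lab z (s + 1) (trans a z k s x) = lab z (s + 1) (trans a z k s y) := by
  unfold trans
  cases (k s == k (s + 1) && best a z s (k s) == best a z (s + 1) (k (s + 1)))
  · simp [hit_congr h]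
  · simpa using lab_mono_succ h

theorem trans_rep {a z s m : ℕ} {k : ℕ → ℕ} (hk : Monotone k) (hm : m < k s) :
    lab z (s + 1) (trans a z k s (rep a z k s m)) = lab z (s + 1) (rep a z k (s + 1) m) := by
  unfold trans
  cases h : (k s == k (s + 1) && best a z s (k s) == best a z (s + 1) (k (s + 1)))
  · have hks := hk (Nat.le_succ s)
    obtain ⟨h₁, h₂⟩ := hit_spec (z := z) (s := s) (b := best a z s (k s)) hm
      (x := rep a z k s m) rfl
    have h₃ := (rep_iff hm h₁).1 h₂
    exact (rep_iff (h₁.trans_le hks) (hm.trans_le hks)).2 (lab_mono_succ h₃.symm)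
  · simp only [Bool.and_eq_true, beq_iff_eq] at h
    simp [rep, h.2]

/-- The value at stage `s` of the code `u` of a pair `(t, x)`: the image at stage `s` of the
element `x` of `ceer z` at stage `t`. -/
def val (a z : ℕ) (k : ℕ → ℕ) (s u : ℕ) : ℕ :=
  Nat.rec u.unpair.2 (fun s x => bif Nat.ble u.unpair.1 s then trans a z k s x else x) s

theorem val_succ {a z s u : ℕ} {k : ℕ → ℕ} (h : u.unpair.1 ≤ s) :
    val a z k (s + 1) u = trans a z k s (val a z k s u) := by
  have : Nat.ble u.unpair.1 s = true := by simpa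
  change (bif Nat.ble u.unpair.1 s then trans a z k s (val a z k s u) else _) = _
  rw [this, cond_true]

theorem val_of_le {a z s u : ℕ} {k : ℕ → ℕ} (h : s ≤ u.unpair.1) :
    val a z k s u = u.unpair.2 := by
  induction s with
  | zero => rfl
  | succ s ih =>
    have : Nat.ble u.unpair.1 s = false := by
      rw [← Bool.not_eq_true, Nat.ble_eq]; omega
    change (bif Nat.ble u.unpair.1 s then _ else val a z k s u) = _
    rw [this, cond_false, ih (by omega)]

theorem val_pair (a z : ℕ) (k : ℕ → ℕ) (s x : ℕ) : val a z k s (Nat.pair s x) = x := by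
  simp [val_of_le]

/-- The elements `u` and `v` are identified by stage `s`. -/
def glued (a z : ℕ) (k : ℕ → ℕ) (u v s : ℕ) : Bool :=
  (Nat.ble u.unpair.1 s && Nat.ble v.unpair.1 s) &&
    lab z s (val a z k s u) == lab z s (val a z k s v)

theorem glued_iff {a z u v s : ℕ} {k : ℕ → ℕ} : glued a z k u v s = true ↔
    (u.unpair.1 ≤ s ∧ v.unpair.1 ≤ s) ∧ lab z s (val a z k s u) = lab z s (val a z k s v) := by
  simp [glued]

/-- The direct limit of the approximations to `ceer z` along the maps `trans`. -/
def Glue (a z : ℕ) (k : ℕ → ℕ) (u v : ℕ) : Prop := ∃ s, glued a z k u v s = true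

theorem glued_mono {a z u v s t : ℕ} {k : ℕ → ℕ} (hst : s ≤ t) (h : glued a z k u v s = true) :
    glued a z k u v t = true := by
  induction hst with
  | refl => exact h
  | @step t _ ih =>
    obtain ⟨⟨h₁, h₂⟩, h₃⟩ := glued_iff.1 ih
    refine glued_iff.2 ⟨⟨h₁.trans t.le_succ, h₂.trans t.le_succ⟩, ?_⟩
    rw [Nat.succ_eq_add_one, val_succ h₁, val_succ h₂]
    exact lab_trans h₃

theorem glue_equivalence (a z : ℕ) (k : ℕ → ℕ) : Equivalence (Glue a z k) where
  refl u := ⟨u.unpair.1, glued_iff.2 ⟨⟨le_rfl, le_rfl⟩, rfl⟩⟩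
  symm := fun ⟨s, h⟩ => ⟨s, by rw [glued_iff] at h ⊢; exact ⟨h.1.symm, h.2.symm⟩⟩
  trans := fun ⟨s, hs⟩ ⟨t, ht⟩ => by
    have h₁ := glued_iff.1 (glued_mono (le_max_left s t) hs)
    have h₂ := glued_iff.1 (glued_mono (le_max_right s t) ht)
    exact ⟨max s t, glued_iff.2 ⟨⟨h₁.1.1, h₂.1.2⟩, h₁.2.trans h₂.2⟩⟩

theorem glue_val {a z u s : ℕ} {k : ℕ → ℕ} (h : u.unpair.1 ≤ s) :
    Glue a z k u (Nat.pair s (val a z k s u)) :=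
  ⟨s, glued_iff.2 ⟨⟨h, by simp⟩, by rw [val_pair]⟩⟩

theorem val_rep {a z s t m : ℕ} {k : ℕ → ℕ} (hk : Monotone k) (hm : m < k s) (hst : s ≤ t) :
    lab z t (val a z k t (Nat.pair s (rep a z k s m))) = lab z t (rep a z k t m) := by
  induction hst with
  | refl => rw [val_pair]
  | @step t hst ih =>
    rw [Nat.succ_eq_add_one, val_succ (by simpa using hst)]
    exact (lab_trans ih).trans (trans_rep hk (hm.trans_le (hk hst)))

theorem glue_rep_iff {a z s t i j : ℕ} {k : ℕ → ℕ} (hk : Monotone k) (hi : i < k s)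
    (hj : j < k t) :
    Glue a z k (Nat.pair s (rep a z k s i)) (Nat.pair t (rep a z k t j)) ↔ ceer a i j := by
  rw [ceer_iff]
  have key : ∀ u, s ≤ u → t ≤ u → (glued a z k (Nat.pair s (rep a z k s i))
      (Nat.pair t (rep a z k t j)) u = true ↔ lab a u i = lab a u j) := fun u hs ht => by
    rw [glued_iff, val_rep hk hi hs, val_rep hk hj ht,
      rep_iff (hi.trans_le (hk hs)) (hj.trans_le (hk ht))]
    simp [hs, ht]
  constructor
  · rintro ⟨u, hu⟩
    have := (glued_iff.1 hu).1
    simp only [Nat.unpair_pair] at this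
    exact ⟨u, (key u this.1 this.2).1 hu⟩
  · rintro ⟨u, hu⟩
    exact ⟨max u (max s t), (key _ (by omega) (by omega)).2 (lab_mono (le_max_left _ _) hu)⟩

/-! #### Computability of the construction -/

section Computability

variable {α : Type*} [Primcodable α]

theorem computable_listFun {b m : α → ℕ} (hb : Computable b) (hm : Computable m) :
    Computable fun p => listFun (b p) (m p) :=
  (Primrec.list_getD 0).to_comp.comp ((Computable.ofNat (List ℕ)).comp hb) hm

theorem computable_good {a z s k b : α → ℕ} (ha : Computable a) (hz : Computable z)
    (hs : Computable s) (hk : Computable k) (hb : Computable b) :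
    Computable fun p => good (a p) (z p) (s p) (k p) (b p) := by
  have hbeq : Computable₂ (fun x y : Bool => x == y) := (Primrec.beq (α := Bool)).to_comp
  refine computable_ball (P := fun p i => decide (∀ j < k p,
    ((lab (z p) (s p) (listFun (b p) i) == lab (z p) (s p) (listFun (b p) j)) ==
    (lab (a p) (s p) i == lab (a p) (s p) j)) = true)) ?_ hk
  refine computable_ball (P := fun (q : α × ℕ) j =>
    ((lab (z q.1) (s q.1) (listFun (b q.1) q.2) == lab (z q.1) (s q.1) (listFun (b q.1) j)) ==
    (lab (a q.1) (s q.1) q.2 == lab (a q.1) (s q.1) j))) ?_ (hk.comp .fst)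
  have h₁ : Computable fun q : (α × ℕ) × ℕ => q.1.1 := Computable.fst.comp .fst
  have h₂ : Computable fun q : (α × ℕ) × ℕ => q.1.2 := Computable.snd.comp .fst
  refine hbeq.comp (computable_beq ?_ ?_) (computable_beq ?_ ?_)
  · exact computable_lab (hz.comp h₁) (hs.comp h₁) (computable_listFun (hb.comp h₁) h₂)
  · exact computable_lab (hz.comp h₁) (hs.comp h₁) (computable_listFun (hb.comp h₁) .snd)
  · exact computable_lab (ha.comp h₁) (hs.comp h₁) h₂
  · exact computable_lab (ha.comp h₁) (hs.comp h₁) .snd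

theorem computable_best {a z s k : α → ℕ} (ha : Computable a) (hz : Computable z)
    (hs : Computable s) (hk : Computable k) :
    Computable fun p => best (a p) (z p) (s p) (k p) :=
  computable_find (P := fun p b => good (a p) (z p) (s p) (k p) b)
    (computable_good (ha.comp .fst) (hz.comp .fst) (hs.comp .fst) (hk.comp .fst) .snd) _

theorem computable_hit {z s k b x : α → ℕ} (hz : Computable z) (hs : Computable s)
    (hk : Computable k) (hb : Computable b) (hx : Computable x) :
    Computable fun p => hit (z p) (s p) (k p) (b p) (x p) := by
  refine computable_find (P := fun p m => Nat.ble (k p) m ||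
    lab (z p) (s p) (x p) == lab (z p) (s p) (listFun (b p) m)) ?_ _
  refine computable_or (computable_ble (hk.comp .fst) .snd) (computable_beq ?_ ?_)
  · exact computable_lab (hz.comp .fst) (hs.comp .fst) (hx.comp .fst)
  · exact computable_lab (hz.comp .fst) (hs.comp .fst) (computable_listFun (hb.comp .fst) .snd)

variable {a z s x : α → ℕ} {k : α → ℕ → ℕ}

theorem computable_rep (ha : Computable a) (hz : Computable z) (hk : Computable₂ k)
    (hs : Computable s) (hx : Computable x) :
    Computable fun p => rep (a p) (z p) (k p) (s p) (x p) :=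
  computable_listFun (computable_best ha hz hs (hk.comp .id hs)) hx

theorem computable_trans (ha : Computable a) (hz : Computable z) (hk : Computable₂ k)
    (hs : Computable s) (hx : Computable x) :
    Computable fun p => trans (a p) (z p) (k p) (s p) (x p) := by
  have hs' : Computable fun p => s p + 1 := computable_add hs (.const 1)
  have hks : Computable fun p => k p (s p) := hk.comp .id hs
  have hks' : Computable fun p => k p (s p + 1) := hk.comp .id hs'
  have hb := computable_best ha hz hs hks
  exact Computable.cond (computable_and (computable_beq hks hks')
    (computable_beq hb (computable_best ha hz hs' hks'))) hx
    (computable_rep ha hz hk hs' (computable_hit hz hs hks hb hx))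

theorem computable_val (ha : Computable a) (hz : Computable z) (hk : Computable₂ k)
    (hs : Computable s) (hx : Computable x) :
    Computable fun p => val (a p) (z p) (k p) (s p) (x p) := by
  refine Computable.nat_rec (f := s) (g := fun p => (x p).unpair.2) (h := fun p q =>
    bif Nat.ble (x p).unpair.1 q.1 then trans (a p) (z p) (k p) q.1 q.2 else q.2)
    hs (computable_unpair_snd hx) ?_
  have h₁ : Computable fun q : α × ℕ × ℕ => q.2.1 := Computable.fst.comp .snd
  have h₂ : Computable fun q : α × ℕ × ℕ => q.2.2 := Computable.snd.comp .snd
  exact Computable.cond (computable_ble (computable_unpair_fst (hx.comp .fst)) h₁)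
    (computable_trans (k := fun q : α × ℕ × ℕ => k q.1) (ha.comp .fst) (hz.comp .fst)
      (hk.comp (Computable.fst.comp .fst) .snd) h₁ h₂) h₂

theorem computable_glued {u v : α → ℕ} (ha : Computable a) (hz : Computable z)
    (hk : Computable₂ k) (hu : Computable u) (hv : Computable v) (hs : Computable s) :
    Computable fun p => glued (a p) (z p) (k p) (u p) (v p) (s p) :=
  computable_and (computable_and (computable_ble (computable_unpair_fst hu) hs)
    (computable_ble (computable_unpair_fst hv) hs))
    (computable_beq (computable_lab hz hs (computable_val ha hz hk hs hu))
      (computable_lab hz hs (computable_val ha hz hk hs hv)))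

end Computability

/-! #### The two outcomes of the construction -/

theorem ceer_equivalence (e : ℕ) : Equivalence (ceer e) := Relation.EqvGen.is_equivalence _

theorem ComputableReduction.trans {E F G : ℕ → ℕ → Prop} (h₁ : ComputableReduction E F)
    (h₂ : ComputableReduction F G) : ComputableReduction E G := by
  obtain ⟨f, hf, hf'⟩ := h₁
  obtain ⟨g, hg, hg'⟩ := h₂
  exact ⟨g ∘ f, hg.comp hf, fun m n => (hf' m n).trans (hg' _ _)⟩

theorem CeerEquiv.symm {E F : ℕ → ℕ → Prop} (h : CeerEquiv E F) : CeerEquiv F E := ⟨h.2, h.1⟩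

theorem CeerEquiv.trans {E F G : ℕ → ℕ → Prop} (h₁ : CeerEquiv E F) (h₂ : CeerEquiv F G) :
    CeerEquiv E G :=
  ⟨ComputableReduction.trans h₁.1 h₂.1, ComputableReduction.trans h₂.2 h₁.2⟩

theorem CeerEquiv.hasInfinitelyManyClasses {E F : ℕ → ℕ → Prop} (h : CeerEquiv E F)
    (hF : HasInfinitelyManyClasses F) : HasInfinitelyManyClasses E := by
  obtain ⟨f, hf⟩ := hF
  obtain ⟨g, -, hg⟩ := h.2
  exact ⟨g ∘ f, fun m n hmn => mt (hg _ _).2 (hf m n hmn)⟩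

theorem eventually_lab_iff (e x y : ℕ) :
    ∀ᶠ s in Filter.atTop, (lab e s x = lab e s y ↔ ceer e x y) := by
  by_cases h : ceer e x y
  · obtain ⟨s, hs⟩ := ceer_iff.1 h
    exact Filter.eventually_atTop.2 ⟨s, fun t ht => iff_of_true (lab_mono ht hs) h⟩
  · exact .of_forall fun s => iff_of_false (fun hs => h (ceer_of_lab hs)) h

theorem exists_limit_good (a z K : ℕ) (hz : HasInfinitelyManyClasses (ceer z)) :
    ∃ b, ∀ i < K, ∀ j < K, (ceer z (listFun b i) (listFun b j) ↔ ceer a i j) := by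
  obtain ⟨f, hf⟩ := hz
  let st : Setoid ℕ := ⟨ceer a, ceer_equivalence a⟩
  obtain ⟨b, hb⟩ := exists_listFun (fun i => f (Quotient.mk st i).out) K
  refine ⟨b, fun i hi j hj => ?_⟩
  rw [hb i hi, hb j hj]
  have h : ceer a i j ↔ (Quotient.mk st i).out = (Quotient.mk st j).out := by
    rw [Quotient.out_inj, Quotient.eq]
    rfl
  rw [h]
  refine ⟨fun h' => ?_, fun h' => h' ▸ (ceer_equivalence z).refl _⟩
  by_contra hne
  exact hf _ _ hne h'

theorem exists_eventually_best (a z K : ℕ) (hz : HasInfinitelyManyClasses (ceer z)) :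
    ∃ B, ∀ᶠ s in Filter.atTop, best a z s K = B := by
  classical
  have hex := exists_limit_good a z K hz
  have hev : ∀ b, ∀ᶠ s in Filter.atTop, (good a z s K b = true ↔
      ∀ i < K, ∀ j < K, (ceer z (listFun b i) (listFun b j) ↔ ceer a i j)) := fun b => by
    have : ∀ᶠ s in Filter.atTop, ∀ i ∈ Set.Iio K, ∀ j ∈ Set.Iio K,
        (lab z s (listFun b i) = lab z s (listFun b j) ↔ ceer z (listFun b i) (listFun b j)) ∧
        (lab a s i = lab a s j ↔ ceer a i j) := by
      refine (Filter.eventually_all_finite (Set.finite_Iio K)).2 fun i _ =>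
        (Filter.eventually_all_finite (Set.finite_Iio K)).2 fun j _ => ?_
      exact (eventually_lab_iff _ _ _).and (eventually_lab_iff _ _ _)
    filter_upwards [this] with s hs
    rw [good_iff]
    refine forall₂_congr fun i hi => forall₂_congr fun j hj => ?_
    rw [(hs i hi j hj).1, (hs i hi j hj).2]
  refine ⟨Nat.find hex, ?_⟩
  have hall := (Filter.eventually_all_finite (Set.finite_Iic (Nat.find hex))).2 fun b _ => hev b
  filter_upwards [hall] with s hs
  refine (Nat.find_eq_iff _).2 ⟨(hs _ Set.self_mem_Iic).2 (Nat.find_spec hex), fun b hb h => ?_⟩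
  exact Nat.find_min hex hb ((hs b hb.le).1 h)

theorem glue_equiv_of_bounded {a z : ℕ} {k : ℕ → ℕ} (hkc : Computable k) {K : ℕ}
    (hK : ∀ᶠ s in Filter.atTop, k s = K) (hz : HasInfinitelyManyClasses (ceer z)) :
    CeerEquiv (Glue a z k) (ceer z) := by
  obtain ⟨B, hB⟩ := exists_eventually_best a z K hz
  obtain ⟨s₀, hs₀⟩ := Filter.eventually_atTop.1 (hK.and hB)
  have htrans : ∀ s, s₀ ≤ s → ∀ x, trans a z k s x = x := fun s hs x => by
    obtain ⟨h₁, h₂⟩ := hs₀ s hs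
    obtain ⟨h₃, h₄⟩ := hs₀ (s + 1) (by omega)
    simp [trans, h₁, h₂, h₃, h₄]
  have hval : ∀ u s, max s₀ u.unpair.1 ≤ s →
      val a z k s u = val a z k (max s₀ u.unpair.1) u := fun u s hs => by
    induction hs with
    | refl => rfl
    | @step s hs ih =>
      rw [Nat.succ_eq_add_one, val_succ ((le_max_right _ _).trans hs),
        htrans s ((le_max_left _ _).trans hs), ih]
  have hiff : ∀ u v, Glue a z k u v ↔
      ceer z (val a z k (max s₀ u.unpair.1) u) (val a z k (max s₀ v.unpair.1) v) := fun u v => by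
    rw [ceer_iff]
    constructor
    · rintro ⟨s, hs⟩
      have h := glued_iff.1 (glued_mono (le_max_left s (max s₀ (max u.unpair.1 v.unpair.1))) hs)
      rw [hval u _ (by omega), hval v _ (by omega)] at h
      exact ⟨_, h.2⟩
    · rintro ⟨s, hs⟩
      refine ⟨max s (max s₀ (max u.unpair.1 v.unpair.1)), glued_iff.2 ⟨by omega, ?_⟩⟩
      rw [hval u _ (by omega), hval v _ (by omega)]
      exact lab_mono (le_max_left _ _) hs
  refine ⟨⟨fun u => val a z k (max s₀ u.unpair.1) u, ?_, hiff⟩,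
    ⟨fun x => Nat.pair s₀ x, computable_pair (.const _) .id, fun x y => ?_⟩⟩
  · exact computable_val (k := fun _ => k) (.const a) (.const z) (hkc.comp .snd)
      (Primrec.nat_max.to_comp.comp (.const s₀) (computable_unpair_fst .id)) .id
  · rw [hiff]
    simp [val_pair]

theorem exists_lt_succ_of_unbounded {k : ℕ → ℕ} (hu : ∀ N, ∃ s, N < k s) (t : ℕ) :
    ∃ s, t ≤ s ∧ k s < k (s + 1) := by
  by_contra! h
  have hle : ∀ s, t ≤ s → k s ≤ k t := fun s hs => by
    induction hs with
    | refl => exact le_rfl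
    | step hs ih => exact (h _ hs).trans ih
  obtain ⟨s, hs⟩ := hu ((Finset.range (t + 1)).sup k)
  rcases le_total t s with h' | h'
  · exact absurd (hle s h') (not_le.2 ((Finset.le_sup (f := k) (by simp)).trans_lt hs))
  · exact absurd (Finset.le_sup (f := k) (Finset.mem_range.2 (Nat.lt_succ_of_le h'))) (not_le.2 hs)

theorem glue_equiv_of_unbounded {a z : ℕ} {k : ℕ → ℕ} (hkc : Computable k) (hk : Monotone k)
    (hu : ∀ N, ∃ s, N < k s) : CeerEquiv (Glue a z k) (ceer a) := by
  have hE := glue_equivalence a z k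
  have hk₂ : Computable fun p : ℕ × ℕ => k p.2 := hkc.comp .snd
  have hk₃ : Computable fun p : ℕ × ℕ => k (p.2 + 1) := hkc.comp (computable_add .snd (.const 1))
  obtain ⟨σ, hσ, hσ'⟩ := exists_computable_choice
    (P := fun u s => Nat.ble u.unpair.1 s && Nat.ble (k s + 1) (k (s + 1)))
    (computable_and (computable_ble (computable_unpair_fst .fst) .snd)
      (computable_ble (computable_add hk₂ (.const 1)) hk₃)) fun u => by
      obtain ⟨s, hs⟩ := exists_lt_succ_of_unbounded hu u.unpair.1
      refine ⟨s, ?_⟩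
      rw [Bool.and_eq_true, Nat.ble_eq, Nat.ble_eq]
      exact hs
  obtain ⟨ρ, hρ, hρ'⟩ := exists_computable_choice (P := fun m s => Nat.ble (m + 1) (k s))
    (computable_ble (computable_add .fst (.const 1)) hk₂) fun m => by
      obtain ⟨s, hs⟩ := hu m
      exact ⟨s, by rwa [Nat.ble_eq]⟩
  simp only [Bool.and_eq_true, Nat.ble_eq] at hσ' hρ'
  let Φ : ℕ → ℕ := fun u =>
    hit z (σ u) (k (σ u)) (best a z (σ u) (k (σ u))) (val a z k (σ u) u)
  have hΦ : Computable Φ :=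
    computable_hit (.const z) hσ (hkc.comp hσ)
      (computable_best (.const a) (.const z) hσ (hkc.comp hσ))
      (computable_val (k := fun _ => k) (.const a) (.const z) (hkc.comp .snd) hσ .id)
  have hlt : ∀ u, Φ u < k (σ u + 1) := fun u => (hit_le _ _ _ _ _).trans_lt (hσ' u).2
  have hglue : ∀ u, Glue a z k u (Nat.pair (σ u + 1) (rep a z k (σ u + 1) (Φ u))) := fun u => by
    obtain ⟨h₁, h₂⟩ := hσ' u
    have h := glue_val (a := a) (z := z) (k := k) (h₁.trans (Nat.le_succ _))
    rw [Nat.succ_eq_add_one, val_succ h₁, trans,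
      beq_eq_false_iff_ne.2 (Nat.ne_of_lt h₂), Bool.false_and, cond_false] at h
    exact h
  refine ⟨⟨Φ, hΦ, fun u v => ?_⟩, ⟨fun m => Nat.pair (ρ m) (rep a z k (ρ m) m), ?_, fun i j =>
    (glue_rep_iff hk (hρ' i) (hρ' j)).symm⟩⟩
  · rw [← glue_rep_iff (z := z) hk (hlt u) (hlt v)]
    exact ⟨fun h => hE.trans (hE.trans (hE.symm (hglue u)) h) (hglue v),
      fun h => hE.trans (hE.trans (hglue u) h) (hE.symm (hglue v))⟩
  · exact computable_pair hρ
      (computable_rep (k := fun _ => k) (.const a) (.const z) (hkc.comp .snd) hρ .id)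

theorem exists_eventually_const_of_bounded {k : ℕ → ℕ} (hk : Monotone k) {N : ℕ}
    (hN : ∀ s, k s ≤ N) : ∃ s, ∀ t, s ≤ t → k t = k s := by
  by_contra! h
  have hex : ∀ n, ∃ s, n ≤ k s := fun n => by
    induction n with
    | zero => exact ⟨0, Nat.zero_le _⟩
    | succ n ih =>
      obtain ⟨s, hs⟩ := ih
      obtain ⟨t, hst, hne⟩ := h s
      have := hk hst
      exact ⟨t, by omega⟩
  obtain ⟨s, hs⟩ := hex (N + 1)
  have := hN s
  omega

/-- There is a uniform construction which, from a ceer `ceer z` and a counter `k p`, builds a ceer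
equivalent to the infinite ceer `ceer a` if the counter is unbounded, and to `ceer z` otherwise
(if the latter has infinitely many classes). -/
theorem exists_step (a : ℕ) {k : ℕ → ℕ → ℕ} (hkc : Computable₂ k) (hk : ∀ p, Monotone (k p)) :
    ∃ t : ℕ → ℕ → ℕ, Computable₂ t ∧ ∀ p z,
      ((∀ N, ∃ s, N < k p s) → CeerEquiv (ceer (t p z)) (ceer a)) ∧
      ((¬ ∀ N, ∃ s, N < k p s) → HasInfinitelyManyClasses (ceer z) →
        CeerEquiv (ceer (t p z)) (ceer z)) := by
  obtain ⟨t, ht, htW⟩ := exists_index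
    (P := fun r q s => glued a r.unpair.2 (k r.unpair.1) q.unpair.1 q.unpair.2 s)
    (computable_glued (k := fun q : ℕ × ℕ × ℕ => k q.1.unpair.1) (.const a)
      (computable_unpair_snd .fst)
      (hkc.comp (computable_unpair_fst (Computable.fst.comp .fst)) .snd)
      (computable_unpair_fst (Computable.fst.comp .snd))
      (computable_unpair_snd (Computable.fst.comp .snd)) (Computable.snd.comp .snd))
  have hceer : ∀ p z, ceer (t (Nat.pair p z)) = Glue a z (k p) := fun p z => by
    have h : (fun m n => Nat.pair m n ∈ W (t (Nat.pair p z))) = Glue a z (k p) := by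
      ext m n
      rw [htW]
      simp [Glue]
    rw [ceer, h]
    exact (glue_equivalence a z (k p)).eqvGen_eq
  have hkp : ∀ p, Computable (k p) := fun p => hkc.comp (.const p) .id
  refine ⟨fun p z => t (Nat.pair p z), ht.comp (computable_pair .fst .snd), fun p z => ?_⟩
  rw [hceer]
  refine ⟨glue_equiv_of_unbounded (hkp p) (hk p), fun hb hz => ?_⟩
  push Not at hb
  obtain ⟨N, hN⟩ := hb
  obtain ⟨s, hs⟩ := exists_eventually_const_of_bounded (hk p) hN
  exact glue_equiv_of_bounded (hkp p) (Filter.eventually_atTop.2 ⟨s, hs⟩) hz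

/-! ### Counters for Σ⁰₃ sets -/

/-- The length of the longest initial segment of `y` for which a witness `z` for `R y z` has been
found by stage `s`. -/
def counter (R : ℕ → ℕ → Bool) (s : ℕ) : ℕ :=
  Nat.rec 0 (fun s c => bif R c s.unpair.1 then c + 1 else c) s

theorem counter_succ (R : ℕ → ℕ → Bool) (s : ℕ) : counter R (s + 1) =
    if R (counter R s) s.unpair.1 = true then counter R s + 1 else counter R s :=
  Bool.cond_eq_ite ..

theorem counter_monotone (R : ℕ → ℕ → Bool) : Monotone (counter R) :=
  monotone_nat_of_le_succ fun s => by rw [counter_succ]; split_ifs <;> omega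

theorem counter_unbounded_iff {R : ℕ → ℕ → Bool} :
    (∀ N, ∃ s, N < counter R s) ↔ ∀ y, ∃ z, R y z = true := by
  constructor
  · intro h y
    obtain ⟨s, hs⟩ := h y
    induction s with
    | zero => exact absurd hs (Nat.not_lt_zero _)
    | succ s ih =>
      rcases lt_or_ge y (counter R s) with h' | h'
      · exact ih h'
      · rw [counter_succ] at hs
        split_ifs at hs with hR
        · obtain rfl : y = counter R s := by omega
          exact ⟨_, hR⟩
        · omega
  · intro h
    by_contra! hb
    obtain ⟨N, hN⟩ := hb
    obtain ⟨s, hs⟩ := exists_eventually_const_of_bounded (counter_monotone R) hN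
    obtain ⟨z, hz⟩ := h (counter R s)
    have hle : s ≤ Nat.pair z s := Nat.right_le_pair z s
    have h₁ := hs _ hle
    have h₂ := hs _ (hle.trans (Nat.le_succ _))
    rw [Nat.succ_eq_add_one, counter_succ, h₁, if_pos (by simpa using hz)] at h₂
    omega

theorem IsSigma03.exists_counter {S : Set ℕ} (hS : IsSigma03 S) :
    ∃ k : ℕ → ℕ → ℕ, Computable₂ k ∧ (∀ p, Monotone (k p)) ∧
      ∀ n, n ∈ S ↔ ∃ x, ∀ N, ∃ s, N < k (Nat.pair n x) s := by
  obtain ⟨R, hR, hRS⟩ := hS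
  refine ⟨fun p s => counter (R p.unpair.1 p.unpair.2) s, ?_, fun p => counter_monotone _,
    fun n => ?_⟩
  · refine Computable.nat_rec (f := fun q : ℕ × ℕ => q.2) (g := fun _ => 0) (h := fun q r =>
      bif R q.1.unpair.1 q.1.unpair.2 r.2 r.1.unpair.1 then r.2 + 1 else r.2) .snd (.const 0) ?_
    have h₁ : Computable fun q : (ℕ × ℕ) × ℕ × ℕ => q.1.1 := Computable.fst.comp .fst
    have h₂ : Computable fun q : (ℕ × ℕ) × ℕ × ℕ => q.2.2 := Computable.snd.comp .snd
    have h₃ : Computable fun q : (ℕ × ℕ) × ℕ × ℕ => q.2.1 := Computable.fst.comp .snd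
    refine Computable.cond ?_ (computable_add h₂ (.const 1)) h₂
    exact hR.comp (g := fun q : (ℕ × ℕ) × ℕ × ℕ =>
      (q.1.1.unpair.1, q.1.1.unpair.2, q.2.2, q.2.1.unpair.1))
      ((computable_unpair_fst h₁).pair ((computable_unpair_snd h₁).pair
        (h₂.pair (computable_unpair_fst h₃))))
  · rw [hRS]
    refine exists_congr fun x => ?_
    rw [counter_unbounded_iff]
    simp

/-! ### Hardness -/

theorem ceer_congr {i j : ℕ} (h : W i = W j) : ceer i = ceer j := by
  rw [ceer, ceer, h]

theorem manyOneReducible_ceerClosure {S A : Set ℕ} (hS : IsSigma03 (ceerClosure S))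
    (hproper : ProperOnInfiniteCeers S) (hA : IsSigma03 A) :
    (· ∈ A) ≤₀ (· ∈ ceerClosure S) := by
  obtain ⟨a, b, ha, hb, haS, hbS⟩ := hproper
  obtain ⟨k, hkc, hk, hkA⟩ := IsSigma03.exists_counter hA
  obtain ⟨l, hlc, hl, hlS⟩ := IsSigma03.exists_counter hS
  obtain ⟨t, ht, htE⟩ := exists_step a hkc hk
  obtain ⟨u, hu, huE⟩ := exists_step b hlc hl
  let idx : ℕ → ℕ → ℕ := fun c q => Encodable.encode ((Denumerable.ofNat Code c).curry q)
  have hidx : Computable₂ idx := Computable.encode.comp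
    (Code.primrec₂_curry.to_comp.comp ((Computable.ofNat Code).comp .fst) .snd)
  have hF : Computable₂ fun c q : ℕ => t q (u (Nat.pair (idx c (Nat.pair q.unpair.1 0)) q.unpair.2)
      (idx c (Nat.pair q.unpair.1 (q.unpair.2 + 1)))) := by
    have hn : Computable fun p : ℕ × ℕ => p.2.unpair.1 := computable_unpair_fst .snd
    have hx : Computable fun p : ℕ × ℕ => p.2.unpair.2 := computable_unpair_snd .snd
    refine ht.comp .snd (hu.comp (computable_pair (hidx.comp .fst ?_) hx) (hidx.comp .fst ?_))
    · exact computable_pair hn (.const 0)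
    · exact computable_pair hn (computable_add hx (.const 1))
  obtain ⟨c, hc⟩ := exists_fixed_index hF
  let e : ℕ → ℕ → ℕ := fun n x => Encodable.encode (c.curry (Nat.pair n x))
  have he : ∀ n x, ceer (e n x) = ceer (t (Nat.pair n x) (u (Nat.pair (e n 0) x) (e n (x + 1)))) :=
    fun n x => by
      refine ceer_congr ((hc _).trans ?_)
      simp [idx, e]
  have key : ∀ n d x, ((∀ N, ∃ s, N < k (Nat.pair n (x + d)) s) ∨
      ∀ N, ∃ s, N < l (Nat.pair (e n 0) (x + d)) s) →
      ((∃ y, ∀ N, ∃ s, N < k (Nat.pair n y) s) ∧ CeerEquiv (ceer (e n x)) (ceer a)) ∨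
      ((∃ y, ∀ N, ∃ s, N < l (Nat.pair (e n 0) y) s) ∧ CeerEquiv (ceer (e n x)) (ceer b)) := by
    intro n d
    induction d with
    | zero =>
      intro x h
      rw [he]
      obtain ⟨ht₁, ht₂⟩ := htE (Nat.pair n x) (u (Nat.pair (e n 0) x) (e n (x + 1)))
      obtain ⟨hu₁, hu₂⟩ := huE (Nat.pair (e n 0) x) (e n (x + 1))
      by_cases hkx : ∀ N, ∃ s, N < k (Nat.pair n x) s
      · exact .inl ⟨⟨x, hkx⟩, ht₁ hkx⟩
      · have hlx := h.resolve_left hkx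
        exact .inr ⟨⟨x, hlx⟩, CeerEquiv.trans (ht₂ hkx
          (CeerEquiv.hasInfinitelyManyClasses (hu₁ hlx) hb)) (hu₁ hlx)⟩
    | succ d ih =>
      intro x h
      rw [he]
      obtain ⟨ht₁, ht₂⟩ := htE (Nat.pair n x) (u (Nat.pair (e n 0) x) (e n (x + 1)))
      obtain ⟨hu₁, hu₂⟩ := huE (Nat.pair (e n 0) x) (e n (x + 1))
      by_cases hkx : ∀ N, ∃ s, N < k (Nat.pair n x) s
      · exact .inl ⟨⟨x, hkx⟩, ht₁ hkx⟩
      by_cases hlx : ∀ N, ∃ s, N < l (Nat.pair (e n 0) x) s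
      · exact .inr ⟨⟨x, hlx⟩, CeerEquiv.trans (ht₂ hkx
          (CeerEquiv.hasInfinitelyManyClasses (hu₁ hlx) hb)) (hu₁ hlx)⟩
      have hnext : ∀ {z}, HasInfinitelyManyClasses (ceer z) →
          CeerEquiv (ceer (e n (x + 1))) (ceer z) →
          CeerEquiv (ceer (t (Nat.pair n x) (u (Nat.pair (e n 0) x) (e n (x + 1))))) (ceer z) :=
        fun hz hE => by
          have h₁ := CeerEquiv.trans (hu₂ hlx (CeerEquiv.hasInfinitelyManyClasses hE hz)) hE
          exact CeerEquiv.trans (ht₂ hkx (CeerEquiv.hasInfinitelyManyClasses h₁ hz)) h₁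
      rw [← Nat.add_assoc, Nat.add_right_comm] at h
      exact (ih (x + 1) h).imp (And.imp_right (hnext ha)) (And.imp_right (hnext hb))
  have hclosed : ∀ {i j}, CeerEquiv (ceer i) (ceer j) → j ∈ ceerClosure S → i ∈ ceerClosure S :=
    fun hE ⟨m, hm, hE'⟩ => ⟨m, hm, CeerEquiv.trans hE hE'⟩
  refine ⟨fun n => e n 0, ?_, fun n => ?_⟩
  · exact Computable.encode.comp (Code.primrec₂_curry.to_comp.comp (.const c)
      (computable_pair .id (.const 0)))
  · constructor
    · intro hn
      obtain ⟨x, hx⟩ := (hkA n).1 hn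
      rcases key n x 0 (.inl (by simpa using hx)) with ⟨-, h⟩ | ⟨h, -⟩
      · exact hclosed h haS
      · exact (hlS _).2 h
    · intro hn
      obtain ⟨x, hx⟩ := (hlS _).1 hn
      rcases key n x 0 (.inr (by simpa using hx)) with ⟨h, -⟩ | ⟨-, h⟩
      · exact (hkA n).2 h
      · exact absurd (hclosed (CeerEquiv.symm h) hn) hbS

/-! ### The upper bound -/

/-- The output of the `e`-th program on input `m` within `s` steps. -/
def out (e s m : ℕ) : ℕ := (Code.evaln s (Denumerable.ofNat Code e) m).getD 0

/-- The `e`-th program halts on input `m` within `s` steps. -/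
def halts (e s m : ℕ) : Bool := (Code.evaln s (Denumerable.ofNat Code e) m).isSome

theorem mem_evaln_iff {e s m v : ℕ} : v ∈ Code.evaln s (Denumerable.ofNat Code e) m ↔
    halts e s m = true ∧ out e s m = v := by
  unfold halts out
  cases Code.evaln s (Denumerable.ofNat Code e) m <;> simp

theorem halts_mono {e s t m : ℕ} (hst : s ≤ t) (h : halts e s m = true) : halts e t m = true :=
  (mem_evaln_iff.1 (Code.evaln_mono hst (mem_evaln_iff.2 ⟨h, rfl⟩))).1

theorem out_eq {e s t m : ℕ} (hs : halts e s m = true) (ht : halts e t m = true) :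
    out e s m = out e t m :=
  Part.mem_unique (Code.evaln_sound (mem_evaln_iff.2 ⟨hs, rfl⟩))
    (Code.evaln_sound (mem_evaln_iff.2 ⟨ht, rfl⟩))

theorem computable_evaln {α : Type*} [Primcodable α] {e s m : α → ℕ} (he : Computable e)
    (hs : Computable s) (hm : Computable m) :
    Computable fun p => Code.evaln (s p) (Denumerable.ofNat Code (e p)) (m p) :=
  Code.primrec_evaln.to_comp.comp ((hs.pair ((Computable.ofNat Code).comp he)).pair hm)

theorem computable_out {α : Type*} [Primcodable α] {e s m : α → ℕ} (he : Computable e)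
    (hs : Computable s) (hm : Computable m) : Computable fun p => out (e p) (s p) (m p) :=
  (Primrec.option_getD.to_comp).comp (computable_evaln he hs hm) (.const 0)

theorem computable_halts {α : Type*} [Primcodable α] {e s m : α → ℕ} (he : Computable e)
    (hs : Computable s) (hm : Computable m) : Computable fun p => halts (e p) (s p) (m p) :=
  Primrec.option_isSome.to_comp.comp (computable_evaln he hs hm)

/-- By stage `s`, the `e`-th program halts on `m` and `n` with outputs identified in `ceer j`. -/
def outEq (e j m n s : ℕ) : Bool :=
  (halts e s m && halts e s n) && lab j s (out e s m) == lab j s (out e s n)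

theorem outEq_iff {e j m n s : ℕ} : outEq e j m n s = true ↔
    (halts e s m = true ∧ halts e s n = true) ∧ lab j s (out e s m) = lab j s (out e s n) := by
  simp [outEq]

/-- The matrix of the `Π⁰₂` statement that the `e`-th program reduces `ceer i` to `ceer j`; the
universal variable is the triple `m`, `n`, `s` and the existential one is `z`. -/
def redMatrix (e i j m n s z : ℕ) : Bool :=
  (halts e z m && halts e z n) && ((!(lab i s m == lab i s n) || outEq e j m n z) &&
    (!outEq e j m n s || lab i z m == lab i z n))

theorem redMatrix_iff {e i j m n s z : ℕ} : redMatrix e i j m n s z = true ↔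
    (halts e z m = true ∧ halts e z n = true) ∧
      (lab i s m = lab i s n → outEq e j m n z = true) ∧
      (outEq e j m n s = true → lab i z m = lab i z n) := by
  simp [redMatrix, imp_iff_not_or]

theorem computableReduction_iff {i j : ℕ} : ComputableReduction (ceer i) (ceer j) ↔
    ∃ e, ∀ m n s, ∃ z, redMatrix e i j m n s z = true := by
  constructor
  · rintro ⟨Φ, hΦ, hred⟩
    obtain ⟨c, hc⟩ := Code.exists_code.1 (Partrec.nat_iff.1 hΦ)
    have hhalt : ∀ m, ∃ s, ∀ t, s ≤ t → halts (Encodable.encode c) t m = true ∧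
        out (Encodable.encode c) t m = Φ m := fun m => by
      have : Φ m ∈ c.eval m := by rw [hc]; exact Part.mem_some _
      obtain ⟨s, hs⟩ := Code.evaln_complete.1 this
      refine ⟨s, fun t ht => mem_evaln_iff.1 ?_⟩
      rw [Denumerable.ofNat_encode]
      exact Code.evaln_mono ht hs
    refine ⟨Encodable.encode c, fun m n s => ?_⟩
    obtain ⟨s₁, h₁⟩ := hhalt m
    obtain ⟨s₂, h₂⟩ := hhalt n
    obtain ⟨s₃, h₃⟩ := Filter.eventually_atTop.1 ((eventually_lab_iff i m n).and
      (eventually_lab_iff j (Φ m) (Φ n)))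
    refine ⟨max s₁ (max s₂ s₃), redMatrix_iff.2 ?_⟩
    obtain ⟨h₄, h₅⟩ := h₁ (max s₁ (max s₂ s₃)) (by omega)
    obtain ⟨h₆, h₇⟩ := h₂ (max s₁ (max s₂ s₃)) (by omega)
    obtain ⟨h₈, h₉⟩ := h₃ (max s₁ (max s₂ s₃)) (by omega)
    refine ⟨⟨h₄, h₆⟩, fun h => outEq_iff.2 ⟨⟨h₄, h₆⟩, ?_⟩, fun h => ?_⟩
    · rw [h₅, h₇, h₉, ← hred]
      exact ceer_of_lab h
    · obtain ⟨⟨h₁₀, h₁₁⟩, h₁₂⟩ := outEq_iff.1 h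
      rw [out_eq h₁₀ h₄, out_eq h₁₁ h₆, h₅, h₇] at h₁₂
      rw [h₈, hred]
      exact ceer_of_lab h₁₂
  · rintro ⟨e, he⟩
    obtain ⟨σ, hσ, hσ'⟩ := exists_computable_choice (P := fun m s => halts e s m)
      (computable_halts (.const e) .snd .fst) fun m =>
        (he m m 0).imp fun z hz => (redMatrix_iff.1 hz).1.1
    refine ⟨fun m => out e (σ m) m, computable_out (.const e) hσ .id, fun m n => ?_⟩
    constructor
    · intro h
      obtain ⟨s, hs⟩ := ceer_iff.1 h
      obtain ⟨z, hz⟩ := he m n s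
      obtain ⟨⟨h₁, h₂⟩, h₃⟩ := outEq_iff.1 ((redMatrix_iff.1 hz).2.1 hs)
      rw [out_eq h₁ (hσ' m), out_eq h₂ (hσ' n)] at h₃
      exact ceer_of_lab h₃
    · intro h
      obtain ⟨s, hs⟩ := ceer_iff.1 h
      have h₁ := halts_mono (le_max_right s (max (σ m) (σ n)))
        (halts_mono (le_max_left _ _) (hσ' m))
      have h₂ := halts_mono (le_max_right s (max (σ m) (σ n)))
        (halts_mono (le_max_right _ _) (hσ' n))
      obtain ⟨z, hz⟩ := he m n (max s (max (σ m) (σ n)))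
      refine ceer_of_lab ((redMatrix_iff.1 hz).2.2 (outEq_iff.2 ⟨⟨h₁, h₂⟩, ?_⟩))
      rw [out_eq h₁ (hσ' m), out_eq h₂ (hσ' n)]
      exact lab_mono (le_max_left _ _) hs

section Computability

variable {α : Type*} [Primcodable α] {e i j m n s z : α → ℕ}

theorem computable_outEq (he : Computable e) (hj : Computable j) (hm : Computable m)
    (hn : Computable n) (hs : Computable s) :
    Computable fun p => outEq (e p) (j p) (m p) (n p) (s p) :=
  computable_and (computable_and (computable_halts he hs hm) (computable_halts he hs hn))
    (computable_beq (computable_lab hj hs (computable_out he hs hm))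
      (computable_lab hj hs (computable_out he hs hn)))

theorem computable_redMatrix (he : Computable e) (hi : Computable i) (hj : Computable j)
    (hm : Computable m) (hn : Computable n) (hs : Computable s) (hz : Computable z) :
    Computable fun p => redMatrix (e p) (i p) (j p) (m p) (n p) (s p) (z p) :=
  computable_and (computable_and (computable_halts he hz hm) (computable_halts he hz hn))
    (computable_and
      (computable_or
        (computable_not (computable_beq (computable_lab hi hs hm) (computable_lab hi hs hn)))
        (computable_outEq he hj hm hn hz))
      (computable_or (computable_not (computable_outEq he hj hm hn hs))
        (computable_beq (computable_lab hi hz hm) (computable_lab hi hz hn))))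

end Computability

theorem isSigma03_ceerClosure {S : Set ℕ} (hS : IsSigma03 S) : IsSigma03 (ceerClosure S) := by
  obtain ⟨R, hR, hRS⟩ := hS
  refine ⟨fun i x y z =>
    R x.unpair.1.unpair.1 x.unpair.1.unpair.2 y z.unpair.1 &&
      (redMatrix x.unpair.2.unpair.1 i x.unpair.1.unpair.1 y.unpair.1.unpair.1 y.unpair.1.unpair.2
        y.unpair.2 z.unpair.2.unpair.1 &&
      redMatrix x.unpair.2.unpair.2 x.unpair.1.unpair.1 i y.unpair.1.unpair.1 y.unpair.1.unpair.2
        y.unpair.2 z.unpair.2.unpair.2), ?_, fun i => ?_⟩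
  · have hi : Computable fun p : ℕ × ℕ × ℕ × ℕ => p.1 := .fst
    have hx : Computable fun p : ℕ × ℕ × ℕ × ℕ => p.2.1 := Computable.fst.comp .snd
    have hy : Computable fun p : ℕ × ℕ × ℕ × ℕ => p.2.2.1 :=
      Computable.fst.comp (Computable.snd.comp .snd)
    have hz : Computable fun p : ℕ × ℕ × ℕ × ℕ => p.2.2.2 :=
      Computable.snd.comp (Computable.snd.comp .snd)
    have hj := computable_unpair_fst (computable_unpair_fst hx)
    have hm := computable_unpair_fst (computable_unpair_fst hy)
    have hn := computable_unpair_snd (computable_unpair_fst hy)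
    have hs := computable_unpair_snd hy
    refine computable_and ?_ (computable_and ?_ ?_)
    · exact hR.comp (g := fun p : ℕ × ℕ × ℕ × ℕ =>
        (p.2.1.unpair.1.unpair.1, p.2.1.unpair.1.unpair.2, p.2.2.1, p.2.2.2.unpair.1))
        (hj.pair ((computable_unpair_snd (computable_unpair_fst hx)).pair
          (hy.pair (computable_unpair_fst hz))))
    · exact computable_redMatrix (computable_unpair_fst (computable_unpair_snd hx)) hi hj hm hn hs
        (computable_unpair_fst (computable_unpair_snd hz))
    · exact computable_redMatrix (computable_unpair_snd (computable_unpair_snd hx)) hj hi hm hn hs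
        (computable_unpair_snd (computable_unpair_snd hz))
  · simp only [Bool.and_eq_true]
    constructor
    · rintro ⟨j, hj, h₁, h₂⟩
      obtain ⟨w, hw⟩ := (hRS j).1 hj
      obtain ⟨d, hd⟩ := computableReduction_iff.1 h₁
      obtain ⟨e, he⟩ := computableReduction_iff.1 h₂
      refine ⟨Nat.pair (Nat.pair j w) (Nat.pair d e), fun y => ?_⟩
      obtain ⟨z₀, hz₀⟩ := hw y
      obtain ⟨z₁, hz₁⟩ := hd y.unpair.1.unpair.1 y.unpair.1.unpair.2 y.unpair.2
      obtain ⟨z₂, hz₂⟩ := he y.unpair.1.unpair.1 y.unpair.1.unpair.2 y.unpair.2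
      refine ⟨Nat.pair z₀ (Nat.pair z₁ z₂), ?_⟩
      simp only [Nat.unpair_pair]
      exact ⟨hz₀, hz₁, hz₂⟩
    · rintro ⟨x, hx⟩
      refine ⟨x.unpair.1.unpair.1, (hRS _).2 ⟨x.unpair.1.unpair.2, fun y => ?_⟩,
        computableReduction_iff.2 ⟨x.unpair.2.unpair.1, fun m n s => ?_⟩,
        computableReduction_iff.2 ⟨x.unpair.2.unpair.2, fun m n s => ?_⟩⟩
      · exact (hx y).imp' (fun z => z.unpair.1) fun z hz => hz.1
      · obtain ⟨z, hz⟩ := hx (Nat.pair (Nat.pair m n) s)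
        simp only [Nat.unpair_pair] at hz
        exact ⟨_, hz.2.1⟩
      · obtain ⟨z, hz⟩ := hx (Nat.pair (Nat.pair m n) s)
        simp only [Nat.unpair_pair] at hz
        exact ⟨_, hz.2.2⟩

end CeerIndex

/-- If `S` is Σ⁰₃ and proper on the infinite ceers, then `[S]` is Σ⁰₃-complete. -/
theorem ceerClosure_Sigma03Complete (S : Set ℕ) (hS : IsSigma03 S)
    (hproper : ProperOnInfiniteCeers S) :
    IsSigma03 (ceerClosure S) ∧
      ∀ A : Set ℕ, IsSigma03 A → (· ∈ A) ≤₀ (· ∈ ceerClosure S) := by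
  have h := CeerIndex.isSigma03_ceerClosure hS
  exact ⟨h, fun _ hA => CeerIndex.manyOneReducible_ceerClosure h hproper hA⟩
end

section
/- Let (E_i) be the fixed uniform enumeration of all ceers. If S ⊆ ℕ satisfies S = [S], S is Π⁰₃, and S is proper on the infinite ceers, then S is Π⁰₃-complete: every Π⁰₃ subset of ℕ many-one reduces to S. -/
/-- A set is Π⁰₃ iff its complement is Σ⁰₃. -/
def IsPi03 (S : Set ℕ) : Prop := IsSigma03 Sᶜ

open Filter

/-- `r` is a monotone stagewise approximation of the equivalence relation `D`: at stage `s` the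
numbers `a`, `b` have been identified when `r s a = r s b`. -/
structure IsApprox (D : ℕ → ℕ → Prop) (r : ℕ → ℕ → ℕ) : Prop where
  succ : ∀ s a b, r s a = r s b → r (s + 1) a = r (s + 1) b
  spec : ∀ a b, D a b ↔ ∃ s, r s a = r s b

theorem IsApprox.mono {D : ℕ → ℕ → Prop} {r : ℕ → ℕ → ℕ} (h : IsApprox D r) {s t a b : ℕ}
    (hst : s ≤ t) (hab : r s a = r s b) : r t a = r t b := by
  induction t, hst using Nat.le_induction with
  | base => exact hab
  | succ t _ ih => exact h.succ t a b ih

namespace CeerConstruction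

/-- The list `g` codes a partial embedding: on arguments below `M`, it is constant on the colour
classes of `col`, and `R` separates the images of distinct colour classes. -/
def Fits (R : ℕ → ℕ) (col : List ℕ) (M : ℕ) (g : List ℕ) : Prop :=
  M ≤ g.length ∧ ∀ x < M, ∀ y < M,
    (col.getD x 0 = col.getD y 0 → g.getD x 0 = g.getD y 0) ∧
    (R (g.getD x 0) = R (g.getD y 0) → col.getD x 0 = col.getD y 0)

instance (R : ℕ → ℕ) (col : List ℕ) (M : ℕ) (g : List ℕ) : Decidable (Fits R col M g) := by
  unfold Fits; infer_instance

/-- The list of length `M` with code `c`. -/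
def candidate (M c : ℕ) : List ℕ :=
  (List.range M).map fun x => (Denumerable.ofNat (List ℕ) c).getD x 0

/-- Keep the list `old` if it still fits, otherwise take the first fitting candidate with code
below `s`. -/
def select (R : ℕ → ℕ) (s : ℕ) (col : List ℕ) (M : ℕ) (old : List ℕ) : List ℕ :=
  if Fits R col M old then old
  else candidate M ((List.range s).findIdx fun c => decide (Fits R col M (candidate M c)))

/-- Extend `g` to all coloured elements, compatibly with `col`, and then by an initial segment
of `ℕ`. -/
def extend (col g : List ℕ) : List ℕ :=
  g ++ (col.drop g.length).map (fun c => g.getD (col.idxOf c) 0) ++ List.range (col.length + 1)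

/-- A state consists of a stack of frames (partial maps `ℕ → ℕ`, the one with index `j + 1`
belonging to the node `j`) and of a colouring of an initial segment of `ℕ`, whose colour classes
are the classes of the relation under construction. -/
abbrev State := List (List ℕ) × List ℕ

/-- The node `j` acts at stage `s`. -/
def act (R : ℕ → ℕ) (j s : ℕ) (σ : State) : State :=
  let M := (σ.1.getD j []).length
  let g := select R s σ.2 M (σ.1.getD (j + 1) [])
  if Fits R σ.2 M g then
    (σ.1.take (j + 1) ++ [extend σ.2 g], (extend σ.2 g).map R)
  else σ

/-- The node acting when `k` is called for. -/
def node (k : ℕ) (σ : State) : ℕ := min k (σ.1.length - 1)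

/-- The state at each stage, where `fire s` is the node called for at stage `s`. -/
def state (r : ℕ → ℕ → ℕ → ℕ) (fire : ℕ → ℕ) : ℕ → State
  | 0 => ([[]], [])
  | s + 1 =>
    let σ := state r fire s
    act (r (node (fire s) σ) s) (node (fire s) σ) s σ

/-- The colourings `col` and `col'` have the same colour classes below `M`. -/
def SameOn (M : ℕ) (col col' : List ℕ) : Prop :=
  ∀ x < M, ∀ y < M, col.getD x 0 = col.getD y 0 ↔ col'.getD x 0 = col'.getD y 0

/-- The invariants of the construction. -/
structure Inv (r : ℕ → ℕ → ℕ → ℕ) (s : ℕ) (σ : State) : Prop where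
  pos : 0 < σ.1.length
  le : ∀ i, (σ.1.getD i []).length ≤ σ.2.length
  mono : ∀ i i', i ≤ i' → i' < σ.1.length → (σ.1.getD i []).length ≤ (σ.1.getD i' []).length
  comp : ∀ i, ∀ x < (σ.1.getD (i + 1) []).length, ∀ y < (σ.1.getD (i + 1) []).length,
    σ.2.getD x 0 = σ.2.getD y 0 →
    r i s ((σ.1.getD (i + 1) []).getD x 0) = r i s ((σ.1.getD (i + 1) []).getD y 0)

theorem length_candidate (M c : ℕ) : (candidate M c).length = M := by simp [candidate]

theorem candidate_encode (M : ℕ) (l : List ℕ) (x : ℕ) (hx : x < M) :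
    (candidate M (Encodable.encode l)).getD x 0 = l.getD x 0 := by
  simp [candidate, List.getD_eq_getElem?_getD, hx]

theorem length_extend (col g : List ℕ) (h : g.length ≤ col.length) :
    (extend col g).length = 2 * col.length + 1 := by
  simp [extend]; omega

theorem isPrefix_extend (col g : List ℕ) : g <+: extend col g := by
  simp [extend, List.append_assoc]

theorem getD_eq_of_isPrefix {g g' : List ℕ} (h : g <+: g') {x : ℕ} (hx : x < g.length) :
    g'.getD x 0 = g.getD x 0 := by
  obtain ⟨l, rfl⟩ := h
  exact List.getD_append _ _ _ _ hx

theorem extend_getD_of_le (col g : List ℕ) {x : ℕ} (h1 : g.length ≤ x) (h2 : x < col.length) :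
    (extend col g).getD x 0 = g.getD (col.idxOf (col.getD x 0)) 0 := by
  have h3 : x - g.length < col.length - g.length := by omega
  have h4 : g.length + (x - g.length) = x := by omega
  rw [extend, List.append_assoc, List.getD_append_right _ _ _ _ h1,
    List.getD_append _ _ _ _ (by simpa using h3)]
  simp [List.getD_eq_getElem?_getD, h3, h4, h2]

theorem exists_extend_getD (col g : List ℕ) (h : g.length ≤ col.length) {a : ℕ}
    (ha : a ≤ col.length) : ∃ x < (extend col g).length, (extend col g).getD x 0 = a := by
  refine ⟨col.length + a, by rw [length_extend _ _ h]; omega, ?_⟩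
  rw [extend, List.getD_append_right _ _ _ _ (by simp; omega)]
  have : col.length + a - (g.length + (col.length - g.length)) = a := by omega
  have h' : a < col.length + 1 := by omega
  simp [List.getD_eq_getElem?_getD, this, h']

theorem getD_map_of_lt (R : ℕ → ℕ) (g : List ℕ) {x : ℕ} (hx : x < g.length) :
    (g.map R).getD x 0 = R (g.getD x 0) := by
  simp [List.getD_eq_getElem?_getD, hx]

theorem idxOf_getD (col : List ℕ) {x : ℕ} (hx : x < col.length) :
    col.idxOf (col.getD x 0) ≤ x ∧ col.getD (col.idxOf (col.getD x 0)) 0 = col.getD x 0 := by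
  rw [List.getD_eq_getElem _ _ hx]
  have hm : col[x] ∈ col := List.getElem_mem hx
  have hl : col.idxOf col[x] < col.length := List.idxOf_lt_length_iff.2 hm
  refine ⟨?_, by rw [List.getD_eq_getElem _ _ hl]; exact List.getElem_idxOf hl⟩
  by_contra! hlt
  have := List.not_of_lt_findIdx hlt
  simp at this

theorem Fits.congr {R : ℕ → ℕ} {col g g' : List ℕ} {M : ℕ} (hM : g.length = M)
    (h : g <+: g') : Fits R col M g' ↔ Fits R col M g := by
  have hl := h.length_le
  have key : ∀ x < M, g'.getD x 0 = g.getD x 0 := fun x hx => getD_eq_of_isPrefix h (hM ▸ hx)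
  unfold Fits
  constructor
  · rintro ⟨_, h2⟩
    refine ⟨hM.ge, fun x hx y hy => ?_⟩
    rw [← key x hx, ← key y hy]; exact h2 x hx y hy
  · rintro ⟨_, h2⟩
    refine ⟨by omega, fun x hx y hy => ?_⟩
    rw [key x hx, key y hy]; exact h2 x hx y hy

variable {r : ℕ → ℕ → ℕ → ℕ} {D : ℕ → ℕ → ℕ → Prop}

theorem Inv.length_select {s j : ℕ} {σ : State} (h : Inv r s σ) :
    (select (r j s) s σ.2 (σ.1.getD j []).length (σ.1.getD (j + 1) [])).length
      ≤ σ.2.length := by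
  unfold select
  split_ifs
  · exact h.le _
  · rw [length_candidate]; exact h.le _

theorem Inv.comp_select {s j : ℕ} {σ : State} (h : Inv r s σ)
    (hf : Fits (r j s) σ.2 (σ.1.getD j []).length
      (select (r j s) s σ.2 (σ.1.getD j []).length (σ.1.getD (j + 1) []))) :
    let g := select (r j s) s σ.2 (σ.1.getD j []).length (σ.1.getD (j + 1) [])
    ∀ x < g.length, ∀ y < g.length, σ.2.getD x 0 = σ.2.getD y 0 →
      r j s (g.getD x 0) = r j s (g.getD y 0) := by
  unfold select at hf ⊢
  split_ifs at hf ⊢ with h1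
  · exact h.comp j
  · intro g x hx y hy hxy
    have hl := length_candidate (σ.1.getD j []).length ((List.range s).findIdx fun c =>
      decide (Fits (r j s) σ.2 (σ.1.getD j []).length (candidate (σ.1.getD j []).length c)))
    exact congrArg _ ((hf.2 x (hl ▸ hx) y (hl ▸ hy)).1 hxy)

theorem extend_comp {R : ℕ → ℕ} {col g : List ℕ}
    (hc : ∀ x < g.length, ∀ y < g.length, col.getD x 0 = col.getD y 0 →
      R (g.getD x 0) = R (g.getD y 0))
    {x y : ℕ} (hx : x < col.length) (hy : y < col.length)
    (hxy : col.getD x 0 = col.getD y 0) :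
    R ((extend col g).getD x 0) = R ((extend col g).getD y 0) := by
  have key : ∀ x < col.length,
      R ((extend col g).getD x 0) = R (g.getD (col.idxOf (col.getD x 0)) 0) := by
    intro x hx
    by_cases h : x < g.length
    · have := idxOf_getD col hx
      rw [getD_eq_of_isPrefix (isPrefix_extend col g) h]
      exact hc _ h _ (by omega) this.2.symm
    · rw [extend_getD_of_le col g (by omega) hx]
  rw [key x hx, key y hy, hxy]

/-- The effect of an action of the node `j` at stage `s`. -/
structure ActSpec (r : ℕ → ℕ → ℕ → ℕ) (j s : ℕ) (σ σ' : State) : Prop where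
  inv : Inv r (s + 1) σ'
  frame : ∀ i ≤ j, σ'.1.getD i [] = σ.1.getD i []
  same : SameOn (σ.1.getD j []).length σ.2 σ'.2
  length_le : σ.2.length ≤ σ'.2.length
  col : ∀ x < σ.2.length, ∀ y < σ.2.length, σ.2.getD x 0 = σ.2.getD y 0 →
    σ'.2.getD x 0 = σ'.2.getD y 0
  lt : j < σ'.1.length

theorem Inv.succ (hr : ∀ j, IsApprox (D j) (r j)) {s : ℕ} {σ : State} (h : Inv r s σ) :
    Inv r (s + 1) σ :=
  ⟨h.pos, h.le, h.mono, fun i x hx y hy hxy => (hr i).succ _ _ _ (h.comp i x hx y hy hxy)⟩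

theorem actSpec (hr : ∀ j, IsApprox (D j) (r j)) {j s : ℕ} {σ : State} (h : Inv r s σ)
    (hj : j < σ.1.length) : ActSpec r j s σ (act (r j s) j s σ) := by
  have hlen := h.length_select (j := j)
  have hcomp := h.comp_select (j := j)
  simp only [act] at hcomp ⊢
  generalize select (r j s) s σ.2 (σ.1.getD j []).length (σ.1.getD (j + 1) []) = g at *
  split_ifs with hf
  swap
  · exact ⟨h.succ hr, fun _ _ => rfl, fun _ _ _ _ => Iff.rfl, le_rfl, fun _ _ _ _ h => h, hj⟩
  specialize hcomp hf
  have hM := h.le j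
  have hE := length_extend _ _ hlen
  have htake : (σ.1.take (j + 1)).length = j + 1 := by simp; omega
  have hframe : ∀ i ≤ j, (σ.1.take (j + 1) ++ [extend σ.2 g]).getD i [] = σ.1.getD i [] := by
    intro i hi
    rw [List.getD_append _ _ _ _ (by omega)]
    have : i < j + 1 := by omega
    simp [List.getD_eq_getElem?_getD, this]
  have hlast : (σ.1.take (j + 1) ++ [extend σ.2 g]).getD (j + 1) [] = extend σ.2 g := by
    rw [List.getD_append_right _ _ _ _ (by omega), htake]; simp
  have hover : ∀ i > j + 1, (σ.1.take (j + 1) ++ [extend σ.2 g]).getD i [] = [] := by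
    intro i hi
    exact List.getD_eq_default _ _ (by simp; omega)
  have hcol : ∀ x < σ.2.length, ∀ y < σ.2.length, σ.2.getD x 0 = σ.2.getD y 0 →
      ((extend σ.2 g).map (r j s)).getD x 0 = ((extend σ.2 g).map (r j s)).getD y 0 := by
    intro x hx y hy hxy
    rw [getD_map_of_lt _ _ (by omega), getD_map_of_lt _ _ (by omega)]
    exact extend_comp hcomp hx hy hxy
  have hsame : SameOn (σ.1.getD j []).length σ.2 ((extend σ.2 g).map (r j s)) := by
    intro x hx y hy
    refine ⟨hcol x (by omega) y (by omega), fun hxy => ?_⟩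
    rw [getD_map_of_lt _ _ (by omega), getD_map_of_lt _ _ (by omega),
      getD_eq_of_isPrefix (isPrefix_extend _ g) (hx.trans_le hf.1),
      getD_eq_of_isPrefix (isPrefix_extend _ g) (hy.trans_le hf.1)] at hxy
    exact (hf.2 x hx y hy).2 hxy
  refine ⟨⟨by simp, fun i => ?_, fun i i' hii hi' => ?_, fun i x hx y hy hxy => ?_⟩, hframe,
    hsame, by simp only [List.length_map]; omega, hcol, by simp; omega⟩
  · simp only [List.length_map]
    rcases lt_trichotomy i (j + 1) with hi | hi | hi
    · rw [hframe i (by omega)]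
      have := h.le i
      omega
    · rw [hi, hlast]
    · rw [hover i hi]; simp
  · simp only [List.length_append, htake, List.length_singleton] at hi'
    rcases Nat.lt_or_ge i' (j + 1) with hi | hi
    · rw [hframe i (by omega), hframe i' (by omega)]
      exact h.mono i i' hii (by omega)
    · obtain rfl : i' = j + 1 := by omega
      rcases Nat.lt_or_ge i (j + 1) with hi2 | hi2
      · rw [hframe i (by omega), hlast]
        have := h.le i
        omega
      · obtain rfl : i = j + 1 := by omega
        exact le_rfl
  · refine (hr i).succ _ _ _ ?_
    simp only at hx hy hxy ⊢
    rcases lt_trichotomy i j with hi | hi | hi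
    · rw [hframe _ (by omega)] at hx hy ⊢
      have := h.mono (i + 1) j (by omega) hj
      exact h.comp i x hx y hy ((hsame x (by omega) y (by omega)).2 hxy)
    · subst hi
      rw [hlast] at hx hy ⊢
      rwa [getD_map_of_lt _ _ hx, getD_map_of_lt _ _ hy] at hxy
    · rw [hover _ (by omega)] at hx
      simp at hx

theorem inv_state (hr : ∀ j, IsApprox (D j) (r j)) (fire : ℕ → ℕ) (s : ℕ) :
    Inv r s (state r fire s) := by
  induction s with
  | zero =>
    refine ⟨by simp [state], fun i => ?_, fun i i' _ _ => ?_, fun i x hx => ?_⟩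
    · cases i <;> simp [state]
    · cases i <;> simp [state]
    · simp [state] at hx
  | succ s ih =>
    exact (actSpec hr ih (by have := ih.pos; unfold node; omega)).inv

theorem actSpec_state (hr : ∀ j, IsApprox (D j) (r j)) (fire : ℕ → ℕ) (s : ℕ) :
    ActSpec r (node (fire s) (state r fire s)) s (state r fire s) (state r fire (s + 1)) :=
  actSpec hr (inv_state hr fire s)
    (by have := (inv_state hr fire s).pos; unfold node; omega)

/-- The relation enumerated by the construction. -/
def Rel (r : ℕ → ℕ → ℕ → ℕ) (fire : ℕ → ℕ) (x y : ℕ) : Prop :=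
  ∃ s, x < (state r fire s).2.length ∧ y < (state r fire s).2.length ∧
    (state r fire s).2.getD x 0 = (state r fire s).2.getD y 0

theorem col_mono (hr : ∀ j, IsApprox (D j) (r j)) (fire : ℕ → ℕ) {s t : ℕ} (hst : s ≤ t) :
    (state r fire s).2.length ≤ (state r fire t).2.length ∧
    ∀ x < (state r fire s).2.length, ∀ y < (state r fire s).2.length,
      (state r fire s).2.getD x 0 = (state r fire s).2.getD y 0 →
      (state r fire t).2.getD x 0 = (state r fire t).2.getD y 0 := by
  induction t, hst using Nat.le_induction with
  | base => exact ⟨le_rfl, fun _ _ _ _ h => h⟩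
  | succ t _ ih =>
    have hs := actSpec_state hr fire t
    exact ⟨ih.1.trans hs.length_le, fun x hx y hy hxy =>
      hs.col x (hx.trans_le ih.1) y (hy.trans_le ih.1) (ih.2 x hx y hy hxy)⟩

theorem exists_least_node (fire : ℕ → ℕ) (h : ∃ k, ∃ᶠ s in atTop, fire s = k) :
    ∃ j, (∃ᶠ s in atTop, node (fire s) (state r fire s) = j) ∧
      ∀ᶠ s in atTop, j ≤ node (fire s) (state r fire s) := by
  classical
  obtain ⟨k, hk⟩ := h
  have hex : ∃ j, ∃ᶠ s in atTop, node (fire s) (state r fire s) = j := by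
    by_contra! hno
    have hall : ∀ᶠ s in atTop, ∀ j ∈ Finset.range (k + 1),
        node (fire s) (state r fire s) ≠ j :=
      (eventually_all_finset _).2 fun j _ => hno j
    refine hk (hall.mono fun s hs hfs => ?_)
    refine hs (node (fire s) (state r fire s)) ?_ rfl
    simp only [node, Finset.mem_range]
    omega
  refine ⟨Nat.find hex, Nat.find_spec hex, ?_⟩
  have hall : ∀ᶠ s in atTop, ∀ j ∈ Finset.range (Nat.find hex),
      node (fire s) (state r fire s) ≠ j :=
    (eventually_all_finset _).2 fun j hj =>
      not_frequently.1 (Nat.find_min hex (Finset.mem_range.1 hj))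
  filter_upwards [hall] with s hs
  by_contra! hlt
  exact hs _ (Finset.mem_range.2 hlt) rfl

/-- From stage `s₁` on, no node below `j` acts. -/
structure Settled (r : ℕ → ℕ → ℕ → ℕ) (fire : ℕ → ℕ) (j s₁ : ℕ) : Prop where
  node_eq : node (fire s₁) (state r fire s₁) = j
  le_node : ∀ s ≥ s₁, j ≤ node (fire s) (state r fire s)

theorem Settled.stable (hr : ∀ j, IsApprox (D j) (r j)) {fire : ℕ → ℕ} {j s₁ : ℕ}
    (hs : Settled r fire j s₁) {s : ℕ} (h : s₁ ≤ s) :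
    j < (state r fire s).1.length ∧
    (∀ i ≤ j, (state r fire s).1.getD i [] = (state r fire s₁).1.getD i []) ∧
    SameOn ((state r fire s₁).1.getD j []).length (state r fire s₁).2 (state r fire s).2 := by
  induction s, h using Nat.le_induction with
  | base =>
    refine ⟨?_, fun _ _ => rfl, fun _ _ _ _ => Iff.rfl⟩
    have h1 := hs.node_eq
    have h2 := (inv_state hr fire s₁).pos
    unfold node at h1
    omega
  | succ s h ih =>
    have ha := actSpec_state hr fire s
    have hle := hs.le_node s h
    have hlt : node (fire s) (state r fire s) < (state r fire s).1.length := by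
      have := (inv_state hr fire s).pos
      unfold node; omega
    have hmono := (inv_state hr fire s).mono _ _ hle hlt
    rw [ih.2.1 j le_rfl] at hmono
    refine ⟨hle.trans_lt ha.lt, fun i hi => (ha.frame i (hi.trans hle)).trans (ih.2.1 i hi),
      fun x hx y hy => (ih.2.2 x hx y hy).trans
        (ha.same x (hx.trans_le hmono) y (hy.trans_le hmono))⟩

theorem act_of_fits {R : ℕ → ℕ} {j s : ℕ} {σ : State} (hj : j < σ.1.length)
    (hf : Fits R σ.2 (σ.1.getD j []).length
      (select R s σ.2 (σ.1.getD j []).length (σ.1.getD (j + 1) []))) :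
    let g := select R s σ.2 (σ.1.getD j []).length (σ.1.getD (j + 1) [])
    (act R j s σ).1.length = j + 2 ∧ (act R j s σ).1.getD (j + 1) [] = extend σ.2 g ∧
      (act R j s σ).2 = (extend σ.2 g).map R := by
  simp only [act, if_pos hf]
  have htake : (σ.1.take (j + 1)).length = j + 1 := by simp; omega
  refine ⟨by simp; omega, ?_, trivial⟩
  rw [List.getD_append_right _ _ _ _ (by omega), htake]; simp

theorem findIdx_range {p : ℕ → Bool} {c s : ℕ} (hc : c < s) (hp : p c = true) :
    (List.range s).findIdx p ≤ c ∧ p ((List.range s).findIdx p) = true := by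
  have hlt : (List.range s).findIdx p < (List.range s).length :=
    List.findIdx_lt_length_of_exists ⟨c, List.mem_range.2 hc, hp⟩
  have h2 := List.findIdx_getElem (w := hlt)
  rw [List.getElem_range] at h2
  refine ⟨?_, h2⟩
  by_contra! h
  have := List.not_of_lt_findIdx h
  rw [List.getElem_range] at this
  simp [hp] at this

theorem Settled.fits_anti (hr : ∀ j, IsApprox (D j) (r j)) {fire : ℕ → ℕ} {j s₁ : ℕ}
    (hs : Settled r fire j s₁) {s s' : ℕ} (h : s₁ ≤ s) (h' : s ≤ s') {g : List ℕ}
    (hf : Fits (r j s') (state r fire s').2 ((state r fire s₁).1.getD j []).length g) :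
    Fits (r j s) (state r fire s).2 ((state r fire s₁).1.getD j []).length g := by
  have h1 := (hs.stable hr h).2.2
  have h2 := (hs.stable hr (h.trans h')).2.2
  refine ⟨hf.1, fun x hx y hy => ⟨fun hxy => ?_, fun hxy => ?_⟩⟩
  · exact (hf.2 x hx y hy).1 ((h2 x hx y hy).1 ((h1 x hx y hy).2 hxy))
  · exact (h1 x hx y hy).1 ((h2 x hx y hy).2 ((hf.2 x hx y hy).2 ((hr j).mono h' hxy)))

theorem Settled.exists_fits (hr : ∀ j, IsApprox (D j) (r j))
    (hD : ∀ j, HasInfinitelyManyClasses (D j)) {fire : ℕ → ℕ} {j s₁ : ℕ}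
    (hs : Settled r fire j s₁) :
    ∃ c, ∀ s ≥ s₁, Fits (r j s) (state r fire s).2 ((state r fire s₁).1.getD j []).length
      (candidate ((state r fire s₁).1.getD j []).length c) := by
  obtain ⟨f, hf⟩ := hD j
  set col := (state r fire s₁).2 with hcol
  set M := ((state r fire s₁).1.getD j []).length with hM
  have hMcol : M ≤ col.length := (inv_state hr fire s₁).le j
  refine ⟨Encodable.encode ((List.range M).map fun x => f (col.idxOf (col.getD x 0))),
    fun s h => ⟨(length_candidate _ _).ge, fun x hx y hy => ?_⟩⟩
  have hstab := (hs.stable hr h).2.2 x hx y hy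
  rw [candidate_encode _ _ _ hx, candidate_encode _ _ _ hy,
    show ∀ x < M, ((List.range M).map fun x => f (col.idxOf (col.getD x 0))).getD x 0
      = f (col.idxOf (col.getD x 0)) from fun x hx => by
        simp [List.getD_eq_getElem?_getD, hx] , ← hstab]
  · rw [show ((List.range M).map fun x => f (col.idxOf (col.getD x 0))).getD y 0
      = f (col.idxOf (col.getD y 0)) by simp [List.getD_eq_getElem?_getD, hy]]
    refine ⟨fun hxy => by rw [hxy], fun hxy => ?_⟩
    have hd := ((hr j).spec _ _).2 ⟨s, hxy⟩
    have hidx : col.idxOf (col.getD x 0) = col.idxOf (col.getD y 0) := by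
      by_contra hne
      exact hf _ _ hne hd
    rw [← (idxOf_getD col (hx.trans_le hMcol)).2, hidx,
      (idxOf_getD col (hy.trans_le hMcol)).2]
  · exact hx

/-- Eventually every action of the settled node succeeds, and whenever it changes its embedding,
the new embedding is never invalidated. -/
theorem Settled.eventually_select (hr : ∀ j, IsApprox (D j) (r j))
    (hD : ∀ j, HasInfinitelyManyClasses (D j)) {fire : ℕ → ℕ} {j s₁ : ℕ}
    (hs : Settled r fire j s₁) (M : ℕ) (hM : M = ((state r fire s₁).1.getD j []).length) :
    ∀ᶠ s in atTop, ∀ old, Fits (r j s) (state r fire s).2 M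
        (select (r j s) s (state r fire s).2 M old) ∧
      (Fits (r j s) (state r fire s).2 M old ∨
        (select (r j s) s (state r fire s).2 M old).length = M ∧
        ∀ s' ≥ s, Fits (r j s') (state r fire s').2 M
          (select (r j s) s (state r fire s).2 M old)) := by
  subst hM
  set M := ((state r fire s₁).1.getD j []).length with hM
  obtain ⟨c, hc⟩ := hs.exists_fits hr hD
  have hall : ∀ᶠ s in atTop, ∀ d ∈ Finset.range (c + 1),
      Fits (r j s) (state r fire s).2 M (candidate M d) →
      ∀ s' ≥ s, Fits (r j s') (state r fire s').2 M (candidate M d) := by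
    refine (eventually_all_finset _).2 fun d _ => ?_
    by_cases hd : ∀ s ≥ s₁, Fits (r j s) (state r fire s).2 M (candidate M d)
    · filter_upwards [eventually_ge_atTop s₁] with s hs _ s' hs'
      exact hd s' (hs.trans hs')
    · push Not at hd
      obtain ⟨t, ht, hnf⟩ := hd
      filter_upwards [eventually_ge_atTop t] with s hst hf
      exact absurd (hs.fits_anti hr ht hst hf) hnf
  filter_upwards [hall, eventually_ge_atTop s₁, eventually_gt_atTop c] with s h1 h2 h3 old
  by_cases hold : Fits (r j s) (state r fire s).2 M old
  · simp [select, hold]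
  · obtain ⟨hle, hfit⟩ := findIdx_range
      (p := fun d => decide (Fits (r j s) (state r fire s).2 M (candidate M d))) h3
      (decide_eq_true (hc s h2))
    have hfit := of_decide_eq_true hfit
    simp only [select, if_neg hold]
    exact ⟨hfit, Or.inr ⟨length_candidate _ _,
      h1 _ (Finset.mem_range.2 (by omega)) hfit⟩⟩

/-- The current frame of the node `j`. -/
def frame (r : ℕ → ℕ → ℕ → ℕ) (fire : ℕ → ℕ) (j s : ℕ) : List ℕ :=
  (state r fire s).1.getD (j + 1) []

/-- From stage `s₂` on, the frame of the node `j` is only ever extended. -/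
structure Locked (r : ℕ → ℕ → ℕ → ℕ) (fire : ℕ → ℕ) (j s₂ : ℕ) : Prop where
  lt : ∀ s ≥ s₂, j + 1 < (state r fire s).1.length
  le_node : ∀ s ≥ s₂, j ≤ node (fire s) (state r fire s)
  frame_succ : ∀ s ≥ s₂, node (fire s) (state r fire s) = j →
    frame r fire j (s + 1) = extend (state r fire s).2 (frame r fire j s) ∧
    (state r fire (s + 1)).2 = (frame r fire j (s + 1)).map (r j s)

theorem frame_succ_of_lt (hr : ∀ j, IsApprox (D j) (r j)) {fire : ℕ → ℕ} {j s : ℕ}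
    (h : j < node (fire s) (state r fire s)) : frame r fire j (s + 1) = frame r fire j s :=
  (actSpec_state hr fire s).frame (j + 1) h

theorem Settled.exists_locked (hr : ∀ j, IsApprox (D j) (r j))
    (hD : ∀ j, HasInfinitelyManyClasses (D j)) {fire : ℕ → ℕ} {j s₁ : ℕ}
    (hs : Settled r fire j s₁) (hj : ∃ᶠ s in atTop, node (fire s) (state r fire s) = j) :
    ∃ s₂, Locked r fire j s₂ := by
  obtain ⟨M, hM⟩ : ∃ M, M = ((state r fire s₁).1.getD j []).length := ⟨_, rfl⟩
  obtain ⟨s₃, hs₃⟩ := eventually_atTop.1 (hs.eventually_select hr hD M hM)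
  have hsucc : ∀ s ≥ max s₁ s₃, node (fire s) (state r fire s) = j →
      (state r fire (s + 1)).1.length = j + 2 ∧
      frame r fire j (s + 1) = extend (state r fire s).2
        (select (r j s) s (state r fire s).2 M (frame r fire j s)) ∧
      (state r fire (s + 1)).2 = (frame r fire j (s + 1)).map (r j s) := by
    intro s h hn
    have hst := hs.stable hr ((le_max_left _ _).trans h)
    have hf := (hs₃ s ((le_max_right _ _).trans h) (frame r fire j s)).1
    rw [hM, ← hst.2.1 j le_rfl] at hf
    have hact := act_of_fits hst.1 hf
    have hstate : state r fire (s + 1) = act (r j s) j s (state r fire s) := by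
      simp only [state, hn]
    rw [hM, ← hst.2.1 j le_rfl]
    unfold frame
    rw [hstate]
    exact ⟨hact.1, hact.2.1, by rw [hact.2.1, hact.2.2]⟩
  obtain ⟨s₄, h₄, hn₄⟩ := frequently_atTop.1 hj (max s₁ s₃)
  have hge : ∀ s ≥ s₄, j ≤ node (fire s) (state r fire s) := fun s h =>
    hs.le_node s ((le_max_left _ _).trans (h₄.trans h))
  have hlen : ∀ s ≥ s₄ + 1, j + 1 < (state r fire s).1.length := by
    have : ∀ s ≥ s₄, j + 1 < (state r fire (s + 1)).1.length := by
      intro s h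
      rcases (hge s h).eq_or_lt with heq | hlt
      · have := (hsucc s (h₄.trans h) heq.symm).1
        omega
      · exact (Nat.succ_le_of_lt hlt).trans_lt (actSpec_state hr fire s).lt
    intro s h
    obtain ⟨t, rfl⟩ : ∃ t, s = t + 1 := ⟨s - 1, by omega⟩
    exact this t (by omega)
  have hlock : ∀ s₂ ≥ s₄ + 1, (∀ s ≥ s₂, node (fire s) (state r fire s) = j →
      Fits (r j s) (state r fire s).2 M (frame r fire j s)) → Locked r fire j s₂ := by
    refine fun s₂ h₂ hfit => ⟨fun s h => hlen s (by omega), fun s h => hge s (by omega),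
      fun s h hn => ?_⟩
    have h := hsucc s (h₄.trans (by omega)) hn
    rw [select, if_pos (hfit s ‹_› hn)] at h
    exact h.2
  by_cases hall : ∀ s ≥ s₄ + 1, node (fire s) (state r fire s) = j →
      Fits (r j s) (state r fire s).2 M (frame r fire j s)
  · exact ⟨_, hlock _ le_rfl hall⟩
  push Not at hall
  obtain ⟨s₅, h₅, hn₅, hnf⟩ := hall
  have hsel := (hs₃ s₅ (by have := le_max_right s₁ s₃; omega)
    (frame r fire j s₅)).2.resolve_left hnf
  have hfr := (hsucc s₅ (by omega) hn₅).2.1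
  generalize select (r j s₅) s₅ (state r fire s₅).2 M (frame r fire j s₅) = g at hsel hfr
  have hfits : ∀ s ≥ s₅, g <+: frame r fire j s →
      Fits (r j s) (state r fire s).2 M (frame r fire j s) := fun s h hp =>
    (Fits.congr hsel.1 hp).2 (hsel.2 s h)
  have hpre : ∀ s ≥ s₅ + 1, g <+: frame r fire j s := by
    intro s h
    induction s, h using Nat.le_induction with
    | base => rw [hfr]; exact isPrefix_extend _ _
    | succ s h ih =>
      rcases (hge s (by omega)).eq_or_lt with heq | hlt
      · rw [(hsucc s (by omega) heq.symm).2.1, select, if_pos (hfits s (by omega) ih)]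
        exact ih.trans (isPrefix_extend _ _)
      · rwa [frame_succ_of_lt hr hlt]
  exact ⟨s₅ + 1, hlock _ (by omega) fun s h _ => hfits s (by omega) (hpre s h)⟩

theorem Locked.frequently_fire {fire : ℕ → ℕ} {j s₂ : ℕ} (h : Locked r fire j s₂)
    (hj : ∃ᶠ s in atTop, node (fire s) (state r fire s) = j) :
    ∃ᶠ s in atTop, fire s = j := by
  refine (hj.and_eventually (eventually_ge_atTop s₂)).mono fun s hs => ?_
  have h1 := h.lt s hs.2
  have h2 := hs.1
  unfold node at h2
  omega

theorem Locked.frame_isPrefix (hr : ∀ j, IsApprox (D j) (r j)) {fire : ℕ → ℕ} {j s₂ : ℕ}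
    (h : Locked r fire j s₂) {s t : ℕ} (hs : s₂ ≤ s) (hst : s ≤ t) :
    frame r fire j s <+: frame r fire j t := by
  induction t, hst using Nat.le_induction with
  | base => exact List.prefix_rfl
  | succ t ht ih =>
    rcases (h.le_node t (by omega)).eq_or_lt with heq | hlt
    · rw [(h.frame_succ t (by omega) heq.symm).1]
      exact ih.trans (isPrefix_extend _ _)
    · rwa [frame_succ_of_lt hr hlt]

theorem Locked.exists_lt_length (hr : ∀ j, IsApprox (D j) (r j)) {fire : ℕ → ℕ} {j s₂ : ℕ}
    (h : Locked r fire j s₂) (hj : ∃ᶠ s in atTop, node (fire s) (state r fire s) = j) (x : ℕ) :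
    ∃ s ≥ s₂, x < (frame r fire j s).length := by
  induction x with
  | zero =>
    obtain ⟨s, hs, hn⟩ := frequently_atTop.1 hj s₂
    refine ⟨s + 1, by omega, ?_⟩
    have h2 : (frame r fire j s).length ≤ _ := (inv_state hr fire s).le (j + 1)
    rw [(h.frame_succ s hs hn).1, length_extend _ _ h2]
    omega
  | succ x ih =>
    obtain ⟨s, hs, hx⟩ := ih
    obtain ⟨t, ht, hn⟩ := frequently_atTop.1 hj s
    refine ⟨t + 1, by omega, ?_⟩
    have h1 := (h.frame_isPrefix hr hs ht).length_le
    have h2 : (frame r fire j t).length ≤ _ := (inv_state hr fire t).le (j + 1)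
    rw [(h.frame_succ t (by omega) hn).1, length_extend _ _ h2]
    omega

end CeerConstruction

theorem Computable.exists_of_forall_exists {p : ℕ → ℕ → Bool} (hp : Computable₂ p)
    (h : ∀ x, ∃ s, p x s = true) : ∃ f : ℕ → ℕ, Computable f ∧ ∀ x, p x (f x) = true := by
  have hpart : Partrec fun x => Nat.rfind fun s => Part.some (p x s) :=
    Partrec.rfind hp.partrec₂
  have hdom : ∀ x, (Nat.rfind fun s => Part.some (p x s)).Dom := fun x => by
    obtain ⟨s, hs⟩ := h x
    exact Nat.rfind_dom.2 ⟨s, by simp [hs], fun _ => trivial⟩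
  refine ⟨fun x => (Nat.rfind fun s => Part.some (p x s)).get (hdom x),
    hpart.of_eq_tot fun x => Part.get_mem _, fun x => ?_⟩
  have := Nat.rfind_spec (Part.get_mem (hdom x))
  exact (Part.mem_some_iff.1 this).symm

namespace CeerConstruction

variable {r : ℕ → ℕ → ℕ → ℕ} {D : ℕ → ℕ → ℕ → Prop}

theorem exists_computable_reduction (hr : ∀ j, IsApprox (D j) (r j))
    (hD : ∀ j, HasInfinitelyManyClasses (D j)) {fire : ℕ → ℕ}
    (hstate : Computable (state r fire)) (h : ∃ k, ∃ᶠ s in atTop, fire s = k) :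
    ∃ k, (∃ᶠ s in atTop, fire s = k) ∧ ∃ G : ℕ → ℕ, Computable G ∧ (∀ a, ∃ x, G x = a) ∧
      ∀ x y, Rel r fire x y ↔ D k (G x) (G y) := by
  obtain ⟨j, hj, hge⟩ := exists_least_node (r := r) fire h
  obtain ⟨s₀, hs₀⟩ := eventually_atTop.1 hge
  obtain ⟨s₁, h₁, hn₁⟩ := frequently_atTop.1 hj s₀
  obtain ⟨s₂, hl⟩ := Settled.exists_locked hr hD
    (⟨hn₁, fun s hs => hs₀ s (h₁.trans hs)⟩ : Settled r fire j s₁) hj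
  have hframe : Computable (frame r fire j) :=
    ((Primrec.list_getD []).comp Primrec.id (Primrec.const (j + 1))).to_comp.comp
      (Computable.fst.comp hstate)
  obtain ⟨f, hf, hfspec⟩ := Computable.exists_of_forall_exists
    (p := fun x s => decide (s₂ ≤ s ∧ x < (frame r fire j s).length))
    ((PrimrecPred.and (Primrec.nat_le.comp (Primrec.const s₂) (Primrec.fst.comp Primrec.snd))
        (Primrec.nat_lt.comp Primrec.fst (Primrec.snd.comp Primrec.snd)) :
        PrimrecPred fun p : ℕ × ℕ × ℕ => s₂ ≤ p.2.1 ∧ p.1 < p.2.2).decide.to_comp.comp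
      (Computable.fst.pair (Computable.snd.pair
        ((Computable.list_length.comp hframe).comp Computable.snd))))
    (fun x => by
      obtain ⟨s, hs, hx⟩ := hl.exists_lt_length hr hj x
      exact ⟨s, decide_eq_true ⟨hs, hx⟩⟩)
  have hfspec : ∀ x, s₂ ≤ f x ∧ x < (frame r fire j (f x)).length := fun x =>
    of_decide_eq_true (hfspec x)
  have hG : ∀ s ≥ s₂, ∀ x < (frame r fire j s).length,
      (frame r fire j s).getD x 0 = (frame r fire j (f x)).getD x 0 := by
    intro s hs x hx
    rcases le_total s (f x) with hle | hle
    · exact (getD_eq_of_isPrefix (hl.frame_isPrefix hr hs hle) hx).symm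
    · exact getD_eq_of_isPrefix (hl.frame_isPrefix hr (hfspec x).1 hle) (hfspec x).2
  have hlarge : ∀ x t, ∃ s ≥ s₂, t ≤ s ∧ node (fire s) (state r fire s) = j ∧
      x < (frame r fire j s).length := by
    intro x t
    obtain ⟨s, hs, hn⟩ := frequently_atTop.1 hj (max t (f x))
    exact ⟨s, (hfspec x).1.trans ((le_max_right _ _).trans hs), (le_max_left _ _).trans hs, hn,
      (hfspec x).2.trans_le
        (hl.frame_isPrefix hr (hfspec x).1 ((le_max_right _ _).trans hs)).length_le⟩
  refine ⟨j, hl.frequently_fire hj, fun x => (frame r fire j (f x)).getD x 0,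
    (Primrec.list_getD 0).to_comp.comp (hframe.comp hf) Computable.id, fun a => ?_,
    fun x y => ⟨?_, fun hxy => ?_⟩⟩
  · obtain ⟨s, hs, -, hn, ha⟩ := hlarge a 0
    have hle : (frame r fire j s).length ≤ _ := (inv_state hr fire s).le (j + 1)
    obtain ⟨x, hx, hxa⟩ := exists_extend_getD (state r fire s).2 (frame r fire j s) hle
      (a := a) (by omega)
    rw [← (hl.frame_succ s hs hn).1] at hx hxa
    exact ⟨x, by beta_reduce; rw [← hG (s + 1) (by omega) x hx, hxa]⟩
  · rintro ⟨t, hx, hy, hxy⟩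
    obtain ⟨s, hs, hts, -, hm⟩ := hlarge (max x y) t
    have hxs : x < (frame r fire j s).length := (le_max_left _ _).trans_lt hm
    have hys : y < (frame r fire j s).length := (le_max_right _ _).trans_lt hm
    have := (inv_state hr fire s).comp j x hxs y hys ((col_mono hr fire hts).2 x hx y hy hxy)
    refine ((hr j).spec _ _).2 ⟨s, ?_⟩
    beta_reduce
    rw [← hG s hs x hxs, ← hG s hs y hys]
    exact this
  · obtain ⟨t, ht⟩ := ((hr j).spec _ _).1 hxy
    obtain ⟨s, hs, hts, hn, hm⟩ := hlarge (max x y) t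
    have hle : (frame r fire j s).length ≤ (frame r fire j (s + 1)).length :=
      (hl.frame_isPrefix hr hs (Nat.le_succ s)).length_le
    have hxs : x < (frame r fire j (s + 1)).length := by have := le_max_left x y; omega
    have hys : y < (frame r fire j (s + 1)).length := by have := le_max_right x y; omega
    refine ⟨s + 1, ?_⟩
    rw [(hl.frame_succ s hs hn).2, List.length_map, getD_map_of_lt _ _ hxs,
      getD_map_of_lt _ _ hys, hG _ (by omega) x hxs, hG _ (by omega) y hys]
    exact ⟨hxs, hys, (hr j).mono hts ht⟩

theorem ceerEquiv_eqvGen (hr : ∀ j, IsApprox (D j) (r j)) (hDe : ∀ j, Equivalence (D j))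
    (hD : ∀ j, HasInfinitelyManyClasses (D j)) {fire : ℕ → ℕ}
    (hstate : Computable (state r fire)) (h : ∃ k, ∃ᶠ s in atTop, fire s = k) :
    ∃ k, (∃ᶠ s in atTop, fire s = k) ∧ CeerEquiv (Relation.EqvGen (Rel r fire)) (D k) := by
  obtain ⟨k, hk, G, hG, hsurj, hrel⟩ := exists_computable_reduction hr hD hstate h
  have he : Equivalence (Rel r fire) :=
    ⟨fun x => (hrel x x).2 ((hDe k).refl _), fun h => (hrel _ _).2 ((hDe k).symm ((hrel _ _).1 h)),
      fun h h' => (hrel _ _).2 ((hDe k).trans ((hrel _ _).1 h) ((hrel _ _).1 h'))⟩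
  refine ⟨k, hk, ?_⟩
  rw [he.eqvGen_eq]
  obtain ⟨H, hH, hHspec⟩ := Computable.exists_of_forall_exists
    (p := fun a x => decide (G x = a))
    ((Primrec.eq.decide.to_comp.comp (hG.comp Computable.snd) Computable.fst))
    (fun a => by simpa using hsurj a)
  have hHspec : ∀ a, G (H a) = a := fun a => of_decide_eq_true (hHspec a)
  exact ⟨⟨G, hG, hrel⟩, ⟨H, hH, fun a b => by rw [hrel, hHspec, hHspec]⟩⟩


end CeerConstruction

namespace CeerApprox

/-- The map replacing `p.1` by `p.2` for the pairs `p` of the list `l` in turn. -/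
def repr (l : List (ℕ × ℕ)) (x : ℕ) : ℕ :=
  l.foldl (fun v p => bif v == p.1 then p.2 else v) x

theorem repr_append (l : List (ℕ × ℕ)) (u v x : ℕ) :
    repr (l ++ [(u, v)]) x = if repr l x = u then v else repr l x := by
  simp [repr, List.foldl_append, Bool.cond_eq_ite]

/-- The `t`-th stage of the enumeration of `W i`, where `t` is the code of a number of steps and of
the element under test. -/
def test (i t : ℕ) : Bool :=
  (Nat.Partrec.Code.evaln t.unpair.1 (Denumerable.ofNat Nat.Partrec.Code i) t.unpair.2).isSome

/-- The list of replacements which by stage `s` have been made in order to identify the elements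
equivalent under `ceer i`. -/
def merges (i : ℕ) : ℕ → List (ℕ × ℕ)
  | 0 => []
  | t + 1 => bif test i t then
      merges i t ++ [(repr (merges i t) t.unpair.2.unpair.1, repr (merges i t) t.unpair.2.unpair.2)]
    else merges i t

/-- The representative at stage `s` of the class of `x` under `ceer i`. -/
def approx (i s x : ℕ) : ℕ := repr (merges i s) x

theorem mem_W_iff (i n : ℕ) : n ∈ W i ↔ ∃ k, test i (Nat.pair k n) = true := by
  unfold W test
  simp only [Set.mem_ofPred_eq, Part.dom_iff_mem, Nat.unpair_pair, Option.isSome_iff_exists]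
  constructor
  · rintro ⟨y, hy⟩
    obtain ⟨k, hk⟩ := Nat.Partrec.Code.evaln_complete.1 hy
    exact ⟨k, y, hk⟩
  · rintro ⟨k, y, hy⟩
    exact ⟨y, Nat.Partrec.Code.evaln_complete.2 ⟨k, hy⟩⟩

theorem ceer_equivalence (i : ℕ) : Equivalence (ceer i) := Relation.EqvGen.is_equivalence _

theorem approx_succ (i s a : ℕ) : approx i (s + 1) a =
    if test i s = true ∧ approx i s a = approx i s s.unpair.2.unpair.1 then
      approx i s s.unpair.2.unpair.2 else approx i s a := by
  unfold approx
  rw [merges]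
  cases h : test i s
  · simp
  · simp [repr_append]

theorem ceer_approx (i s a : ℕ) : ceer i a (approx i s a) := by
  have he := ceer_equivalence i
  induction s generalizing a with
  | zero => exact he.refl a
  | succ s ih =>
    rw [approx_succ]
    split_ifs with h
    · have hm : ceer i s.unpair.2.unpair.1 s.unpair.2.unpair.2 := by
        refine Relation.EqvGen.rel _ _ ?_
        rw [Nat.pair_unpair, mem_W_iff]
        exact ⟨s.unpair.1, by rw [Nat.pair_unpair]; exact h.1⟩
      refine he.trans ?_ (he.trans hm (ih _))
      have := ih a
      rw [h.2] at this
      exact he.trans this (he.symm (ih _))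
    · exact ih a

theorem isApprox (i : ℕ) : IsApprox (ceer i) (approx i) := by
  have hsucc : ∀ s a b, approx i s a = approx i s b → approx i (s + 1) a = approx i (s + 1) b := by
    intro s a b h
    rw [approx_succ, approx_succ, h]
  have hmono : ∀ s t a b, s ≤ t → approx i s a = approx i s b → approx i t a = approx i t b := by
    intro s t a b hst h
    induction t, hst using Nat.le_induction with
    | base => exact h
    | succ t _ ih => exact hsucc t a b ih
  have he := ceer_equivalence i
  refine ⟨hsucc, fun a b => ⟨fun h => ?_, fun ⟨s, h⟩ => ?_⟩⟩
  · induction h with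
    | rel a b h =>
      obtain ⟨k, hk⟩ := (mem_W_iff _ _).1 h
      refine ⟨Nat.pair k (Nat.pair a b) + 1, ?_⟩
      simp only [approx_succ, hk, Nat.unpair_pair, true_and]
      split_ifs <;> simp_all
    | refl a => exact ⟨0, rfl⟩
    | symm a b _ ih => obtain ⟨s, h⟩ := ih; exact ⟨s, h.symm⟩
    | trans a b c _ _ ih ih' =>
      obtain ⟨s, h⟩ := ih
      obtain ⟨t, h'⟩ := ih'
      exact ⟨max s t, (hmono _ _ _ _ (le_max_left _ _) h).trans
        (hmono _ _ _ _ (le_max_right _ _) h')⟩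
  · have := ceer_approx i s a
    rw [h] at this
    exact he.trans this (he.symm (ceer_approx i s b))

theorem primrec_repr : Primrec₂ repr := by
  refine Primrec.list_foldl (f := fun p : List (ℕ × ℕ) × ℕ => p.1) (g := fun p => p.2)
    (h := fun _ q => bif q.1 == q.2.1 then q.2.2 else q.1) Primrec.fst Primrec.snd ?_
  have h1 : Primrec fun x : (List (ℕ × ℕ) × ℕ) × ℕ × ℕ × ℕ => x.2.1 :=
    Primrec.fst.comp Primrec.snd
  have h2 : Primrec fun x : (List (ℕ × ℕ) × ℕ) × ℕ × ℕ × ℕ => x.2.2 :=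
    Primrec.snd.comp Primrec.snd
  exact Primrec.cond (Primrec.beq.comp h1 (Primrec.fst.comp h2)) (Primrec.snd.comp h2) h1

theorem primrec_test (i : ℕ) : Primrec (test i) := by
  have h : Primrec fun t : ℕ =>
      ((t.unpair.1, Denumerable.ofNat Nat.Partrec.Code i), t.unpair.2) :=
    ((Primrec.fst.comp Primrec.unpair).pair (Primrec.const _)).pair
      (Primrec.snd.comp Primrec.unpair)
  exact Primrec.option_isSome.comp (Nat.Partrec.Code.primrec_evaln.comp h)

theorem primrec_merges (i : ℕ) : Primrec (merges i) := by
  have h1 : Primrec fun p : ℕ × List (ℕ × ℕ) => p.1.unpair.2.unpair :=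
    Primrec.unpair.comp (Primrec.snd.comp (Primrec.unpair.comp Primrec.fst))
  have hstep : Primrec₂ fun (t : ℕ) (l : List (ℕ × ℕ)) => bif test i t then
      l ++ [(repr l t.unpair.2.unpair.1, repr l t.unpair.2.unpair.2)] else l :=
    Primrec.cond ((primrec_test i).comp Primrec.fst)
      (Primrec.list_append.comp Primrec.snd (Primrec.list_cons.comp
        ((primrec_repr.comp Primrec.snd (Primrec.fst.comp h1)).pair
          (primrec_repr.comp Primrec.snd (Primrec.snd.comp h1))) (Primrec.const [])))
      Primrec.snd
  refine (Primrec.nat_rec₁ [] hstep).of_eq fun s => ?_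
  induction s with
  | zero => rfl
  | succ s ih => simp only [merges, ← ih]

theorem primrec_approx (i : ℕ) : Primrec₂ (approx i) :=
  primrec_repr.comp ((primrec_merges i).comp Primrec.fst) Primrec.snd

end CeerApprox

theorem PrimrecRel.forall_lt_comp {α : Type*} [Primcodable α] {P : ℕ → α → Prop}
    {M : α → ℕ} (hP : PrimrecRel P) (hM : Primrec M) :
    PrimrecPred fun a => ∀ x < M a, P x a := by
  have h := PrimrecRel.comp (f := fun a => List.range (M a)) (g := fun a => a)
    hP.forall_mem_list (Primrec.list_range.comp hM) Primrec.id
  simpa only [List.mem_range] using h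

theorem PrimrecPred.forall_lt_forall_lt {α : Type*} [Primcodable α] {P : ℕ → ℕ → α → Prop}
    {M : α → ℕ} (hM : Primrec M) (hP : PrimrecRel fun (y : ℕ) (p : ℕ × α) => P p.1 y p.2) :
    PrimrecPred fun a => ∀ x < M a, ∀ y < M a, P x y a :=
  PrimrecRel.forall_lt_comp
    (P := fun x a => ∀ y < M a, P x y a) (hP.forall_lt_comp (hM.comp Primrec.snd)) hM

namespace CeerConstruction

variable {r : ℕ → ℕ → ℕ → ℕ}

theorem primrecPred_fits (hr : Primrec fun p : ℕ × ℕ × ℕ => r p.1 p.2.1 p.2.2) :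
    PrimrecPred fun q : (ℕ × ℕ) × List ℕ × ℕ × List ℕ =>
      Fits (r q.1.1 q.1.2) q.2.1 q.2.2.1 q.2.2.2 := by
  have hcol : ∀ {α : Type} [Primcodable α] {q : α → (ℕ × ℕ) × List ℕ × ℕ × List ℕ} {x : α → ℕ},
      Primrec q → Primrec x → Primrec fun a => (q a).2.1.getD (x a) 0 := fun hq hx =>
    (Primrec.list_getD 0).comp (Primrec.fst.comp (Primrec.snd.comp hq)) hx
  have hg : ∀ {α : Type} [Primcodable α] {q : α → (ℕ × ℕ) × List ℕ × ℕ × List ℕ} {x : α → ℕ},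
      Primrec q → Primrec x → Primrec fun a => (q a).2.2.2.getD (x a) 0 := fun hq hx =>
    (Primrec.list_getD 0).comp (Primrec.snd.comp (Primrec.snd.comp (Primrec.snd.comp hq))) hx
  have hrg : ∀ {α : Type} [Primcodable α] {q : α → (ℕ × ℕ) × List ℕ × ℕ × List ℕ} {x : α → ℕ},
      Primrec q → Primrec x → Primrec fun a => r (q a).1.1 (q a).1.2 ((q a).2.2.2.getD (x a) 0) :=
    fun hq hx => hr.comp ((Primrec.fst.comp (Primrec.fst.comp hq)).pair
      ((Primrec.snd.comp (Primrec.fst.comp hq)).pair (hg hq hx)))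
  have hM : Primrec fun q : (ℕ × ℕ) × List ℕ × ℕ × List ℕ => q.2.2.1 :=
    Primrec.fst.comp (Primrec.snd.comp Primrec.snd)
  have hy : Primrec fun p : ℕ × ℕ × (ℕ × ℕ) × List ℕ × ℕ × List ℕ => p.1 := Primrec.fst
  have hx : Primrec fun p : ℕ × ℕ × (ℕ × ℕ) × List ℕ × ℕ × List ℕ => p.2.1 :=
    Primrec.fst.comp Primrec.snd
  have hq : Primrec fun p : ℕ × ℕ × (ℕ × ℕ) × List ℕ × ℕ × List ℕ => p.2.2 :=
    Primrec.snd.comp Primrec.snd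
  have hcc := Primrec.eq.comp (hcol hq hx) (hcol hq hy)
  have hgg := Primrec.eq.comp (hg hq hx) (hg hq hy)
  have hrr := Primrec.eq.comp (hrg hq hx) (hrg hq hy)
  have hall := PrimrecPred.forall_lt_forall_lt
    (P := fun x y (q : (ℕ × ℕ) × List ℕ × ℕ × List ℕ) =>
      (q.2.1.getD x 0 = q.2.1.getD y 0 → q.2.2.2.getD x 0 = q.2.2.2.getD y 0) ∧
      (r q.1.1 q.1.2 (q.2.2.2.getD x 0) = r q.1.1 q.1.2 (q.2.2.2.getD y 0) →
        q.2.1.getD x 0 = q.2.1.getD y 0)) hM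
    (((hcc.not.or hgg).and (hrr.not.or hcc)).of_eq fun _ =>
      and_congr imp_iff_not_or.symm imp_iff_not_or.symm)
  exact (Primrec.nat_le.comp hM (Primrec.list_length.comp
    (Primrec.snd.comp (Primrec.snd.comp Primrec.snd)))).and hall

theorem primrec_candidate : Primrec₂ candidate :=
  Primrec.list_map (Primrec.list_range.comp Primrec.fst)
    ((Primrec.list_getD 0).comp ((Primrec.ofNat (List ℕ)).comp (Primrec.snd.comp Primrec.fst))
      Primrec.snd)

theorem primrec_select (hr : Primrec fun p : ℕ × ℕ × ℕ => r p.1 p.2.1 p.2.2) :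
    Primrec fun q : (ℕ × ℕ) × List ℕ × ℕ × List ℕ =>
      select (r q.1.1 q.1.2) q.1.2 q.2.1 q.2.2.1 q.2.2.2 := by
  have hM : Primrec fun q : (ℕ × ℕ) × List ℕ × ℕ × List ℕ => q.2.2.1 :=
    Primrec.fst.comp (Primrec.snd.comp Primrec.snd)
  have harg : Primrec fun p : ((ℕ × ℕ) × List ℕ × ℕ × List ℕ) × ℕ =>
      (p.1.1, p.1.2.1, p.1.2.2.1, candidate p.1.2.2.1 p.2) :=
    (Primrec.fst.comp Primrec.fst).pair (((Primrec.fst.comp Primrec.snd).comp Primrec.fst).pair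
      ((hM.comp Primrec.fst).pair (primrec_candidate.comp (hM.comp Primrec.fst) Primrec.snd)))
  refine Primrec.ite (primrecPred_fits hr) (Primrec.snd.comp (Primrec.snd.comp Primrec.snd)) ?_
  refine primrec_candidate.comp hM (Primrec.list_findIdx
    (Primrec.list_range.comp (Primrec.snd.comp Primrec.fst)) ?_)
  exact ((primrecPred_fits hr).comp harg).decide

theorem primrec_extend : Primrec₂ extend := by
  refine Primrec.list_append.comp (Primrec.list_append.comp Primrec.snd
    (Primrec.list_map (Primrec.list_drop.comp (Primrec.list_length.comp Primrec.snd) Primrec.fst)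
      ?_)) (Primrec.list_range.comp (Primrec.succ.comp (Primrec.list_length.comp Primrec.fst)))
  exact (Primrec.list_getD 0).comp (Primrec.snd.comp Primrec.fst)
    (Primrec.list_idxOf.comp Primrec.snd (Primrec.fst.comp Primrec.fst))

theorem primrec_act (hr : Primrec fun p : ℕ × ℕ × ℕ => r p.1 p.2.1 p.2.2) :
    Primrec fun p : (ℕ × ℕ) × State => act (r p.1.1 p.1.2) p.1.1 p.1.2 p.2 := by
  have hj : Primrec fun p : (ℕ × ℕ) × State => p.1.1 := Primrec.fst.comp Primrec.fst
  have hst : Primrec fun p : (ℕ × ℕ) × State => p.2.1 := Primrec.fst.comp Primrec.snd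
  have hcol : Primrec fun p : (ℕ × ℕ) × State => p.2.2 := Primrec.snd.comp Primrec.snd
  have hM : Primrec fun p : (ℕ × ℕ) × State => (p.2.1.getD p.1.1 []).length :=
    Primrec.list_length.comp ((Primrec.list_getD []).comp hst hj)
  have hold : Primrec fun p : (ℕ × ℕ) × State => p.2.1.getD (p.1.1 + 1) [] :=
    (Primrec.list_getD []).comp hst (Primrec.succ.comp hj)
  have hsel : Primrec fun p : (ℕ × ℕ) × State =>
      select (r p.1.1 p.1.2) p.1.2 p.2.2 (p.2.1.getD p.1.1 []).length
        (p.2.1.getD (p.1.1 + 1) []) :=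
    (primrec_select hr).comp (Primrec.fst.pair (hcol.pair (hM.pair hold)))
  have hext := primrec_extend.comp hcol hsel
  refine Primrec.ite ((primrecPred_fits hr).comp (Primrec.fst.pair (hcol.pair (hM.pair hsel))))
    (Primrec.pair (Primrec.list_append.comp
        (Primrec.list_take.comp (Primrec.succ.comp hj) hst)
        (Primrec.list_cons.comp hext (Primrec.const [])))
      (Primrec.list_map hext ?_)) Primrec.snd
  exact hr.comp ((hj.comp Primrec.fst).pair
    ((Primrec.snd.comp (Primrec.fst.comp Primrec.fst)).pair Primrec.snd))

theorem primrec_state {α : Type*} [Primcodable α] {fire : α → ℕ → ℕ} (hfire : Primrec₂ fire)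
    (hr : Primrec fun p : ℕ × ℕ × ℕ => r p.1 p.2.1 p.2.2) :
    Primrec₂ fun a s => state r (fire a) s := by
  have hnode : Primrec₂ node := Primrec.nat_min.comp Primrec.fst
    (Primrec.pred.comp (Primrec.list_length.comp (Primrec.fst.comp Primrec.snd)))
  have hs : Primrec fun p : (α × ℕ) × ℕ × State => p.2.1 := Primrec.fst.comp Primrec.snd
  have hσ : Primrec fun p : (α × ℕ) × ℕ × State => p.2.2 := Primrec.snd.comp Primrec.snd
  have hj : Primrec fun p : (α × ℕ) × ℕ × State => node (fire p.1.1 p.2.1) p.2.2 :=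
    hnode.comp (hfire.comp (Primrec.fst.comp Primrec.fst) hs) hσ
  refine (Primrec.nat_rec' (f := fun p : α × ℕ => p.2) (g := fun _ => (([[]], []) : State))
    (h := fun p q => act (r (node (fire p.1 q.1) q.2) q.1) (node (fire p.1 q.1) q.2) q.1 q.2)
    Primrec.snd (Primrec.const _) ((primrec_act hr).comp ((hj.pair hs).pair hσ))).of_eq ?_
  rintro ⟨a, s⟩
  induction s with
  | zero => rfl
  | succ s ih => simp only [state, ← ih]

end CeerConstruction

/-- The predicate, at stage `t`, that `t` codes a pair `(y, z)` such that `z` is the least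
stage at which `V` holds of all numbers up to `y`. -/
def FirstStage (V : ℕ → ℕ → Prop) (t : ℕ) : Prop :=
  (∀ y < t.unpair.1 + 1, V t.unpair.2 y) ∧
    (t.unpair.2 = 0 ∨ ¬∀ y < t.unpair.1 + 1, V (t.unpair.2 - 1) y)

theorem frequently_firstStage_iff {V : ℕ → ℕ → Prop}
    (hV : ∀ k k' y, k ≤ k' → V k y → V k' y) :
    (∃ᶠ t in atTop, FirstStage V t) ↔ ∀ y, ∃ k, V k y := by
  rw [Nat.frequently_atTop_iff_infinite]
  constructor
  · intro h
    by_contra! hno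
    obtain ⟨y, hy⟩ := hno
    refine h (Set.Finite.of_injOn (f := fun t => t.unpair.1) (t := Set.Iio y) ?_ ?_
      (Set.finite_Iio y))
    · intro t ht
      by_contra! hle
      exact hy _ (ht.1 y (by simp only [Set.mem_Iio, not_lt] at hle; omega))
    · intro t ht u hu htu
      replace htu : t.unpair.1 = u.unpair.1 := htu
      have key : ∀ t u, FirstStage V t → FirstStage V u → t.unpair.1 = u.unpair.1 →
          t.unpair.2 ≤ u.unpair.2 := by
        intro t u ht hu h
        by_contra! hlt
        refine ht.2.elim (fun h0 => by omega) fun hn => hn fun y hy => ?_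
        exact hV _ _ _ (by omega) (hu.1 y (h ▸ hy))
      rw [← Nat.pair_unpair t, ← Nat.pair_unpair u, htu,
        (key t u ht hu htu).antisymm (key u t hu ht htu.symm)]
  · intro h
    classical
    have hall : ∀ n, ∃ k, ∀ y < n, V k y := by
      intro n
      induction n with
      | zero => exact ⟨0, by simp⟩
      | succ n ih =>
        obtain ⟨k, hk⟩ := ih
        obtain ⟨k', hk'⟩ := h n
        refine ⟨max k k', fun y hy => ?_⟩
        rcases Nat.lt_succ_iff_lt_or_eq.1 hy with hy | rfl
        · exact hV _ _ _ (le_max_left _ _) (hk y hy)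
        · exact hV _ _ _ (le_max_right _ _) hk'
    refine Set.infinite_of_injective_forall_mem
      (f := fun y => Nat.pair y (Nat.find (hall (y + 1)))) (fun y y' h => ?_) fun y => ?_
    · exact (Nat.pair_eq_pair.1 h).1
    · show FirstStage V _
      simp only [FirstStage, Nat.unpair_pair]
      refine ⟨Nat.find_spec (hall (y + 1)), or_iff_not_imp_left.2 fun h0 => ?_⟩
      exact Nat.find_min (hall (y + 1)) (by omega)

theorem partrec_rfind_unpair {F : ℕ × ℕ × ℕ × ℕ → Bool} (hF : Computable F) :
    Partrec fun m : ℕ => Nat.rfind fun z =>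
      Part.some (F (m.unpair.1, m.unpair.2.unpair.1, m.unpair.2.unpair.2, z)) := by
  have h1 : Primrec fun p : ℕ × ℕ => p.1.unpair := Primrec.unpair.comp Primrec.fst
  have h2 : Primrec fun p : ℕ × ℕ => p.1.unpair.2.unpair :=
    Primrec.unpair.comp (Primrec.snd.comp h1)
  have h3 : Primrec fun p : ℕ × ℕ =>
      (p.1.unpair.1, p.1.unpair.2.unpair.1, p.1.unpair.2.unpair.2, p.2) :=
    (Primrec.fst.comp h1).pair ((Primrec.fst.comp h2).pair
      ((Primrec.snd.comp h2).pair Primrec.snd))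
  have h4 : Computable₂ fun m z : ℕ =>
      F (m.unpair.1, m.unpair.2.unpair.1, m.unpair.2.unpair.2, z) := hF.comp h3.to_comp
  exact Partrec.rfind h4.partrec₂

theorem IsSigma03.exists_primrec_s8 {S : Set ℕ} (h : IsSigma03 S) :
    ∃ q : ℕ → ℕ → ℕ → Bool, (Primrec fun p : ℕ × ℕ × ℕ => q p.1 p.2.1 p.2.2) ∧
      ∀ n, n ∈ S ↔ ∃ x, ∃ᶠ t in atTop, q n x t = true := by
  classical
  obtain ⟨R, hR, hS⟩ := h
  have hpart := partrec_rfind_unpair hR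
  obtain ⟨c, hc⟩ := Nat.Partrec.Code.exists_code.1 (Partrec.nat_iff.1 hpart)
  let V : ℕ → ℕ → ℕ → ℕ → Prop := fun n x k y =>
    (Nat.Partrec.Code.evaln k c (Nat.pair n (Nat.pair x y))).isSome = true
  have hVmono : ∀ n x k k' y, k ≤ k' → V n x k y → V n x k' y := by
    intro n x k k' y hk h
    obtain ⟨a, ha⟩ := Option.isSome_iff_exists.1 h
    exact Option.isSome_iff_exists.2 ⟨a, Nat.Partrec.Code.evaln_mono hk ha⟩
  have hVspec : ∀ n x y, (∃ k, V n x k y) ↔ ∃ z, R n x y z = true := by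
    intro n x y
    have h1 : (∃ k, V n x k y) ↔ (c.eval (Nat.pair n (Nat.pair x y))).Dom := by
      simp only [Part.dom_iff_mem, Nat.Partrec.Code.evaln_complete, V,
        Option.isSome_iff_exists, Option.mem_def]
      exact exists_comm
    rw [h1, hc]
    simp only [Nat.unpair_pair]
    refine Nat.rfind_dom.trans ?_
    simp only [Part.mem_some_iff, Part.some_dom, implies_true, and_true, eq_comm (a := true)]
  have hVprim : PrimrecPred fun p : (ℕ × ℕ) × ℕ × ℕ => V p.1.1 p.1.2 p.2.1 p.2.2 := by
    have harg : Primrec fun p : (ℕ × ℕ) × ℕ × ℕ =>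
        ((p.2.1, c), Nat.pair p.1.1 (Nat.pair p.1.2 p.2.2)) :=
      ((Primrec.fst.comp Primrec.snd).pair (Primrec.const c)).pair
        (Primrec₂.natPair.comp (Primrec.fst.comp Primrec.fst)
          (Primrec₂.natPair.comp (Primrec.snd.comp Primrec.fst) (Primrec.snd.comp Primrec.snd)))
    exact Primrec.eq.comp
      (Primrec.option_isSome.comp (Nat.Partrec.Code.primrec_evaln.comp harg)) (Primrec.const true)
  have hall : PrimrecPred fun p : (ℕ × ℕ) × ℕ × ℕ => ∀ y < p.2.2, V p.1.1 p.1.2 p.2.1 y :=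
    PrimrecRel.forall_lt_comp (P := fun y (p : (ℕ × ℕ) × ℕ × ℕ) => V p.1.1 p.1.2 p.2.1 y)
      (hVprim.comp ((Primrec.fst.comp Primrec.snd).pair
        ((Primrec.fst.comp (Primrec.snd.comp Primrec.snd)).pair Primrec.fst)))
      (Primrec.snd.comp Primrec.snd)
  have hfirst : PrimrecPred fun p : ℕ × ℕ × ℕ => FirstStage (V p.1 p.2.1) p.2.2 := by
    have hnx : Primrec fun p : ℕ × ℕ × ℕ => (p.1, p.2.1) :=
      Primrec.fst.pair (Primrec.fst.comp Primrec.snd)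
    have ht : Primrec fun p : ℕ × ℕ × ℕ => p.2.2.unpair :=
      Primrec.unpair.comp (Primrec.snd.comp Primrec.snd)
    have hy := Primrec.succ.comp (Primrec.fst.comp ht)
    have hz := Primrec.snd.comp ht
    exact (hall.comp (hnx.pair (hz.pair hy))).and ((Primrec.eq.comp hz (Primrec.const 0)).or
      (hall.comp (hnx.pair ((Primrec.pred.comp hz).pair hy))).not)
  refine ⟨fun n x t => decide (FirstStage (V n x) t), hfirst.decide, fun n => ?_⟩
  simp only [decide_eq_true_eq, frequently_firstStage_iff (hVmono n _), hVspec, hS]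

/-- The sequence calling for `k` whenever it meets the code of a pair `(k, t)` with `p k t`. -/
def fireOf (p : ℕ → ℕ → Bool) (s : ℕ) : ℕ :=
  if p s.unpair.1 s.unpair.2 = true then s.unpair.1 else s

theorem frequently_fireOf_iff (p : ℕ → ℕ → Bool) (k : ℕ) :
    (∃ᶠ s in atTop, fireOf p s = k) ↔ ∃ᶠ t in atTop, p k t = true := by
  simp only [Nat.frequently_atTop_iff_infinite]
  constructor
  · refine fun h hfin => h ((((hfin.image (Nat.pair k)).insert k)).subset fun s hs => ?_)
    simp only [Set.mem_ofPred_eq, fireOf] at hs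
    split_ifs at hs with hp
    · subst hs
      exact Or.inr ⟨s.unpair.2, hp, Nat.pair_unpair s⟩
    · exact Or.inl hs
  · intro h
    refine (h.image (f := Nat.pair k) fun t _ t' _ h => (Nat.pair_eq_pair.1 h).2).mono ?_
    rintro _ ⟨t, ht, rfl⟩
    replace ht : p k t = true := ht
    simp [fireOf, ht]

/-- A form of the recursion theorem with a parameter: `Q` may refer to the index of the set
which it enumerates. -/
theorem exists_computable_index {Q : ℕ × ℕ → ℕ × ℕ → Bool} (hQ : Primrec₂ Q) :
    ∃ f : ℕ → ℕ, Computable f ∧ ∀ n, W (f n) = {m | ∃ s, Q (f n, n) (m, s) = true} := by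
  have hpart : Partrec₂ fun (c : Nat.Partrec.Code) (v : ℕ) => Nat.rfind fun s =>
      Part.some (Q (Encodable.encode (c.curry v.unpair.1), v.unpair.1) (v.unpair.2, s)) := by
    have h1 : Primrec fun q : (Nat.Partrec.Code × ℕ) × ℕ => q.1.2.unpair :=
      Primrec.unpair.comp (Primrec.snd.comp Primrec.fst)
    have h2 : Primrec fun q : (Nat.Partrec.Code × ℕ) × ℕ =>
        Encodable.encode (q.1.1.curry q.1.2.unpair.1) :=
      Primrec.encode.comp (Nat.Partrec.Code.primrec₂_curry.comp (Primrec.fst.comp Primrec.fst)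
        (Primrec.fst.comp h1))
    have h3 : Primrec₂ fun (q : Nat.Partrec.Code × ℕ) (s : ℕ) =>
        Q (Encodable.encode (q.1.curry q.2.unpair.1), q.2.unpair.1) (q.2.unpair.2, s) :=
      hQ.comp (h2.pair (Primrec.fst.comp h1)) ((Primrec.snd.comp h1).pair Primrec.snd)
    exact Partrec.rfind h3.to_comp.partrec₂
  obtain ⟨c, hc⟩ := Nat.Partrec.Code.fixed_point₂ hpart
  refine ⟨fun n => Encodable.encode (c.curry n), (Primrec.encode.comp
    (Nat.Partrec.Code.primrec₂_curry.comp (Primrec.const c) Primrec.id)).to_comp, fun n => ?_⟩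
  ext m
  simp only [W, Set.mem_ofPred_eq, Denumerable.ofNat_encode, Nat.Partrec.Code.eval_curry, hc,
    Nat.unpair_pair]
  refine Nat.rfind_dom.trans ?_
  simp only [Part.mem_some_iff, Part.some_dom, implies_true, and_true, eq_comm (a := true)]

namespace CeerConstruction

/-- The pair coded by `m` has been made equivalent in the state `σ`. -/
def Identified (σ : State) (m : ℕ) : Prop :=
  m.unpair.1 < σ.2.length ∧ m.unpair.2 < σ.2.length ∧
    σ.2.getD m.unpair.1 0 = σ.2.getD m.unpair.2 0

instance (σ : State) (m : ℕ) : Decidable (Identified σ m) := by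
  unfold Identified; infer_instance

theorem primrecRel_identified : PrimrecRel Identified := by
  have hm : Primrec fun p : State × ℕ => p.2.unpair := Primrec.unpair.comp Primrec.snd
  have hx := Primrec.fst.comp hm
  have hy := Primrec.snd.comp hm
  have hcol : Primrec fun p : State × ℕ => p.1.2 := Primrec.snd.comp Primrec.fst
  have hlen := Primrec.list_length.comp hcol
  exact (Primrec.nat_lt.comp hx hlen).and ((Primrec.nat_lt.comp hy hlen).and
    (Primrec.eq.comp ((Primrec.list_getD 0).comp hcol hx) ((Primrec.list_getD 0).comp hcol hy)))

theorem exists_ceer_eq {r : ℕ → ℕ → ℕ → ℕ}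
    (hr : Primrec fun p : ℕ × ℕ × ℕ => r p.1 p.2.1 p.2.2)
    {fire : ℕ × ℕ → ℕ → ℕ} (hfire : Primrec₂ fire) :
    ∃ f : ℕ → ℕ, Computable f ∧
      ∀ n, ceer (f n) = Relation.EqvGen (Rel r (fire (f n, n))) := by
  have hQ : Primrec₂ fun (a b : ℕ × ℕ) => decide (Identified (state r (fire a) b.2) b.1) :=
    (primrecRel_identified.comp ((primrec_state hfire hr).comp Primrec.fst
      (Primrec.snd.comp Primrec.snd)) (Primrec.fst.comp Primrec.snd)).decide
  obtain ⟨f, hf, hW⟩ := exists_computable_index hQ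
  refine ⟨f, hf, fun n => ?_⟩
  have : (fun x y => Nat.pair x y ∈ W (f n)) = Rel r (fire (f n, n)) := by
    funext x y
    simp [hW, Rel, Identified]
  rw [ceer, this]

end CeerConstruction

theorem CeerEquiv.mem_iff {S : Set ℕ} (hcl : S = ceerClosure S) {i j : ℕ}
    (h : CeerEquiv (ceer i) (ceer j)) : i ∈ S ↔ j ∈ S := by
  constructor <;> intro hS <;> rw [hcl]
  · exact ⟨i, hS, h.2, h.1⟩
  · exact ⟨j, hS, h⟩

/-- The conditions whose infinite recurrence is decided by the nodes: the even nodes belong to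
`p`, the odd ones to `q`. -/
def interleave (p q : ℕ → ℕ → Bool) (k t : ℕ) : Bool :=
  bif k % 2 == 0 then p (k / 2) t else q (k / 2) t

/-- If `S = [S]` is Π⁰₃ and proper on the infinite ceers, then `S` is Π⁰₃-complete. -/
theorem ceerClosure_Pi03Complete (S : Set ℕ) (hcl : S = ceerClosure S) (hS : IsPi03 S)
    (hproper : ProperOnInfiniteCeers S) :
    ∀ A : Set ℕ, IsPi03 A → (· ∈ A) ≤₀ (· ∈ S) := by
  intro A hA
  obtain ⟨i, j, hi, hj, hiS, hjS⟩ := hproper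
  rw [← hcl] at hiS hjS
  obtain ⟨p, hp, hpA⟩ := IsSigma03.exists_primrec_s8 hA
  obtain ⟨q, hq, hqS⟩ := IsSigma03.exists_primrec_s8 hS
  let D : ℕ → ℕ := fun k => if k % 2 = 0 then j else i
  have hDeven : ∀ k, k % 2 = 0 → D k = j := fun k hk => if_pos hk
  have hDodd : ∀ k, k % 2 ≠ 0 → D k = i := fun k hk => if_neg hk
  have hparity : Primrec fun k : ℕ => k % 2 :=
    Primrec.nat_mod.comp Primrec.id (Primrec.const 2)
  have hr : Primrec fun p : ℕ × ℕ × ℕ => CeerApprox.approx (D p.1) p.2.1 p.2.2 := by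
    refine (Primrec.ite (Primrec.eq.comp (hparity.comp Primrec.fst) (Primrec.const 0))
      ((CeerApprox.primrec_approx j).comp (Primrec.fst.comp Primrec.snd)
        (Primrec.snd.comp Primrec.snd))
      ((CeerApprox.primrec_approx i).comp (Primrec.fst.comp Primrec.snd)
        (Primrec.snd.comp Primrec.snd))).of_eq fun p => ?_
    simp only [D]
    split_ifs <;> rfl
  have hDinf : ∀ k, HasInfinitelyManyClasses (ceer (D k)) := by
    intro k
    simp only [D]
    split_ifs <;> assumption
  let fire : ℕ × ℕ → ℕ → ℕ := fun a => fireOf (interleave (p a.2) (q a.1))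
  have hfire : Primrec₂ fire := by
    have hk : Primrec fun x : (ℕ × ℕ) × ℕ => x.2.unpair.1 :=
      Primrec.fst.comp (Primrec.unpair.comp Primrec.snd)
    have ht : Primrec fun x : (ℕ × ℕ) × ℕ => x.2.unpair.2 :=
      Primrec.snd.comp (Primrec.unpair.comp Primrec.snd)
    have hk2 : Primrec fun x : (ℕ × ℕ) × ℕ => x.2.unpair.1 / 2 :=
      Primrec.nat_div.comp hk (Primrec.const 2)
    have hpq : Primrec fun x : (ℕ × ℕ) × ℕ =>
        interleave (p x.1.2) (q x.1.1) x.2.unpair.1 x.2.unpair.2 :=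
      Primrec.cond (Primrec.beq.comp (hparity.comp hk) (Primrec.const 0))
        (hp.comp ((Primrec.snd.comp Primrec.fst).pair (hk2.pair ht)))
        (hq.comp ((Primrec.fst.comp Primrec.fst).pair (hk2.pair ht)))
    exact Primrec.ite (Primrec.eq.comp hpq (Primrec.const true)) hk Primrec.snd
  obtain ⟨f, hf, hceer⟩ := CeerConstruction.exists_ceer_eq
    (r := fun k => CeerApprox.approx (D k)) hr hfire
  have hfreq : ∀ n k, (∃ᶠ s in atTop, fire (f n, n) s = k) ↔
      if k % 2 = 0 then ∃ᶠ t in atTop, p n (k / 2) t = true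
        else ∃ᶠ t in atTop, q (f n) (k / 2) t = true := by
    intro n k
    simp only [fire, frequently_fireOf_iff]
    by_cases hk : k % 2 = 0 <;> simp [interleave, hk]
  have hcore : ∀ n, (∃ k, ∃ᶠ s in atTop, fire (f n, n) s = k) →
      ∃ k, (∃ᶠ s in atTop, fire (f n, n) s = k) ∧ CeerEquiv (ceer (f n)) (ceer (D k)) := by
    intro n hn
    rw [hceer]
    exact CeerConstruction.ceerEquiv_eqvGen (fun k => CeerApprox.isApprox (D k))
      (fun k => CeerApprox.ceer_equivalence (D k)) hDinf
      ((CeerConstruction.primrec_state (r := fun k => CeerApprox.approx (D k)) hfire hr).comp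
        (Primrec.const (f n, n))
        Primrec.id).to_comp hn
  have hcase : ∀ n, (∃ k, ∃ᶠ s in atTop, fire (f n, n) s = k) → n ∉ A ∧ f n ∉ S := by
    intro n hn
    obtain ⟨k, hk, hequiv⟩ := hcore n hn
    rw [hfreq] at hk
    split_ifs at hk with hpar
    · rw [hDeven k hpar] at hequiv
      exact ⟨(hpA n).2 ⟨_, hk⟩, fun h => hjS ((hequiv.mem_iff hcl).1 h)⟩
    · rw [hDodd k hpar] at hequiv
      exact absurd ((hequiv.mem_iff hcl).2 hiS) ((hqS (f n)).2 ⟨_, hk⟩)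
  refine ⟨f, hf, fun n => ⟨fun hnA => ?_, fun hfS => ?_⟩⟩
  · by_contra hfS
    obtain ⟨x, hx⟩ := (hqS (f n)).1 hfS
    exact (hcase n ⟨2 * x + 1, (hfreq _ _).2 (by
      have h1 : (2 * x + 1) % 2 ≠ 0 := by omega
      have h2 : (2 * x + 1) / 2 = x := by omega
      rwa [if_neg h1, h2])⟩).1 hnA
  · by_contra hnA
    obtain ⟨x, hx⟩ := (hpA n).1 hnA
    exact (hcase n ⟨2 * x, (hfreq _ _).2 (by
      have h1 : (2 * x) % 2 = 0 := by omega
      have h2 : (2 * x) / 2 = x := by omega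
      rwa [if_pos h1, h2])⟩).2 hfS
end
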